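/- (DNN approximations overcome the curse of dimensionality for semilinear heat PDEs.) Let ρ denote the componentwise rectifier: for every d ∈ ℕ and x = (x_1,…,x_d) ∈ ℝ^d, ρ(x) = (max{x_1,0},…,max{x_d,0}). Let 𝐍 = ∪_{L∈ℕ} ∪_{l_0,…,l_L∈ℕ} ( ⨉_{k=1}^L ( ℝ^{l_k×l_{k−1}} × ℝ^{l_k} ) ) be the set of neural networks, let ℛ: 𝐍 → ∪_{k,l∈ℕ} C(ℝ^k,ℝ^l) and 𝒫: 𝐍 → ℕ satisfy for all L ∈ ℕ, l_0,…,l_L ∈ ℕ, Φ = ((W_1,B_1),…,(W_L,B_L)) ∈ ⨉_{k=1}^L (ℝ^{l_k×l_{k−1}}×ℝ^{l_k}), and all x_0 ∈ ℝ^{l_0}, x_1 ∈ ℝ^{l_1}, …, x_L ∈ ℝ^{l_L} with x_k = ρ(W_k x_{k−1} + B_k) for all k ∈ ℕ ∩ (0,L), that ℛ(Φ) ∈ C(ℝ^{l_0}, ℝ^{l_L}), (ℛ(Φ))(x_0) = W_L x_{L−1} + B_L, and 𝒫(Φ) = Σ_{k=1}^L l_k(l_{k−1}+1). Let T, κ ∈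 (0,∞), let (𝔤_{d,ε})_{(d,ε)∈ℕ×(0,1]} ⊆ 𝐍, let u_d ∈ C^{1,2}([0,T]×ℝ^d,ℝ) for d ∈ ℕ, let f: ℝ → ℝ be Lipschitz continuous, and assume for all d ∈ ℕ, x = (x_1,…,x_d) ∈ ℝ^d, ε ∈ (0,1], t ∈ [0,T] that ℛ(𝔤_{d,ε}) ∈ C(ℝ^d,ℝ), ε|u_d(t,x)| + |u_d(0,x) − (ℛ(𝔤_{d,ε}))(x)| ≤ ε κ d^κ (1 + Σ_{i=1}^d |x_i|^κ), 𝒫(𝔤_{d,ε}) ≤ κ d^κ ε^{−κ}, and ∂u_d/∂t(t,x) = Δ_x u_d(t,x) + f(u_d(t,x)). Then there exist neural networks (𝔲_{d,ε})_{(d,ε)∈ℕ×(0,1]} ⊆ 𝐍 and a constant c ∈ ℝ such that for all d ∈ ℕ, ε ∈ (0,1] it holds that ℛ(𝔲_{d,ε}) ∈ C(ℝ^d,ℝ), 𝒫(𝔲_{d,ε}) ≤ c d^c ε^{−c}, and ( ∫_{[0,1]^d} | u_d(T,x) − (ℛ(𝔲_{d,ε}))(x) |² dx )^{1/2} ≤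 ε. -/

import Mathlib

open MeasureTheory ProbabilityTheory Set

noncomputable section

/-- First spatial partial derivative `∂g/∂x_i` of a function `g : ℝ^d → ℝ`. -/
def spatialPD1 (d : ℕ) (g : (Fin d → ℝ) → ℝ) (i : Fin d) (x : Fin d → ℝ) : ℝ :=
  fderiv ℝ g x (Pi.single i 1)

/-- Second spatial partial derivative `∂²g/(∂x_i ∂x_j)` of a function `g : ℝ^d → ℝ`. -/
def spatialPD2 (d : ℕ) (g : (Fin d → ℝ) → ℝ) (i j : Fin d) (x : Fin d → ℝ) : ℝ :=
  fderiv ℝ (fun y => fderiv ℝ g y (Pi.single i 1)) x (Pi.single j 1)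

/-- The Laplacian `Δg` of a function `g : ℝ^d → ℝ`. -/
def laplacian (d : ℕ) (g : (Fin d → ℝ) → ℝ) (x : Fin d → ℝ) : ℝ :=
  ∑ i : Fin d, spatialPD2 d g i i x

/-- `u ∈ C^{1,2}([α,β] × ℝ^d, ℝ)`: `u` is continuous, once continuously differentiable in
the time variable and twice continuously differentiable in the space variable, with all
partial derivatives jointly continuous. -/
def IsC12On (d : ℕ) (α β : ℝ) (u : ℝ → (Fin d → ℝ) → ℝ) : Prop :=
  ContinuousOn (fun p : ℝ × (Fin d → ℝ) => u p.1 p.2) (Icc α β ×ˢ univ) ∧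
  (∀ x, DifferentiableOn ℝ (fun t => u t x) (Icc α β)) ∧
  ContinuousOn (fun p : ℝ × (Fin d → ℝ) =>
    derivWithin (fun s => u s p.2) (Icc α β) p.1) (Icc α β ×ˢ univ) ∧
  (∀ t ∈ Icc α β, ContDiff ℝ 2 (u t)) ∧
  (∀ i : Fin d, ContinuousOn (fun p : ℝ × (Fin d → ℝ) => spatialPD1 d (u p.1) i p.2)
    (Icc α β ×ˢ univ)) ∧
  (∀ i j : Fin d, ContinuousOn (fun p : ℝ × (Fin d → ℝ) => spatialPD2 d (u p.1) i j p.2)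
    (Icc α β ×ˢ univ))


/-- A (fully connected feedforward) neural network
`Φ = ((W_1,B_1),…,(W_L,B_L)) ∈ ⨉_{k=1}^L (ℝ^{l_k×l_{k−1}} × ℝ^{l_k})`:
`depth + 1` is the number `L ∈ ℕ` of affine layers, `l k` is the number of neurons in
the `(k+1)`-th layer, `W k` is the weight matrix and `B k` the bias vector of the
`(k+1)`-th affine map.  (The data for `k > depth` is irrelevant.) -/
structure NeuralNet where
  depth : ℕ
  l : ℕ → ℕ
  lpos : ∀ k, 0 < l k
  W : (k : ℕ) → Matrix (Fin (l (k + 1))) (Fin (l k)) ℝ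
  B : (k : ℕ) → Fin (l (k + 1)) → ℝ

namespace NeuralNet

/-- The number of affine layers `L ∈ ℕ` of a neural network. -/
def L (Φ : NeuralNet) : ℕ := Φ.depth + 1

/-- The vectors `x_k = ρ(W_k x_{k−1} + B_k)`, `0 < k < L`, obtained by alternately
applying the affine maps and the componentwise rectifier
`ρ(y) = (max{y_1,0}, …, max{y_m,0})`. -/
def hiddenEval (Φ : NeuralNet) : (k : ℕ) → (Fin (Φ.l 0) → ℝ) → (Fin (Φ.l k) → ℝ)
  | 0 => fun x => x
  | k + 1 => fun x i => max ((Φ.W k).mulVec (Φ.hiddenEval k x) i + Φ.B k i) 0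

/-- The realization function `ℛ(Φ) ∈ C(ℝ^{l_0}, ℝ^{l_L})`, i.e.
`(ℛ(Φ))(x_0) = W_L x_{L−1} + B_L` (no rectifier after the last affine map). -/
def realize (Φ : NeuralNet) (x : Fin (Φ.l 0) → ℝ) : Fin (Φ.l Φ.L) → ℝ :=
  (Φ.W Φ.depth).mulVec (Φ.hiddenEval Φ.depth x) + Φ.B Φ.depth

/-- The number of parameters `𝒫(Φ) = Σ_{k=1}^L l_k (l_{k−1} + 1)` of a neural network. -/
def params (Φ : NeuralNet) : ℕ :=
  ∑ k ∈ Finset.range Φ.L, Φ.l (k + 1) * (Φ.l k + 1)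

/-- The realization of a neural network with input dimension `d` and output dimension `1`,
viewed as a real-valued function `ℝ^d → ℝ`. -/
def realizeScalar (Φ : NeuralNet) {d : ℕ} (h0 : Φ.l 0 = d) (h1 : Φ.l Φ.L = 1)
    (x : Fin d → ℝ) : ℝ :=
  Φ.realize (fun i => x (Fin.cast h0 i)) (Fin.cast h1.symm 0)

end NeuralNet

/-- `RectNet d k w h`: the function `h : ℝ^d → ℝ` is the realization of a rectifier network with
`k + 1` hidden layers of common width `w`; `X j i` is the `i`-th neuron of the `j`-th hidden
layer. -/
def RectNet (d k w : ℕ) (h : (Fin d → ℝ) → ℝ) : Prop :=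
  ∃ X : ℕ → ℕ → (Fin d → ℝ) → ℝ,
    (∀ i < w, ∃ (a : Fin d → ℝ) (b : ℝ), ∀ x, X 0 i x = max (∑ j, a j * x j + b) 0) ∧
    (∀ k' < k, ∀ i < w, ∃ (a : ℕ → ℝ) (b : ℝ), ∀ x,
      X (k' + 1) i x = max (∑ j ∈ Finset.range w, a j * X k' j x + b) 0) ∧
    ∃ (a : ℕ → ℝ) (b : ℝ), ∀ x, h x = ∑ j ∈ Finset.range w, a j * X k j x + b

namespace RectNet

variable {d k w w' : ℕ} {h h' : (Fin d → ℝ) → ℝ}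

theorem const (d k w : ℕ) (c : ℝ) : RectNet d k w (fun _ => c) :=
  ⟨fun _ _ _ => 0, fun _ _ => ⟨0, 0, by simp⟩, fun _ _ _ _ => ⟨0, 0, by simp⟩, 0, c, by simp⟩

theorem comp_add (hN : RectNet d k w h) (v : Fin d → ℝ) : RectNet d k w (fun x => h (x + v)) := by
  obtain ⟨X, h0, hs, a, b, hh⟩ := hN
  refine ⟨fun j i x => X j i (x + v), fun i hi => ?_, fun k' hk i hi => ?_, a, b, fun x => hh _⟩
  · obtain ⟨a, b, h⟩ := h0 i hi
    refine ⟨a, ∑ j, a j * v j + b, fun x => ?_⟩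
    simp [h, mul_add, Finset.sum_add_distrib, add_assoc]
  · obtain ⟨a, b, h⟩ := hs k' hk i hi
    exact ⟨a, b, fun x => h _⟩

theorem const_mul (hN : RectNet d k w h) (c : ℝ) : RectNet d k w (fun x => c * h x) := by
  obtain ⟨X, h0, hs, a, b, hh⟩ := hN
  refine ⟨X, h0, hs, fun j => c * a j, c * b, fun x => ?_⟩
  simp [hh, mul_add, Finset.mul_sum, mul_assoc]

private theorem sum_range_ite (w w' : ℕ) (a a' x x' : ℕ → ℝ) :
    ∑ j ∈ Finset.range (w + w'), (if j < w then a j else a' (j - w)) *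
      (if j < w then x j else x' (j - w)) =
    ∑ j ∈ Finset.range w, a j * x j + ∑ j ∈ Finset.range w', a' j * x' j := by
  rw [Finset.sum_range_add]
  congr 1
  · refine Finset.sum_congr rfl fun j hj => ?_
    simp [Finset.mem_range.1 hj]
  · simp

theorem add (hN : RectNet d k w h) (hN' : RectNet d k w' h') :
    RectNet d k (w + w') (fun x => h x + h' x) := by
  obtain ⟨X, h0, hs, a, b, hh⟩ := hN
  obtain ⟨X', h0', hs', a', b', hh'⟩ := hN'
  refine ⟨fun j i x => if i < w then X j i x else X' j (i - w) x, fun i hi => ?_,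
    fun k' hk i hi => ?_, fun i => if i < w then a i else a' (i - w), b + b', fun x => ?_⟩
  · by_cases hiw : i < w
    · simpa [hiw] using h0 i hiw
    · simpa [hiw] using h0' (i - w) (by omega)
  · by_cases hiw : i < w
    · obtain ⟨a, b, h⟩ := hs k' hk i hiw
      refine ⟨fun i => if i < w then a i else (fun _ => 0) (i - w), b, fun x => ?_⟩
      rw [sum_range_ite w w' a (fun _ => 0) (fun j => X k' j x) (fun j => X' k' j x)]
      simp [hiw, h]
    · obtain ⟨a, b, h⟩ := hs' k' hk (i - w) (by omega)
      refine ⟨fun i => if i < w then (fun _ => 0) i else a (i - w), b, fun x => ?_⟩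
      rw [sum_range_ite w w' (fun _ => 0) a (fun j => X k' j x) (fun j => X' k' j x)]
      simp [hiw, h]
  · rw [sum_range_ite w w' a a' (fun j => X k j x) (fun j => X' k j x)]
    simp only [hh, hh']
    ring

theorem mono (hN : RectNet d k w h) (hw : w ≤ w') : RectNet d k w' h := by
  obtain ⟨e, rfl⟩ := Nat.exists_eq_add_of_le hw
  simpa using hN.add (const d k e 0)

theorem sum {ι : Type*} (s : Finset ι) (w : ι → ℕ) (h : ι → (Fin d → ℝ) → ℝ)
    (hN : ∀ i ∈ s, RectNet d k (w i) (h i)) :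
    RectNet d k (∑ i ∈ s, w i) (fun x => ∑ i ∈ s, h i x) := by
  classical
  induction s using Finset.induction_on with
  | empty => simpa using const d k 0 0
  | insert i s hi ih =>
    simp only [Finset.sum_insert hi]
    exact (hN i (by simp)).add (ih fun j hj => hN j (by simp [hj]))

/-- Composing with a one-dimensional shallow network adds one hidden layer. -/
theorem comp_shallow {m : ℕ} (hN : RectNet d k w h) (a b c : ℕ → ℝ) (c₀ : ℝ) (hm : m ≤ w) :
    RectNet d (k + 1) w
      (fun x => ∑ i ∈ Finset.range m, c i * max (a i * h x + b i) 0 + c₀) := by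
  obtain ⟨X, h0, hs, α, β, hh⟩ := hN
  refine ⟨fun j i x => if j ≤ k then X j i x else max (a i * h x + b i) 0, fun i hi => ?_,
    fun k' hk i hi => ?_, fun i => if i < m then c i else 0, c₀, fun x => ?_⟩
  · simpa using h0 i hi
  · by_cases hk' : k' < k
    · obtain ⟨a, b, h⟩ := hs k' hk' i hi
      refine ⟨a, b, fun x => ?_⟩
      simp [Nat.succ_le_iff.2 hk', hk'.le, h]
    · obtain rfl : k' = k := by omega
      refine ⟨fun j => a i * α j, a i * β + b i, fun x => ?_⟩
      simp [hh, mul_add, Finset.mul_sum, mul_assoc, add_assoc]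
  · simp only [add_le_iff_nonpos_right, nonpos_iff_eq_zero, one_ne_zero, if_false, ite_mul,
      zero_mul]
    rw [← Finset.sum_filter]
    congr 1
    refine Finset.sum_congr ?_ fun _ _ => rfl
    ext i
    simp only [Finset.mem_range, Finset.mem_filter]
    omega

theorem succ (hN : RectNet d k w h) (hw : 2 ≤ w) : RectNet d (k + 1) w h := by
  have := hN.comp_shallow (fun i => if i = 0 then 1 else -1) (fun _ => 0)
    (fun i => if i = 0 then 1 else -1) 0 hw
  convert this using 2 with x
  simp only [Finset.sum_range_succ, Finset.range_zero, Finset.sum_empty]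
  rcases le_total 0 (h x) with h0 | h0
  · simp [h0]
  · simp [h0]

theorem mono_depth {k' : ℕ} (hN : RectNet d k w h) (hw : 2 ≤ w) (hk : k ≤ k') :
    RectNet d k' w h := by
  induction k', hk using Nat.le_induction with
  | base => exact hN
  | succ n _ ih => exact ih.succ hw

/-- A function computed by `RectNet` is the realization of a neural network. -/
theorem exists_neuralNet (hN : RectNet d k w h) (hd : 0 < d) (hw : 0 < w) :
    ∃ (Φ : NeuralNet) (h0 : Φ.l 0 = d) (h1 : Φ.l Φ.L = 1),
      Φ.params ≤ (k + 2) * (w + d + 1) ^ 2 ∧ ∀ x, Φ.realizeScalar h0 h1 x = h x := by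
  obtain ⟨X, hX0, hs, α, β, hh⟩ := hN
  choose! a0 b0 h0 using hX0
  choose! a b hab using hs
  let l : ℕ → ℕ := fun j => if j = 0 then d else if j ≤ k + 1 then w else 1
  let A : ℕ → ℕ → ℕ → ℝ := fun j p q => if j = 0 then (if hq : q < d then a0 p ⟨q, hq⟩ else 0)
    else if j ≤ k then a (j - 1) p q else α q
  let Bv : ℕ → ℕ → ℝ := fun j p => if j = 0 then b0 p else if j ≤ k then b (j - 1) p else β
  let Φ : NeuralNet :=
    { depth := k + 1
      l := l
      lpos := fun j => by simp only [l]; split_ifs <;> omega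
      W := fun j p q => A j p q
      B := fun j p => Bv j p }
  have hl0 : Φ.l 0 = d := by simp [Φ, l]
  have hl1 : Φ.l Φ.L = 1 := by simp [Φ, l, NeuralNet.L]
  have key : ∀ (x : Fin d → ℝ) (j : ℕ), j ≤ k → ∀ i : Fin (Φ.l (j + 1)),
      Φ.hiddenEval (j + 1) (fun i => x (Fin.cast hl0 i)) i = X j i x := by
    intro x j
    induction j with
    | zero =>
      intro _ i
      have hi : (i : ℕ) < w := by simpa [Φ, l] using i.2
      rw [h0 i hi]
      simp only [NeuralNet.hiddenEval, Matrix.mulVec, dotProduct]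
      congr 1
      congr 1
      have : ∀ y : Fin (Φ.l 0), Φ.W 0 i y = a0 i (Fin.cast hl0 y) := by
        intro y
        have : (y : ℕ) < d := hl0 ▸ y.2
        simp [Φ, A, this, Fin.cast]
      simp only [this]
      exact (finCongr hl0).sum_comp (fun j => a0 i j * x j)
    | succ j ih =>
      intro hj i
      have hi : (i : ℕ) < w := by
        have := i.2
        have hj' : j + 1 ≤ k := hj
        simpa [Φ, l, hj'] using this
      rw [hab j (by omega) i hi, NeuralNet.hiddenEval]
      simp only [Matrix.mulVec, dotProduct]
      have hW : ∀ y : Fin (Φ.l (j + 1)), Φ.W (j + 1) i y = a j i y := by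
        intro y
        simp [Φ, A, hj]
      have hlw : Φ.l (j + 1) = w := by
        have : j ≤ k := by omega
        simp [Φ, l, this]
      have hB : Φ.B (j + 1) i = b j i := by simp [Φ, Bv, hj]
      simp only [hW, ih (by omega), hB]
      rw [Fin.sum_univ_eq_sum_range (fun q => a j i q * X j q x), hlw]
  refine ⟨Φ, hl0, hl1, ?_, fun x => ?_⟩
  · have hle : ∀ j, Φ.l j ≤ w + d := by
      intro j
      simp only [Φ, l]
      split_ifs <;> omega
    calc Φ.params ≤ ∑ j ∈ Finset.range (k + 2), (w + d + 1) ^ 2 := by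
          refine Finset.sum_le_sum fun j _ => ?_
          rw [sq]
          exact Nat.mul_le_mul ((hle _).trans (Nat.le_succ _)) (Nat.succ_le_succ (hle _))
      _ = _ := by simp
  · have hW : ∀ i (y : Fin (Φ.l (k + 1))), Φ.W (k + 1) i y = α y := by
      intro i y
      simp [Φ, A]
    have hB : ∀ i, Φ.B (k + 1) i = β := by intro i; simp [Φ, Bv]
    have hlw : Φ.l (k + 1) = w := by simp [Φ, l]
    have hout : ∀ r : Fin (Φ.l (k + 1 + 1)),
        (Φ.W (k + 1)).mulVec (Φ.hiddenEval (k + 1) fun i => x (Fin.cast hl0 i)) r + Φ.B (k + 1) r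
          = h x := by
      intro r
      rw [hh, hB]
      simp only [Matrix.mulVec, dotProduct, hW, key x k le_rfl]
      rw [Fin.sum_univ_eq_sum_range (fun q => α q * X k q x), hlw]
    exact hout _

end RectNet

namespace NeuralNet

theorem depth_le_params (Φ : NeuralNet) : Φ.depth ≤ Φ.params := by
  have : ∑ k ∈ Finset.range Φ.L, 1 ≤ Φ.params :=
    Finset.sum_le_sum fun k _ => Nat.mul_pos (Φ.lpos _) (Nat.succ_pos _)
  simp [L] at this
  omega

theorem width_le_params (Φ : NeuralNet) {k : ℕ} (hk : k < Φ.L) : Φ.l (k + 1) ≤ Φ.params := by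
  refine le_trans ?_ (Finset.single_le_sum (f := fun k => Φ.l (k + 1) * (Φ.l k + 1))
    (fun _ _ => Nat.zero_le _) (Finset.mem_range.2 hk))
  exact Nat.le_mul_of_pos_right _ (Nat.succ_pos _)

private theorem sum_range_dite {l w : ℕ} (hl : l ≤ w) (F G : Fin l → ℝ) :
    ∑ j ∈ Finset.range w, (if h : j < l then F ⟨j, h⟩ else 0) *
      (if h : j < l then G ⟨j, h⟩ else 0) = ∑ y, F y * G y := by
  obtain ⟨e, rfl⟩ := Nat.exists_eq_add_of_le hl
  rw [Finset.sum_range_add, ← Fin.sum_univ_eq_sum_range (fun j =>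
    (if h : j < l then F ⟨j, h⟩ else 0) * (if h : j < l then G ⟨j, h⟩ else 0))]
  simp

theorem rectNet_preactivation (Φ : NeuralNet) {w : ℕ} (n : ℕ) (hw : ∀ j ≤ n, Φ.l (j + 1) ≤ w)
    (r : Fin (Φ.l (n + 2))) :
    RectNet (Φ.l 0) n w
      (fun x => ((Φ.W (n + 1)).mulVec (Φ.hiddenEval (n + 1) x) + Φ.B (n + 1)) r) := by
  refine ⟨fun j i x => if h : i < Φ.l (j + 1) then Φ.hiddenEval (j + 1) x ⟨i, h⟩ else 0,
    fun i _ => ?_, fun k hk i _ => ?_,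
    fun j => if h : j < Φ.l (n + 1) then Φ.W (n + 1) r ⟨j, h⟩ else 0, Φ.B (n + 1) r, fun x => ?_⟩
  · by_cases hi : i < Φ.l (0 + 1)
    · refine ⟨fun j => Φ.W 0 ⟨i, hi⟩ j, Φ.B 0 ⟨i, hi⟩, fun x => ?_⟩
      exact dif_pos hi
    · exact ⟨0, 0, fun x => by simp [hi]⟩
  · by_cases hi : i < Φ.l (k + 1 + 1)
    · refine ⟨fun j => if h : j < Φ.l (k + 1) then Φ.W (k + 1) ⟨i, hi⟩ ⟨j, h⟩ else 0,
        Φ.B (k + 1) ⟨i, hi⟩, fun x => ?_⟩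
      refine (dif_pos hi).trans ?_
      beta_reduce
      rw [sum_range_dite (hw k hk.le)]
      rfl
    · exact ⟨0, 0, fun x => by simp [hi]⟩
  · rw [sum_range_dite (hw n le_rfl)]
    rfl

/-- The realization of a neural network is computed by a `RectNet`. -/
theorem rectNet (Φ : NeuralNet) {d : ℕ} (h0 : Φ.l 0 = d) (h1 : Φ.l Φ.L = 1) {w : ℕ}
    (hw : Φ.params ≤ w) (hw2 : 2 ≤ w) :
    RectNet d Φ.depth w (Φ.realizeScalar h0 h1) := by
  subst h0
  rcases Nat.eq_zero_or_pos Φ.depth with hd | hd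
  · set r : Fin (Φ.l Φ.L) := Fin.cast h1.symm 0
    have hW : ∃ (a : Fin (Φ.l 0) → ℝ) (b : ℝ), ∀ x,
        Φ.realizeScalar rfl h1 x = ∑ j, a j * x j + b := by
      unfold realizeScalar realize
      generalize Fin.cast h1.symm 0 = r
      have : ∀ n, n = 0 → ∀ (r : Fin (Φ.l (n + 1))), ∃ (a : Fin (Φ.l 0) → ℝ) (b : ℝ),
          ∀ x : Fin (Φ.l 0) → ℝ, ((Φ.W n).mulVec (Φ.hiddenEval n x) + Φ.B n) r
            = ∑ j, a j * x j + b := by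
        rintro n rfl r
        exact ⟨fun j => Φ.W 0 r j, Φ.B 0 r, fun x => rfl⟩
      exact this _ hd r
    obtain ⟨a, b, hab⟩ := hW
    rw [hd]
    refine RectNet.mono (w := 2) ⟨fun _ i x => max ((if i = 0 then 1 else -1) * (∑ j, a j * x j)) 0,
      fun i _ => ⟨fun j => (if i = 0 then 1 else -1) * a j, 0, fun x => ?_⟩, by simp,
      fun i => if i = 0 then 1 else -1, b, fun x => ?_⟩ hw2
    · simp only [Finset.mul_sum, mul_assoc, add_zero]
    · rw [hab]
      simp only [Finset.sum_range_succ, Finset.range_zero, Finset.sum_empty]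
      rcases le_total 0 (∑ j, a j * x j) with h0 | h0
      · simp [h0]
      · simp [h0]
  · obtain ⟨n, hn⟩ := Nat.exists_eq_succ_of_ne_zero hd.ne'
    have hlw : ∀ j ≤ n, Φ.l (j + 1) ≤ w := fun j hj =>
      (Φ.width_le_params (by rw [L, hn]; omega)).trans hw
    have aux : ∀ m, m = n + 1 → ∀ r : Fin (Φ.l (m + 1)), RectNet (Φ.l 0) n w
        (fun x => ((Φ.W m).mulVec (Φ.hiddenEval m x) + Φ.B m) r) := by
      rintro m rfl r
      exact Φ.rectNet_preactivation n hlw r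
    have := aux Φ.depth hn (Fin.cast h1.symm 0)
    exact RectNet.mono_depth this hw2 (by omega)

end NeuralNet

private theorem hinge_sub_mono {p r : ℝ} (hpr : p ≤ r) :
    Monotone fun y : ℝ => max (y - p) 0 - max (y - r) 0 := by
  intro y z hyz
  simp only
  rcases le_total (y - p) 0 with h1 | h1 <;> rcases le_total (y - r) 0 with h2 | h2 <;>
    rcases le_total (z - p) 0 with h3 | h3 <;> rcases le_total (z - r) 0 with h4 | h4 <;>
    simp only [max_eq_left, max_eq_right, *] <;> linarith

/-- A Lipschitz function is approximated by shallow rectifier networks with the same Lipschitz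
constant, up to an error which is quadratic in the argument. -/
theorem LipschitzWith.exists_shallow_approx {f : ℝ → ℝ} {K : NNReal} (hf : LipschitzWith K f)
    {q : ℕ} (hq : 0 < q) :
    ∃ (a b c : ℕ → ℝ) (c₀ : ℝ) (F : ℝ → ℝ),
      (∀ y, F y = ∑ i ∈ Finset.range (4 * q ^ 2), c i * max (a i * y + b i) 0 + c₀) ∧
      LipschitzWith K F ∧ ∀ y, |F y - f y| ≤ 2 * K * ((1 + y ^ 2) / q) := by
  have hq0 : (0 : ℝ) < q := Nat.cast_pos.2 hq
  set m := 2 * q ^ 2 with hm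
  set ξ : ℕ → ℝ := fun j => -q + j / q with hξ
  have hstep : ∀ j, ξ (j + 1) - ξ j = 1 / q := fun j => by simp only [hξ]; push_cast; ring
  have hmono : Monotone ξ := monotone_nat_of_le_succ fun j => by
    have := hstep j
    have : (0 : ℝ) < 1 / q := by positivity
    linarith
  have hξm : ξ m = q := by simp only [hξ, hm]; push_cast; field_simp; ring
  set s : ℕ → ℝ := fun j => (f (ξ (j + 1)) - f (ξ j)) * q with hs
  have hsK : ∀ j, |s j| ≤ K := by
    intro j
    have h1 := hf.dist_le_mul (ξ (j + 1)) (ξ j)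
    rw [Real.dist_eq, Real.dist_eq, hstep, abs_of_pos (show (0 : ℝ) < 1 / q by positivity)] at h1
    simp only [hs]
    rw [abs_mul, abs_of_pos hq0]
    calc _ ≤ (K * (1 / q)) * (q : ℝ) := by gcongr
      _ = K := by field_simp
  set φ : ℕ → ℝ → ℝ := fun j y => max (y - ξ j) 0 - max (y - ξ (j + 1)) 0 with hφ
  set F : ℝ → ℝ := fun y => ∑ j ∈ Finset.range m, s j * φ j y + f (ξ 0) with hF
  have hφmono : ∀ j, Monotone (φ j) := fun j => hinge_sub_mono (hmono (Nat.le_succ j))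
  have hφsum : ∀ y, ∑ j ∈ Finset.range m, φ j y = max (y - ξ 0) 0 - max (y - ξ m) 0 := by
    intro y
    have := Finset.sum_range_sub' (fun j => max (y - ξ j) 0) m
    simpa [hφ] using this
  have hFlip : LipschitzWith K F := by
    refine LipschitzWith.of_dist_le_mul fun y z => ?_
    wlog hyz : z ≤ y generalizing y z
    · rw [dist_comm, dist_comm y]; exact this z y (le_of_not_ge hyz)
    rw [Real.dist_eq, Real.dist_eq, abs_of_nonneg (sub_nonneg.2 hyz)]
    have h1 : F y - F z = ∑ j ∈ Finset.range m, s j * (φ j y - φ j z) := by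
      simp only [hF, mul_sub, Finset.sum_sub_distrib]; ring
    rw [h1]
    calc |∑ j ∈ Finset.range m, s j * (φ j y - φ j z)|
        ≤ ∑ j ∈ Finset.range m, |s j * (φ j y - φ j z)| := Finset.abs_sum_le_sum_abs _ _
      _ ≤ ∑ j ∈ Finset.range m, K * (φ j y - φ j z) := by
          refine Finset.sum_le_sum fun j _ => ?_
          have := sub_nonneg.2 (hφmono j hyz)
          rw [abs_mul, abs_of_nonneg this]
          exact mul_le_mul_of_nonneg_right (hsK j) this
      _ = K * ((max (y - ξ 0) 0 - max (y - ξ m) 0) - (max (z - ξ 0) 0 - max (z - ξ m) 0)) := by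
          rw [← Finset.mul_sum, Finset.sum_sub_distrib, hφsum, hφsum]
      _ ≤ K * (y - z) := by
          refine mul_le_mul_of_nonneg_left ?_ K.2
          have h2 : max (z - ξ m) 0 ≤ max (y - ξ m) 0 := by gcongr
          have h3 : max (y - ξ 0) 0 ≤ max (z - ξ 0) 0 + (y - z) := by
            apply max_le
            · linarith [le_max_left (z - ξ 0) 0]
            · linarith [le_max_right (z - ξ 0) 0]
          linarith
  have hnode : ∀ k ≤ m, F (ξ k) = f (ξ k) := by
    intro k hk
    obtain ⟨e, he⟩ := Nat.exists_eq_add_of_le hk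
    simp only [hF]
    rw [he, Finset.sum_range_add]
    have h1 : ∀ j ∈ Finset.range k, s j * φ j (ξ k) = f (ξ (j + 1)) - f (ξ j) := by
      intro j hj
      have hjk : j + 1 ≤ k := Finset.mem_range.1 hj
      have e1 : 0 ≤ ξ k - ξ (j + 1) := sub_nonneg.2 (hmono hjk)
      have e2 : 0 ≤ ξ k - ξ j := sub_nonneg.2 (hmono (by omega))
      simp only [hφ, hs, max_eq_left e1, max_eq_left e2]
      have := hstep j
      have e3 : ξ k - ξ j - (ξ k - ξ (j + 1)) = 1 / q := by linarith
      rw [e3]; field_simp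
    have h2 : ∀ j ∈ Finset.range e, s (k + j) * φ (k + j) (ξ k) = 0 := by
      intro j _
      have e1 : ξ k - ξ (k + j + 1) ≤ 0 := sub_nonpos.2 (hmono (by omega))
      have e2 : ξ k - ξ (k + j) ≤ 0 := sub_nonpos.2 (hmono (by omega))
      simp only [hφ, max_eq_right e1, max_eq_right e2, sub_self, mul_zero]
    rw [Finset.sum_congr rfl h1, Finset.sum_congr rfl h2, Finset.sum_range_sub (fun j => f (ξ j))]
    simp
  have hnear : ∀ y : ℝ, ∃ k ≤ m, |y - ξ k| ≤ (1 + y ^ 2) / q := by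
    intro y
    rcases le_total y (-q) with h1 | h1
    · refine ⟨0, Nat.zero_le _, ?_⟩
      have : ξ 0 = -q := by simp [hξ]
      rw [this, abs_of_nonpos (by linarith), le_div_iff₀ hq0]
      nlinarith
    · rcases le_total (q : ℝ) y with h2 | h2
      · refine ⟨m, le_rfl, ?_⟩
        rw [hξm, abs_of_nonneg (by linarith), le_div_iff₀ hq0]
        nlinarith
      · have h0 : 0 ≤ (y + q) * q := mul_nonneg (by linarith) hq0.le
        refine ⟨⌊(y + q) * q⌋₊, ?_, ?_⟩
        · have : (⌊(y + q) * q⌋₊ : ℝ) ≤ m := by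
            refine (Nat.floor_le h0).trans ?_
            rw [hm]; push_cast; nlinarith
          exact_mod_cast this
        · have e1 := Nat.floor_le h0
          have e2 := Nat.lt_floor_add_one ((y + q) * q)
          have e3 : y - ξ ⌊(y + q) * q⌋₊ = ((y + q) * q - ⌊(y + q) * q⌋₊) / q := by
            simp only [hξ]; field_simp; ring
          rw [e3, abs_of_nonneg (div_nonneg (by linarith) hq0.le)]
          gcongr
          nlinarith
  refine ⟨fun _ => 1, fun i => if i < m then -ξ i else -ξ (i - m + 1),
    fun i => if i < m then s i else -s (i - m), f (ξ 0), F, fun y => ?_, hFlip, fun y => ?_⟩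
  · have h4 : 4 * q ^ 2 = m + m := by rw [hm]; ring
    rw [h4, Finset.sum_range_add]
    simp only [hF, hφ]
    congr 1
    rw [← Finset.sum_add_distrib]
    refine Finset.sum_congr rfl fun j hj => ?_
    have := Finset.mem_range.1 hj
    simp only [this, if_true, one_mul]
    simp
    ring_nf
  · obtain ⟨k, hk, hky⟩ := hnear y
    have e1 := hFlip.dist_le_mul y (ξ k)
    have e2 := hf.dist_le_mul y (ξ k)
    rw [Real.dist_eq, Real.dist_eq, hnode k hk] at e1
    rw [Real.dist_eq, Real.dist_eq, abs_sub_comm] at e2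
    calc |F y - f y| = |(F y - f (ξ k)) + (f (ξ k) - f y)| := by ring_nf
      _ ≤ K * |y - ξ k| + K * |y - ξ k| := (abs_add_le _ _).trans (add_le_add e1 e2)
      _ = 2 * K * |y - ξ k| := by ring
      _ ≤ _ := by gcongr

/-- The standard normal distribution on `ℝ^d`. -/
def stdNormal (d : ℕ) : Measure (Fin d → ℝ) := Measure.pi fun _ => gaussianReal 0 1

instance (d : ℕ) : IsProbabilityMeasure (stdNormal d) := by
  unfold stdNormal; infer_instance

/-- Gaussian integration by parts on the line. -/
theorem integral_mul_gaussianReal_eq_integral_deriv {h h' : ℝ → ℝ}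
    (hh : ∀ x, HasDerivAt h (h' x) x) (hc : Continuous h') (hs : HasCompactSupport h) :
    ∫ x, x * h x ∂(gaussianReal 0 1) = ∫ x, h' x ∂(gaussianReal 0 1) := by
  have hcont : Continuous h := continuous_iff_continuousAt.2 fun x => (hh x).continuousAt
  have hs' : HasCompactSupport h' := by
    have : h' = deriv h := funext fun x => (hh x).deriv.symm
    rw [this]; exact hs.deriv
  have hpdf : ∀ x, HasDerivAt (gaussianPDFReal 0 1) (-x * gaussianPDFReal 0 1 x) x := by
    intro x
    have h1 : HasDerivAt (fun x : ℝ => -(x - 0) ^ 2 / (2 * ((1 : NNReal) : ℝ))) (-x) x :=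
      ((((hasDerivAt_id x).sub_const 0).pow 2).neg.div_const _).congr_deriv (by simp; ring)
    exact (h1.exp.const_mul ((√(2 * Real.pi * ((1 : NNReal) : ℝ)))⁻¹)).congr_deriv
      (by simp only [gaussianPDFReal]; ring)
  have hpc : Continuous (gaussianPDFReal 0 1) :=
    continuous_iff_continuousAt.2 fun x => (hpdf x).continuousAt
  rw [integral_gaussianReal_eq_integral_smul one_ne_zero,
    integral_gaussianReal_eq_integral_smul one_ne_zero]
  simp only [smul_eq_mul]
  rw [integral_mul_deriv_eq_deriv_mul_of_integrable (fun x _ => hpdf x) (fun x _ => hh x),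
    ← integral_neg]
  · refine integral_congr_ae (Filter.Eventually.of_forall fun x => ?_)
    simp only; ring
  · exact (hpc.mul hc).integrable_of_hasCompactSupport hs'.mul_left
  · exact ((continuous_neg.mul hpc).mul hcont).integrable_of_hasCompactSupport hs.mul_left
  · exact (hpc.mul hcont).integrable_of_hasCompactSupport hs.mul_left

theorem integrable_mul_stdNormal {d : ℕ} {h : (Fin d → ℝ) → ℝ} (hc : Continuous h)
    (hs : HasCompactSupport h) (i : Fin d) : Integrable (fun z => z i * h z) (stdNormal d) :=
  Continuous.integrable_of_hasCompactSupport (by fun_prop) hs.mul_left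

/-- Gaussian integration by parts. -/
theorem integral_mul_stdNormal_eq_integral_fderiv {d : ℕ} {h : (Fin d → ℝ) → ℝ}
    (hh : ContDiff ℝ 1 h) (hs : HasCompactSupport h) (i : Fin d) :
    ∫ z, z i * h z ∂(stdNormal d) = ∫ z, fderiv ℝ h z (Pi.single i 1) ∂(stdNormal d) := by
  obtain _ | n := d
  · exact i.elim0
  have hcont := hh.continuous
  have hfc : Continuous fun z => fderiv ℝ h z (Pi.single i 1) :=
    (hh.continuous_fderiv one_ne_zero).clm_apply continuous_const
  have hfs : HasCompactSupport fun z => fderiv ℝ h z (Pi.single i 1) :=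
    hs.fderiv_apply ℝ _
  have hmp := (measurePreserving_piFinSuccAbove (fun _ : Fin (n + 1) => gaussianReal 0 1) i).symm
  have key : ∀ φ : (Fin (n + 1) → ℝ) → ℝ, Integrable φ (stdNormal (n + 1)) →
      ∫ z, φ z ∂(stdNormal (n + 1)) =
        ∫ y, ∫ a, φ (i.insertNth a y) ∂(gaussianReal 0 1) ∂(stdNormal n) := by
    intro φ hφ
    have h1 := hmp.integral_comp
      (MeasurableEquiv.measurableEmbedding (MeasurableEquiv.piFinSuccAbove _ i).symm) φ
    rw [stdNormal, ← h1, integral_prod_symm]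
    · rfl
    · exact (hmp.integrable_comp_emb
        (MeasurableEquiv.measurableEmbedding (MeasurableEquiv.piFinSuccAbove _ i).symm)).2 hφ
  rw [key _ (integrable_mul_stdNormal hcont hs i),
    key _ (hfc.integrable_of_hasCompactSupport hfs)]
  congr 1
  funext y
  have hins : ∀ a : ℝ, (i.insertNth a y : Fin (n + 1) → ℝ)
      = i.insertNth 0 y + a • (Pi.single i 1 : Fin (n + 1) → ℝ) := by
    intro a
    ext j
    refine i.succAboveCases ?_ (fun j => ?_) j
    · simp
    · simp only [Fin.insertNth_apply_succAbove, Pi.add_apply, Pi.smul_apply,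
        Pi.single_eq_of_ne (Fin.succAbove_ne i j), smul_zero, add_zero]
  have hd : ∀ a : ℝ, HasDerivAt (fun a : ℝ => (i.insertNth a y : Fin (n + 1) → ℝ))
      (Pi.single i 1) a := by
    intro a
    rw [funext hins]
    simpa using ((hasDerivAt_id a).smul_const (Pi.single i (1 : ℝ) : Fin (n + 1) → ℝ)).const_add
      (i.insertNth 0 y)
  have hic : Continuous fun a : ℝ => (i.insertNth a y : Fin (n + 1) → ℝ) :=
    continuous_iff_continuousAt.2 fun a => (hd a).continuousAt
  have hcs : HasCompactSupport fun a : ℝ => h (i.insertNth a y) := by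
    have hK : IsCompact ((fun z : Fin (n + 1) → ℝ => z i) '' tsupport h) :=
      IsCompact.image hs (continuous_apply i)
    refine HasCompactSupport.intro hK fun a ha => ?_
    by_contra hne
    exact ha ⟨i.insertNth a y, subset_tsupport _ hne, by simp⟩
  have := integral_mul_gaussianReal_eq_integral_deriv (h := fun a => h (i.insertNth a y))
    (h' := fun a => fderiv ℝ h (i.insertNth a y) (Pi.single i 1))
    (fun a => ((hh.differentiable one_ne_zero _).hasFDerivAt.comp_hasDerivAt a (hd a)))
    (hfc.comp hic) hcs
  simpa using this

/-- A linear combination of independent standard normal vectors is normal. -/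
theorem map_stdNormal_prod (d : ℕ) {a b c : ℝ} (habc : c ^ 2 = a ^ 2 + b ^ 2) :
    ((stdNormal d).prod (stdNormal d)).map (fun p => a • p.1 + b • p.2) =
      (stdNormal d).map (fun z => c • z) := by
  have h1 : ((gaussianReal 0 1).prod (gaussianReal 0 1)).map (fun p : ℝ × ℝ => a * p.1 + b * p.2)
      = (gaussianReal 0 1).map (fun z => c * z) := by
    have hind : IndepFun (fun p : ℝ × ℝ => a * p.1) (fun p : ℝ × ℝ => b * p.2)
        ((gaussianReal 0 1).prod (gaussianReal 0 1)) :=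
      indepFun_prod (X := fun x : ℝ => a * x) (Y := fun y : ℝ => b * y) (by fun_prop)
        (by fun_prop)
    have hX : ((gaussianReal 0 1).prod (gaussianReal 0 1)).map (fun p : ℝ × ℝ => a * p.1)
        = gaussianReal (a * 0) (.mk (a ^ 2) (sq_nonneg _) * 1) := by
      rw [← gaussianReal_map_const_mul, ← (measurePreserving_fst (μ := gaussianReal 0 1)
        (ν := gaussianReal 0 1)).map_eq, Measure.map_map (by fun_prop) (by fun_prop)]
      rw [(measurePreserving_fst (μ := gaussianReal 0 1) (ν := gaussianReal 0 1)).map_eq]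
      rfl
    have hY : ((gaussianReal 0 1).prod (gaussianReal 0 1)).map (fun p : ℝ × ℝ => b * p.2)
        = gaussianReal (b * 0) (.mk (b ^ 2) (sq_nonneg _) * 1) := by
      rw [← gaussianReal_map_const_mul, ← (measurePreserving_snd (μ := gaussianReal 0 1)
        (ν := gaussianReal 0 1)).map_eq, Measure.map_map (by fun_prop) (by fun_prop)]
      rw [(measurePreserving_snd (μ := gaussianReal 0 1) (ν := gaussianReal 0 1)).map_eq]
      rfl
    have := gaussianReal_add_gaussianReal_of_indepFun hind hX hY
    rw [gaussianReal_map_const_mul]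
    refine this.trans ?_
    congr 1
    · ring
    · ext; simp [habc]
  have h2 := measurePreserving_arrowProdEquivProdArrow ℝ ℝ (Fin d)
    (fun _ => gaussianReal 0 1) (fun _ => gaussianReal 0 1)
  unfold stdNormal
  rw [← h2.map_eq, Measure.map_map (by fun_prop) (MeasurableEquiv.measurable _)]
  have hl := Measure.pi_map_pi (μ := fun _ : Fin d => (gaussianReal 0 1).prod (gaussianReal 0 1))
    (f := fun _ (p : ℝ × ℝ) => a * p.1 + b * p.2) (fun _ => by fun_prop)
  have hr := Measure.pi_map_pi (μ := fun _ : Fin d => gaussianReal 0 1)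
    (f := fun _ (z : ℝ) => c * z) (fun _ => by fun_prop)
  simp only [h1] at hl
  exact hl.trans hr.symm

/-- The polynomial weight `1 + ∑ |x_i|^κ`. -/
def polyGrowth (κ : ℝ) {d : ℕ} (x : Fin d → ℝ) : ℝ := 1 + ∑ i, |x i| ^ κ

/-- The unit cube `[0,1]^d`. -/
def unitCube (d : ℕ) : Set (Fin d → ℝ) := Set.univ.pi fun _ => Icc (0 : ℝ) 1

theorem one_le_polyGrowth (κ : ℝ) {d : ℕ} (x : Fin d → ℝ) : 1 ≤ polyGrowth κ x :=
  le_add_of_nonneg_right (Finset.sum_nonneg fun _ _ => Real.rpow_nonneg (abs_nonneg _) _)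

theorem continuous_polyGrowth {κ : ℝ} (hκ : 0 < κ) {d : ℕ} :
    Continuous (polyGrowth κ : (Fin d → ℝ) → ℝ) := by
  unfold polyGrowth
  refine continuous_const.add (continuous_finsetSum _ fun i _ => ?_)
  exact (continuous_apply i).abs.rpow_const fun _ => Or.inr hκ.le

theorem integrable_rpow_gaussianReal {a s p : ℝ} (ha : 0 ≤ a) (hs : 0 ≤ s) (hp : 0 < p) :
    Integrable (fun z : ℝ => (a + s * |z|) ^ p) (gaussianReal 0 1) := by
  have h1 : MemLp (fun z : ℝ => a + s * |z|) (ENNReal.ofReal p) (gaussianReal 0 1) :=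
    (memLp_const a).add (((memLp_id_gaussianReal' _ ENNReal.ofReal_ne_top).abs).const_mul s)
  have h2 := h1.integrable_norm_rpow (by simpa using hp) ENNReal.ofReal_ne_top
  rw [ENNReal.toReal_ofReal hp.le] at h2
  refine h2.congr (Filter.Eventually.of_forall fun z => ?_)
  have : 0 ≤ a + s * |z| := by positivity
  simp only [Real.norm_of_nonneg this]

theorem integrable_comp_apply_stdNormal {d : ℕ} {h : ℝ → ℝ}
    (hh : Integrable h (gaussianReal 0 1)) (i : Fin d) :
    Integrable (fun z : Fin d → ℝ => h (z i)) (stdNormal d) :=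
  (measurePreserving_eval (fun _ : Fin d => gaussianReal 0 1) i).integrable_comp_of_integrable hh

theorem integral_comp_apply_stdNormal {d : ℕ} {h : ℝ → ℝ}
    (hh : Integrable h (gaussianReal 0 1)) (i : Fin d) :
    ∫ z, h (z i) ∂(stdNormal d) = ∫ y, h y ∂(gaussianReal 0 1) := by
  have hm := measurePreserving_eval (fun _ : Fin d => gaussianReal 0 1) i
  have := integral_map (μ := stdNormal d) (φ := Function.eval i) hm.measurable.aemeasurable
    (f := h) (by rw [stdNormal, hm.map_eq]; exact hh.aestronglyMeasurable)
  rw [stdNormal, hm.map_eq] at this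
  exact this.symm

theorem abs_add_smul_le {d : ℕ} {x z : Fin d → ℝ} {σ s : ℝ} (hσ : |σ| ≤ s) (i : Fin d) :
    |(x + σ • z) i| ≤ |x i| + s * |z i| := by
  refine (abs_add_le _ _).trans ?_
  simp only [Pi.smul_apply, smul_eq_mul, abs_mul]
  gcongr

theorem polyGrowth_add_smul_le {κ : ℝ} (hκ : 0 < κ) {d : ℕ} (x z : Fin d → ℝ) {σ s : ℝ}
    (hσ : |σ| ≤ s) : polyGrowth κ (x + σ • z) ≤ 1 + ∑ i, (|x i| + s * |z i|) ^ κ := by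
  unfold polyGrowth
  gcongr with i
  exact abs_add_smul_le hσ i

theorem integrable_growth_bound {κ : ℝ} (hκ : 0 < κ) {d : ℕ} (x : Fin d → ℝ) {s : ℝ}
    (hs : 0 ≤ s) :
    Integrable (fun z : Fin d → ℝ => 1 + ∑ i, (|x i| + s * |z i|) ^ κ) (stdNormal d) :=
  (integrable_const _).add (integrable_finsetSum _ fun i _ =>
    integrable_comp_apply_stdNormal (integrable_rpow_gaussianReal (abs_nonneg (x i)) hs hκ) i)

theorem one_add_sum_pow_four_le {d : ℕ} (m : Fin d → ℝ) :
    (1 + ∑ i, m i) ^ 4 ≤ 8 * (1 + (d : ℝ) ^ 3 * ∑ i, m i ^ 4) := by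
  have h1 : (∑ i, m i) ^ 2 ≤ d * ∑ i, m i ^ 2 := by
    simpa using sq_sum_le_card_mul_sum_sq (s := Finset.univ) (f := m)
  have h2 : (∑ i, m i ^ 2) ^ 2 ≤ d * ∑ i, m i ^ 4 := by
    refine (sq_sum_le_card_mul_sum_sq (s := Finset.univ) (f := fun i => m i ^ 2)).trans_eq ?_
    simp only [← pow_mul, Finset.card_univ, Fintype.card_fin]
  have h3 : (∑ i, m i) ^ 4 ≤ (d : ℝ) ^ 3 * ∑ i, m i ^ 4 :=
    calc (∑ i, m i) ^ 4 = ((∑ i, m i) ^ 2) ^ 2 := by ring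
      _ ≤ (d * ∑ i, m i ^ 2) ^ 2 := pow_le_pow_left₀ (sq_nonneg _) h1 2
      _ = (d : ℝ) ^ 2 * (∑ i, m i ^ 2) ^ 2 := by ring
      _ ≤ (d : ℝ) ^ 2 * (d * ∑ i, m i ^ 4) := by gcongr
      _ = _ := by ring
  have h4 : (1 + ∑ i, m i) ^ 4 ≤ 8 * (1 + (∑ i, m i) ^ 4) := by
    set S := ∑ i, m i
    nlinarith [sq_nonneg (S - 1), sq_nonneg (S ^ 2 - 1), sq_nonneg (S * (S - 1)),
      sq_nonneg ((S - 1) ^ 2), sq_nonneg (S + 1)]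
  linarith

/-- Fourth moments of the polynomial weight along Gaussian perturbations of the cube. -/
theorem exists_lintegral_polyGrowth_le {κ s : ℝ} (hκ : 0 < κ) (hs : 0 ≤ s) :
    ∃ C : ℝ, 1 ≤ C ∧ ∀ d : ℕ, 0 < d → ∀ σ : ℝ, |σ| ≤ s →
      ∫⁻ x in unitCube d, ∫⁻ z, ENNReal.ofReal (polyGrowth κ (x + σ • z) ^ 4) ∂(stdNormal d) ≤
        ENNReal.ofReal (C * (d : ℝ) ^ 4) := by
  set E : ℝ := ∫ y, (1 + s * |y|) ^ (4 * κ) ∂(gaussianReal 0 1) with hE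
  have hE0 : 0 ≤ E := integral_nonneg fun y => by positivity
  have hint := integrable_rpow_gaussianReal zero_le_one hs (show 0 < 4 * κ by positivity)
  refine ⟨8 * (1 + E), by linarith, fun d hd σ hσ => ?_⟩
  have hd1 : (1 : ℝ) ≤ d := by exact_mod_cast hd
  have hpt : ∀ x ∈ unitCube d, ∫⁻ z, ENNReal.ofReal (polyGrowth κ (x + σ • z) ^ 4) ∂(stdNormal d)
      ≤ ENNReal.ofReal (8 * (1 + E) * (d : ℝ) ^ 4) := by
    intro x hx
    have hle : ∀ z : Fin d → ℝ, polyGrowth κ (x + σ • z) ^ 4 ≤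
        8 * (1 + (d : ℝ) ^ 3 * ∑ i, (1 + s * |z i|) ^ (4 * κ)) := by
      intro z
      have h1 : polyGrowth κ (x + σ • z) ≤ 1 + ∑ i, (1 + s * |z i|) ^ κ := by
        refine (polyGrowth_add_smul_le hκ x z hσ).trans ?_
        gcongr with i
        have := hx i (mem_univ i)
        exact abs_le.2 ⟨by linarith [this.1], this.2⟩
      have h2 : ∀ i, (1 + s * |z i|) ^ (4 * κ) = ((1 + s * |z i|) ^ κ) ^ 4 := by
        intro i
        rw [mul_comm 4 κ, Real.rpow_mul (by positivity)]
        exact_mod_cast Real.rpow_natCast _ 4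
      simp only [h2]
      exact (pow_le_pow_left₀ (zero_le_one.trans (one_le_polyGrowth _ _)) h1 4).trans
        (one_add_sum_pow_four_le _)
    have hsum : Integrable (fun z : Fin d → ℝ => ∑ i, (1 + s * |z i|) ^ (4 * κ)) (stdNormal d) :=
      integrable_finsetSum _ fun i _ => integrable_comp_apply_stdNormal hint i
    have hI : Integrable (fun z : Fin d → ℝ =>
        8 * (1 + (d : ℝ) ^ 3 * ∑ i, (1 + s * |z i|) ^ (4 * κ))) (stdNormal d) :=
      ((integrable_const _).add (hsum.const_mul _)).const_mul _
    calc _ ≤ ∫⁻ z, ENNReal.ofReal (8 * (1 + (d : ℝ) ^ 3 * ∑ i, (1 + s * |z i|) ^ (4 * κ)))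
          ∂(stdNormal d) := lintegral_mono fun z => ENNReal.ofReal_le_ofReal (hle z)
      _ = ENNReal.ofReal (∫ z, 8 * (1 + (d : ℝ) ^ 3 * ∑ i, (1 + s * |z i|) ^ (4 * κ))
          ∂(stdNormal d)) := (ofReal_integral_eq_lintegral_ofReal hI
            (Filter.Eventually.of_forall fun z => by positivity)).symm
      _ ≤ _ := by
        refine ENNReal.ofReal_le_ofReal ?_
        rw [integral_const_mul, integral_add (integrable_const _) (hsum.const_mul _),
          integral_const_mul, integral_finsetSum _
            fun i _ => integrable_comp_apply_stdNormal hint i]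
        simp only [integral_comp_apply_stdNormal hint, ← hE]
        simp only [integral_const, probReal_univ, smul_eq_mul, mul_one, Finset.sum_const,
          Finset.card_univ, Fintype.card_fin, nsmul_eq_mul]
        have : (1 : ℝ) ≤ (d : ℝ) ^ 4 := one_le_pow₀ hd1
        nlinarith
  have hms : MeasurableSet (unitCube d) := MeasurableSet.univ_pi fun _ => measurableSet_Icc
  have hvol : volume (unitCube d) = 1 := by
    rw [unitCube, volume_pi_pi]; simp
  calc _ ≤ ∫⁻ _ in unitCube d, ENNReal.ofReal (8 * (1 + E) * (d : ℝ) ^ 4) :=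
        setLIntegral_mono' hms hpt
    _ = _ := by rw [setLIntegral_const, hvol, mul_one]

theorem ContDiff.spatialPD1 {d : ℕ} {v : (Fin d → ℝ) → ℝ} (hv : ContDiff ℝ 2 v) (i : Fin d) :
    ContDiff ℝ 1 (spatialPD1 d v i) :=
  (hv.fderiv_right (m := 1) (by norm_num)).clm_apply contDiff_const

theorem ContDiff.continuous_spatialPD2 {d : ℕ} {v : (Fin d → ℝ) → ℝ} (hv : ContDiff ℝ 2 v)
    (i j : Fin d) : Continuous (spatialPD2 d v i j) :=
  ((hv.spatialPD1 i).continuous_fderiv one_ne_zero).clm_apply continuous_const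

theorem HasCompactSupport.spatialPD1 {d : ℕ} {v : (Fin d → ℝ) → ℝ} (hv : HasCompactSupport v)
    (i : Fin d) : HasCompactSupport (spatialPD1 d v i) :=
  hv.fderiv_apply ℝ _

theorem HasCompactSupport.spatialPD2 {d : ℕ} {v : (Fin d → ℝ) → ℝ} (hv : HasCompactSupport v)
    (i j : Fin d) : HasCompactSupport (spatialPD2 d v i j) :=
  (hv.spatialPD1 i).fderiv_apply ℝ _

theorem spatialPD1_comp_smul {d : ℕ} (v : (Fin d → ℝ) → ℝ) (c : ℝ) (i : Fin d) :
    spatialPD1 d (fun y => v (c • y)) i = fun y => c * spatialPD1 d v i (c • y) := by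
  funext y
  simp [spatialPD1, fderiv_comp_smul]

theorem spatialPD2_comp_smul {d : ℕ} {v : (Fin d → ℝ) → ℝ} (hv : ContDiff ℝ 2 v) (c : ℝ)
    (i j : Fin d) (y : Fin d → ℝ) :
    spatialPD2 d (fun y => v (c • y)) i j y = c * (c * spatialPD2 d v i j (c • y)) := by
  change spatialPD1 d (spatialPD1 d (fun y => v (c • y)) i) j y = _
  rw [spatialPD1_comp_smul]
  have hd : DifferentiableAt ℝ (fun y => spatialPD1 d v i (c • y)) y :=
    (((hv.spatialPD1 i).comp (contDiff_const_smul c)).differentiable one_ne_zero) y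
  have h1 := spatialPD1_comp_smul (spatialPD1 d v i) c j
  have h2 : spatialPD1 d (fun y => c * spatialPD1 d v i (c • y)) j y
      = c * spatialPD1 d (fun y => spatialPD1 d v i (c • y)) j y := by
    simp only [spatialPD1] at hd ⊢
    rw [fderiv_const_mul hd]; rfl
  rw [h2, h1]
  rfl

/-- Smooth compactly supported cutoff functions exhausting `ℝ^d`, with uniformly bounded
derivatives. -/
theorem exists_cutoff (d : ℕ) : ∃ (χ : ℕ → (Fin d → ℝ) → ℝ) (C : ℝ), 0 ≤ C ∧
    (∀ n, ContDiff ℝ 2 (χ n)) ∧ (∀ n, HasCompactSupport (χ n)) ∧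
    (∀ n y, |χ n y| ≤ C) ∧ (∀ n i y, |spatialPD1 d (χ n) i y| ≤ C) ∧
    (∀ n i y, |spatialPD2 d (χ n) i i y| ≤ C) ∧
    ∀ y, ∀ᶠ n in Filter.atTop, χ n y = 1 ∧ (∀ i, spatialPD1 d (χ n) i y = 0) ∧
      ∀ i, spatialPD2 d (χ n) i i y = 0 := by
  let b : ContDiffBump (0 : Fin d → ℝ) := ⟨1, 2, one_pos, one_lt_two⟩
  have hb : ContDiff ℝ 2 b := b.contDiff (n := 2)
  have hbs : HasCompactSupport b := b.hasCompactSupport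
  obtain ⟨C0, hC0⟩ := hb.continuous.bounded_above_of_compact_support hbs
  choose C1 hC1 using fun i => (hb.spatialPD1 i).continuous.bounded_above_of_compact_support
    (hbs.spatialPD1 i)
  choose C2 hC2 using fun i => (hb.continuous_spatialPD2 i i).bounded_above_of_compact_support
    (hbs.spatialPD2 i i)
  have hC0' : 0 ≤ C0 := (norm_nonneg _).trans (hC0 0)
  have hC1' : ∀ i, 0 ≤ C1 i := fun i => (norm_nonneg _).trans (hC1 i 0)
  have hC2' : ∀ i, 0 ≤ C2 i := fun i => (norm_nonneg _).trans (hC2 i 0)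
  have hs1 : ∀ i, C1 i ≤ ∑ i, C1 i := fun i =>
    Finset.single_le_sum (fun i _ => hC1' i) (Finset.mem_univ i)
  have hs2 : ∀ i, C2 i ≤ ∑ i, C2 i := fun i =>
    Finset.single_le_sum (fun i _ => hC2' i) (Finset.mem_univ i)
  have hS1 := Finset.sum_nonneg fun i (_ : i ∈ Finset.univ) => hC1' i
  have hS2 := Finset.sum_nonneg fun i (_ : i ∈ Finset.univ) => hC2' i
  set c : ℕ → ℝ := fun n => ((n : ℝ) + 1)⁻¹ with hc
  have hc0 : ∀ n, 0 < c n := fun n => by simp only [hc]; positivity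
  have hc1 : ∀ n, c n ≤ 1 := fun n => inv_le_one_of_one_le₀ (by simp)
  refine ⟨fun n y => b (c n • y), C0 + ∑ i, C1 i + ∑ i, C2 i, by positivity,
    fun n => hb.comp (contDiff_const_smul _), fun n => ?_, fun n y => ?_, fun n i y => ?_,
    fun n i y => ?_, fun y => ?_⟩
  · exact hbs.comp_homeomorph (Homeomorph.smulOfNeZero (c n) (hc0 n).ne')
  · have := hC0 (c n • y)
    rw [Real.norm_eq_abs] at this
    linarith
  · rw [spatialPD1_comp_smul, abs_mul, abs_of_pos (hc0 n)]
    have h1 := hC1 i (c n • y)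
    rw [Real.norm_eq_abs] at h1
    have := mul_le_mul (hc1 n) h1 (abs_nonneg _) zero_le_one
    linarith [hs1 i]
  · rw [spatialPD2_comp_smul hb, abs_mul, abs_mul, abs_of_pos (hc0 n)]
    have h1 := hC2 i (c n • y)
    rw [Real.norm_eq_abs] at h1
    have h2 := mul_le_mul (hc1 n) h1 (abs_nonneg _) zero_le_one
    have := mul_le_mul (hc1 n) h2 (by have := hc0 n; positivity) zero_le_one
    linarith [hs2 i]
  · obtain ⟨N, hN⟩ := exists_nat_gt ‖y‖
    filter_upwards [Filter.eventually_ge_atTop N] with n hn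
    have hlt : ‖y‖ < (n : ℝ) + 1 := by
      have : (N : ℝ) ≤ n := by exact_mod_cast hn
      linarith
    have hone : ∀ y' : Fin d → ℝ, ‖y'‖ < (n : ℝ) + 1 → b (c n • y') = 1 := by
      intro y' hy'
      refine b.one_of_mem_closedBall ?_
      rw [mem_closedBall_zero_iff, norm_smul, Real.norm_of_nonneg (hc0 n).le]
      calc c n * ‖y'‖ ≤ c n * (n + 1) := by
            have := hc0 n
            gcongr
        _ = 1 := inv_mul_cancel₀ (by positivity)
    have hev : ∀ y' : Fin d → ℝ, ‖y'‖ < (n : ℝ) + 1 →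
        (fun y => b (c n • y)) =ᶠ[nhds y'] fun _ => 1 := by
      intro y' hy'
      filter_upwards [(isOpen_lt continuous_norm continuous_const).mem_nhds hy'] with z hz
        using hone z hz
    have hz1 : ∀ i, ∀ y' : Fin d → ℝ, ‖y'‖ < (n : ℝ) + 1 →
        spatialPD1 d (fun y => b (c n • y)) i y' = 0 := by
      intro i y' hy'
      rw [spatialPD1, (hev y' hy').fderiv_eq]
      simp
    refine ⟨hone y hlt, fun i => hz1 i y hlt, fun i => ?_⟩
    have hev2 : spatialPD1 d (fun y => b (c n • y)) i =ᶠ[nhds y] fun _ => 0 := by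
      filter_upwards [(isOpen_lt continuous_norm continuous_const).mem_nhds hlt] with z hz
        using hz1 i z hz
    change fderiv ℝ (spatialPD1 d (fun y => b (c n • y)) i) y (Pi.single i 1) = 0
    rw [hev2.fderiv_eq]
    simp

/-- Gaussian integration by parts along an affine map. -/
theorem integral_mul_comp_affine_stdNormal {d : ℕ} {h : (Fin d → ℝ) → ℝ}
    (hh : ContDiff ℝ 1 h) (hs : HasCompactSupport h) (x : Fin d → ℝ) {r : ℝ} (hr : r ≠ 0)
    (i : Fin d) :
    ∫ z, z i * h (x + r • z) ∂(stdNormal d) =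
      ∫ z, r * spatialPD1 d h i (x + r • z) ∂(stdNormal d) := by
  have hc : ContDiff ℝ 1 fun z : Fin d → ℝ => x + r • z :=
    contDiff_const.add (contDiff_const_smul r)
  have hs' : HasCompactSupport fun z => h (x + r • z) :=
    hs.comp_homeomorph ((Homeomorph.smulOfNeZero r hr).trans (Homeomorph.addLeft x))
  rw [integral_mul_stdNormal_eq_integral_fderiv (h := fun z => h (x + r • z))
    (hh.comp hc) hs' i]
  congr 1
  funext z
  have h1 : HasFDerivAt (fun z : Fin d → ℝ => x + r • z)
      (r • ContinuousLinearMap.id ℝ (Fin d → ℝ)) z :=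
    ((hasFDerivAt_id z).const_smul r).const_add x
  have h2 := ((hh.differentiable one_ne_zero (x + r • z)).hasFDerivAt.comp z h1).fderiv
  simp only [Function.comp_def] at h2
  rw [h2]
  simp [spatialPD1]

theorem integrable_affine_of_hasCompactSupport {d : ℕ} {h : (Fin d → ℝ) → ℝ} (hh : Continuous h)
    (hs : HasCompactSupport h) (x : Fin d → ℝ) {r : ℝ} (hr : r ≠ 0) :
    Integrable (fun z => h (x + r • z)) (stdNormal d) :=
  Continuous.integrable_of_hasCompactSupport (by fun_prop)
    (hs.comp_homeomorph ((Homeomorph.smulOfNeZero r hr).trans (Homeomorph.addLeft x)))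

theorem integrable_mul_affine_of_hasCompactSupport {d : ℕ} {h : (Fin d → ℝ) → ℝ}
    (hh : Continuous h) (hs : HasCompactSupport h) (x : Fin d → ℝ) {r : ℝ} (hr : r ≠ 0)
    (i : Fin d) : Integrable (fun z => z i * h (x + r • z)) (stdNormal d) :=
  integrable_mul_stdNormal (h := fun z => h (x + r • z)) (by fun_prop)
    (hs.comp_homeomorph ((Homeomorph.smulOfNeZero r hr).trans (Homeomorph.addLeft x))) i

theorem spatialPD1_mul {d : ℕ} {v w : (Fin d → ℝ) → ℝ} (hv : Differentiable ℝ v)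
    (hw : Differentiable ℝ w) (i : Fin d) (y : Fin d → ℝ) :
    spatialPD1 d (fun y => v y * w y) i y =
      v y * spatialPD1 d w i y + w y * spatialPD1 d v i y := by
  simp [spatialPD1, fderiv_fun_mul (hv y) (hw y)]

/-- Integration by parts for the radial derivative of `v χ` in one coordinate direction. -/
theorem integral_radial_deriv {d : ℕ} {v χ : (Fin d → ℝ) → ℝ} (hv : ContDiff ℝ 2 v)
    (hχ : ContDiff ℝ 2 χ) (hs : HasCompactSupport χ) (x : Fin d → ℝ) {r : ℝ} (hr : r ≠ 0)
    (i : Fin d) :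
    ∫ z, z i * (spatialPD1 d v i (x + r • z) * χ (x + r • z) +
        v (x + r • z) * spatialPD1 d χ i (x + r • z)) ∂(stdNormal d) =
      ∫ z, (r * (spatialPD2 d v i i (x + r • z) * χ (x + r • z)) +
        (2 * (z i * (v (x + r • z) * spatialPD1 d χ i (x + r • z))) -
          r * (v (x + r • z) * spatialPD2 d χ i i (x + r • z)))) ∂(stdNormal d) := by
  have hv1 := hv.spatialPD1 i
  have hχ1 := hχ.spatialPD1 i
  have hv' : ContDiff ℝ 1 v := hv.of_le (by norm_num)
  have hχ' : ContDiff ℝ 1 χ := hχ.of_le (by norm_num)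
  have cv := hv.continuous
  have cχ := hχ.continuous
  have cv1 := hv1.continuous
  have cχ1 := hχ1.continuous
  have cv2 := hv.continuous_spatialPD2 i i
  have cχ2 := hχ.continuous_spatialPD2 i i
  have sχ1 := hs.spatialPD1 i
  have sχ2 := hs.spatialPD2 i i
  have e1 := integral_mul_comp_affine_stdNormal (hv1.mul hχ') hs.mul_left x hr i
  have e2 := integral_mul_comp_affine_stdNormal (hv'.mul hχ1) sχ1.mul_left x hr i
  have p1 : ∀ y, spatialPD1 d (fun y => spatialPD1 d v i y * χ y) i y
      = spatialPD1 d v i y * spatialPD1 d χ i y + χ y * spatialPD2 d v i i y :=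
    spatialPD1_mul (hv1.differentiable one_ne_zero) (hχ'.differentiable one_ne_zero) i
  have p2 : ∀ y, spatialPD1 d (fun y => v y * spatialPD1 d χ i y) i y
      = v y * spatialPD2 d χ i i y + spatialPD1 d χ i y * spatialPD1 d v i y :=
    spatialPD1_mul (hv'.differentiable one_ne_zero) (hχ1.differentiable one_ne_zero) i
  simp only [p1] at e1
  simp only [p2] at e2
  have i1 : Integrable (fun z => z i * (spatialPD1 d v i (x + r • z) * χ (x + r • z)))
      (stdNormal d) := integrable_mul_affine_of_hasCompactSupport
    (h := fun y => spatialPD1 d v i y * χ y) (by fun_prop) hs.mul_left x hr i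
  have i2 : Integrable (fun z => z i * (v (x + r • z) * spatialPD1 d χ i (x + r • z)))
      (stdNormal d) := integrable_mul_affine_of_hasCompactSupport
    (h := fun y => v y * spatialPD1 d χ i y) (by fun_prop) sχ1.mul_left x hr i
  have j1 : Integrable (fun z => r * (spatialPD2 d v i i (x + r • z) * χ (x + r • z)))
      (stdNormal d) := (integrable_affine_of_hasCompactSupport
    (h := fun y => spatialPD2 d v i i y * χ y) (by fun_prop) hs.mul_left x hr).const_mul r
  have j2 : Integrable (fun z => r * (v (x + r • z) * spatialPD2 d χ i i (x + r • z)))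
      (stdNormal d) := (integrable_affine_of_hasCompactSupport
    (h := fun y => v y * spatialPD2 d χ i i y) (by fun_prop) sχ2.mul_left x hr).const_mul r
  have j3 : Integrable (fun z => r * (spatialPD1 d v i (x + r • z) * spatialPD1 d χ i (x + r • z)))
      (stdNormal d) := (integrable_affine_of_hasCompactSupport
    (h := fun y => spatialPD1 d v i y * spatialPD1 d χ i y) (by fun_prop)
      sχ1.mul_left x hr).const_mul r
  have i3 : Integrable (fun z => 2 * (z i * (v (x + r • z) * spatialPD1 d χ i (x + r • z))) -
          r * (v (x + r • z) * spatialPD2 d χ i i (x + r • z))) (stdNormal d) :=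
    (i2.const_mul 2).sub j2
  rw [integral_add j1 i3, integral_sub (i2.const_mul 2) j2, integral_const_mul 2]
  have E1 : ∫ z, z i * (spatialPD1 d v i (x + r • z) * χ (x + r • z)) ∂(stdNormal d)
      = ∫ z, r * (spatialPD1 d v i (x + r • z) * spatialPD1 d χ i (x + r • z)) ∂(stdNormal d)
        + ∫ z, r * (spatialPD2 d v i i (x + r • z) * χ (x + r • z)) ∂(stdNormal d) := by
    rw [e1, ← integral_add j3 j1]
    congr 1; funext z; ring
  have E2 : ∫ z, z i * (v (x + r • z) * spatialPD1 d χ i (x + r • z)) ∂(stdNormal d)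
      = ∫ z, r * (v (x + r • z) * spatialPD2 d χ i i (x + r • z)) ∂(stdNormal d)
        + ∫ z, r * (spatialPD1 d v i (x + r • z) * spatialPD1 d χ i (x + r • z))
          ∂(stdNormal d) := by
    rw [e2, ← integral_add j2 j3]
    congr 1; funext z; ring
  simp only [mul_add]
  rw [integral_add i1 i2]
  linarith

theorem fderiv_eq_sum_spatialPD1 {d : ℕ} (v : (Fin d → ℝ) → ℝ) (y : Fin d → ℝ) :
    fderiv ℝ v y =
      ∑ i, spatialPD1 d v i y • (ContinuousLinearMap.proj i : (Fin d → ℝ) →L[ℝ] ℝ) := by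
  refine ContinuousLinearMap.ext fun z => ?_
  have hz : z = ∑ i, z i • (Pi.single i 1 : Fin d → ℝ) := by
    ext j
    simp [Finset.sum_apply, Pi.single_apply]
  conv_lhs => rw [hz]
  rw [map_sum]
  simp [spatialPD1, mul_comm]

theorem IsC12On.hasDerivAt_along {d : ℕ} {T : ℝ} {u : ℝ → (Fin d → ℝ) → ℝ}
    (hu : IsC12On d 0 T u) {t ρ : ℝ} (x z : Fin d → ℝ) (hs : t - ρ ^ 2 / 2 ∈ Ioo 0 T) :
    HasDerivAt (fun ρ : ℝ => u (t - ρ ^ 2 / 2) (x + ρ • z))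
      (-ρ * derivWithin (fun s => u s (x + ρ • z)) (Icc 0 T) (t - ρ ^ 2 / 2) +
        ∑ i, z i * spatialPD1 d (u (t - ρ ^ 2 / 2)) i (x + ρ • z)) ρ := by
  obtain ⟨-, h2, h3, h4, h5, -⟩ := hu
  set s := t - ρ ^ 2 / 2 with hsdef
  set y := x + ρ • z with hy
  have hnhds : Icc 0 T ×ˢ (univ : Set (Fin d → ℝ)) ∈ nhds (s, y) :=
    prod_mem_nhds (Icc_mem_nhds hs.1 hs.2) Filter.univ_mem
  have hev : ∀ᶠ v : ℝ × (Fin d → ℝ) in nhds (s, y), v.1 ∈ Ioo 0 T :=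
    (continuous_fst.tendsto (s, y)).eventually (isOpen_Ioo.mem_nhds hs)
  have key := hasStrictFDerivAt_uncurry_coprod (𝕜 := ℝ) (u := (s, y)) (f := u)
    (f₁ := fun s y => (derivWithin (fun s => u s y) (Icc 0 T) s) • (1 : ℝ →L[ℝ] ℝ))
    (f₂ := fun s y => fderiv ℝ (u s) y) ?_ ?_ ?_ ?_
  · have hline : HasDerivAt (fun ρ : ℝ => (t - ρ ^ 2 / 2, x + ρ • z)) (-ρ, z) ρ := by
      refine HasDerivAt.prodMk ?_ ?_
      · exact (((hasDerivAt_pow 2 ρ).div_const 2).const_sub t).congr_deriv (by simp)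
      · simpa using ((hasDerivAt_id ρ).smul_const z).const_add x
    have hk : HasFDerivAt (Function.HasUncurry.uncurry u) _ (t - ρ ^ 2 / 2, x + ρ • z) :=
      key.hasFDerivAt
    refine (hk.comp_hasDerivAt ρ hline).congr_deriv ?_
    simp only [ContinuousLinearMap.coprod_apply, Function.HasUncurry.uncurry, id]
    rw [fderiv_eq_sum_spatialPD1]
    simp [mul_comm]
  · filter_upwards [hev] with v hv
    have := ((h2 v.2 v.1 (Ioo_subset_Icc_self hv)).hasDerivWithinAt.hasDerivAt
      (Icc_mem_nhds hv.1 hv.2)).hasFDerivAt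
    refine this.congr_fderiv ?_
    ext; simp [Function.HasUncurry.uncurry]
  · filter_upwards [hev] with v hv
    exact ((h4 v.1 (Ioo_subset_Icc_self hv)).differentiable (by norm_num) v.2).hasFDerivAt
  · exact ((h3.continuousAt hnhds).smul continuousAt_const)
  · have : (Function.HasUncurry.uncurry fun s y => fderiv ℝ (u s) y) = fun p : ℝ × (Fin d → ℝ) =>
        ∑ i, spatialPD1 d (u p.1) i p.2 •
          (ContinuousLinearMap.proj i : (Fin d → ℝ) →L[ℝ] ℝ) := by
      funext p
      exact fderiv_eq_sum_spatialPD1 _ _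
    rw [this]
    exact tendsto_finsetSum _ fun i _ => ((h5 i).continuousAt hnhds).smul continuousAt_const

theorem exists_bound_mul_of_hasCompactSupport {d : ℕ} {T : ℝ} {p : ℝ → (Fin d → ℝ) → ℝ}
    {χ : (Fin d → ℝ) → ℝ}
    (hp : ContinuousOn (fun q : ℝ × (Fin d → ℝ) => p q.1 q.2) (Icc 0 T ×ˢ univ))
    (hχ : Continuous χ) (hs : HasCompactSupport χ) :
    ∃ C, 0 ≤ C ∧ ∀ t ∈ Icc 0 T, ∀ y, |p t y * χ y| ≤ C := by
  obtain ⟨C, hC⟩ := (isCompact_Icc.prod hs).exists_bound_of_continuousOn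
    (f := fun q : ℝ × (Fin d → ℝ) => p q.1 q.2 * χ q.2) (s := Icc 0 T ×ˢ tsupport χ)
    ((hp.mono (prod_mono_right (subset_univ _))).mul
      (hχ.comp continuous_snd).continuousOn)
  refine ⟨max C 0, le_max_right _ _, fun t ht y => ?_⟩
  by_cases hy : y ∈ tsupport χ
  · exact (hC (t, y) ⟨ht, hy⟩).trans (le_max_left _ _)
  · rw [image_eq_zero_of_notMem_tsupport hy]
    simp

theorem integrable_abs_mul_growth_bound {κ : ℝ} (hκ : 0 < κ) {d : ℕ} (x : Fin d → ℝ) {s : ℝ}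
    (hs : 0 ≤ s) (j : Fin d) :
    Integrable (fun z : Fin d → ℝ => |z j| * (1 + ∑ i, (|x i| + s * |z i|) ^ κ))
      (stdNormal d) := by
  have h1 : Integrable (fun z : Fin d → ℝ => (0 + 1 * |z j|) ^ (2 : ℝ)) (stdNormal d) :=
    integrable_comp_apply_stdNormal (integrable_rpow_gaussianReal le_rfl zero_le_one two_pos) j
  have h2 : Integrable (fun z : Fin d → ℝ => ∑ i, (|x i| + s * |z i|) ^ (4 * κ)) (stdNormal d) :=
    integrable_finsetSum _ fun i _ => integrable_comp_apply_stdNormal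
      (integrable_rpow_gaussianReal (abs_nonneg (x i)) hs (by positivity)) i
  have h3 := h1.add (((integrable_const (1 : ℝ)).add (h2.const_mul ((d : ℝ) ^ 3))).const_mul 8)
  have hm : Measurable fun z : Fin d → ℝ => |z j| * (1 + ∑ i, (|x i| + s * |z i|) ^ κ) := by
    fun_prop
  refine h3.mono' hm.aestronglyMeasurable (Filter.Eventually.of_forall fun z => ?_)
  have hG : 1 ≤ 1 + ∑ i, (|x i| + s * |z i|) ^ κ :=
    le_add_of_nonneg_right (Finset.sum_nonneg fun _ _ => by positivity)
  have h4 := one_add_sum_pow_four_le fun i => (|x i| + s * |z i|) ^ κ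
  have h5 : ∀ i, ((|x i| + s * |z i|) ^ κ) ^ 4 = (|x i| + s * |z i|) ^ (4 * κ) := by
    intro i
    rw [mul_comm 4 κ, Real.rpow_mul (by positivity)]
    exact_mod_cast (Real.rpow_natCast _ 4).symm
  simp only [h5] at h4
  rw [Real.norm_of_nonneg (by positivity)]
  simp only [Pi.add_apply, zero_add, one_mul, Real.rpow_two, sq_abs]
  refine le_trans ?_ (add_le_add_right h4 _)
  set G := 1 + ∑ i, (|x i| + s * |z i|) ^ κ
  have : G ^ 2 ≤ G ^ 4 := pow_le_pow_right₀ hG (by norm_num)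
  nlinarith [sq_nonneg (|z j| - G), sq_abs (z j)]

/-- The integrand obtained by differentiating `∫ u χ` along the backward heat flow. -/
def heatFlowIntegrand {d : ℕ} (f : ℝ → ℝ) (u : ℝ → (Fin d → ℝ) → ℝ) (χ : (Fin d → ℝ) → ℝ)
    (t : ℝ) (x : Fin d → ℝ) (ρ : ℝ) (z : Fin d → ℝ) : ℝ :=
  ρ * (f (u (t - ρ ^ 2 / 2) (x + ρ • z)) * χ (x + ρ • z)) -
    ∑ i, (2 * (z i * (u (t - ρ ^ 2 / 2) (x + ρ • z) * spatialPD1 d χ i (x + ρ • z))) -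
      ρ * (u (t - ρ ^ 2 / 2) (x + ρ • z) * spatialPD2 d χ i i (x + ρ • z)))

theorem LipschitzWith.abs_le_add {K : NNReal} {f : ℝ → ℝ} (hf : LipschitzWith K f) (y : ℝ) :
    |f y| ≤ |f 0| + K * |y| := by
  have := hf.dist_le_mul y 0
  rw [Real.dist_eq, Real.dist_eq, sub_zero] at this
  linarith [abs_sub_abs_le_abs_sub (f y) (f 0)]

theorem exists_bound_heatFlowIntegrand {d : ℕ} {T κ A C : ℝ} (hκ : 0 < κ) (hA : 0 ≤ A)
    {K : NNReal} {f : ℝ → ℝ} (hf : LipschitzWith K f) {u : ℝ → (Fin d → ℝ) → ℝ}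
    (hgr : ∀ t ∈ Icc 0 T, ∀ x, |u t x| ≤ A * polyGrowth κ x) (x : Fin d → ℝ) {R : ℝ}
    (hR : 0 ≤ R) :
    ∃ B : (Fin d → ℝ) → ℝ, Integrable B (stdNormal d) ∧
      ∀ χ : (Fin d → ℝ) → ℝ, (∀ y, |χ y| ≤ C) → (∀ i y, |spatialPD1 d χ i y| ≤ C) →
      (∀ i y, |spatialPD2 d χ i i y| ≤ C) → ∀ t ρ z, ρ ∈ Icc 0 R → t - ρ ^ 2 / 2 ∈ Icc 0 T →
      |heatFlowIntegrand f u χ t x ρ z| ≤ B z := by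
  have hG := integrable_growth_bound hκ x hR
  have hGi := integrable_abs_mul_growth_bound hκ x hR
  refine ⟨fun z => R * ((|f 0| + K * (A * (1 + ∑ i, (|x i| + R * |z i|) ^ κ))) * C) +
    ∑ j, (2 * (A * C * (|z j| * (1 + ∑ i, (|x i| + R * |z i|) ^ κ))) +
      R * (A * C * (1 + ∑ i, (|x i| + R * |z i|) ^ κ))), ?_, ?_⟩
  · refine (((((integrable_const _).add ((hG.const_mul A).const_mul _)).mul_const C).const_mul
      R)).add (integrable_finsetSum _ fun j _ => ?_)
    exact (((hGi j).const_mul _).const_mul 2).add ((hG.const_mul _).const_mul R)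
  · intro χ h0 h1 h2 t ρ z hρ hs
    have hu : |u (t - ρ ^ 2 / 2) (x + ρ • z)| ≤ A * (1 + ∑ i, (|x i| + R * |z i|) ^ κ) :=
      (hgr _ hs _).trans (mul_le_mul_of_nonneg_left
        (polyGrowth_add_smul_le hκ x z (by rw [abs_of_nonneg hρ.1]; exact hρ.2)) hA)
    set G := 1 + ∑ i, (|x i| + R * |z i|) ^ κ
    set U := u (t - ρ ^ 2 / 2) (x + ρ • z)
    have hAG : 0 ≤ A * G := (abs_nonneg _).trans hu
    have hfu : |f U| ≤ |f 0| + K * (A * G) := (hf.abs_le_add U).trans (by gcongr)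
    unfold heatFlowIntegrand
    refine (abs_sub _ _).trans (add_le_add ?_ ((Finset.abs_sum_le_sum_abs _ _).trans
      (Finset.sum_le_sum fun j _ => (abs_sub _ _).trans (add_le_add ?_ ?_))))
    · rw [abs_mul, abs_mul, abs_of_nonneg hρ.1]
      have := h0 (x + ρ • z)
      gcongr
      exact hρ.2
    · rw [abs_mul, abs_mul, abs_mul, abs_of_pos (show (0 : ℝ) < 2 by norm_num)]
      have h3 := mul_le_mul hu (h1 j (x + ρ • z)) (abs_nonneg _) hAG
      calc 2 * (|z j| * (|U| * |spatialPD1 d χ j (x + ρ • z)|)) ≤ 2 * (|z j| * (A * G * C)) := by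
            gcongr
        _ = _ := by ring
    · rw [abs_mul, abs_mul, abs_of_nonneg hρ.1]
      have h3 := mul_le_mul hu (h2 j (x + ρ • z)) (abs_nonneg _) hAG
      calc ρ * (|U| * |spatialPD2 d χ j j (x + ρ • z)|) ≤ R * (A * G * C) := by
            gcongr
            exact hρ.2
        _ = _ := by ring

theorem IsC12On.continuous_slice {d : ℕ} {T : ℝ} {u : ℝ → (Fin d → ℝ) → ℝ}
    (hu : IsC12On d 0 T u) {t : ℝ} (ht : t ∈ Icc 0 T) : Continuous (u t) :=
  (hu.2.2.2.1 t ht).continuous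

theorem continuousOn_along {d : ℕ} {T : ℝ} {p : ℝ → (Fin d → ℝ) → ℝ}
    (hp : ContinuousOn (fun q : ℝ × (Fin d → ℝ) => p q.1 q.2) (Icc 0 T ×ˢ univ))
    {t R : ℝ} (htR : ∀ ρ ∈ Icc 0 R, t - ρ ^ 2 / 2 ∈ Icc 0 T) (x : Fin d → ℝ) :
    ContinuousOn (fun q : ℝ × (Fin d → ℝ) => p (t - q.1 ^ 2 / 2) (x + q.1 • q.2))
      (Icc 0 R ×ˢ univ) :=
  hp.comp (f := fun q : ℝ × (Fin d → ℝ) => (t - q.1 ^ 2 / 2, x + q.1 • q.2))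
    (by fun_prop) fun q hq => ⟨htR q.1 hq.1, mem_univ _⟩

theorem continuousOn_heatFlowIntegrand {d : ℕ} {T : ℝ} {f : ℝ → ℝ} (hf : Continuous f)
    {u : ℝ → (Fin d → ℝ) → ℝ} (hu : IsC12On d 0 T u) {χ : (Fin d → ℝ) → ℝ}
    (hχ : ContDiff ℝ 2 χ) {t R : ℝ} (htR : ∀ ρ ∈ Icc 0 R, t - ρ ^ 2 / 2 ∈ Icc 0 T)
    (x : Fin d → ℝ) :
    ContinuousOn (fun q : ℝ × (Fin d → ℝ) => heatFlowIntegrand f u χ t x q.1 q.2)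
      (Icc 0 R ×ˢ univ) := by
  have h1 := continuousOn_along hu.1 htR x
  have c0 := hχ.continuous
  have c1 := fun i => (hχ.spatialPD1 i).continuous
  have c2 := fun i => hχ.continuous_spatialPD2 i i
  unfold heatFlowIntegrand
  have e0 : Continuous fun q : ℝ × (Fin d → ℝ) => χ (x + q.1 • q.2) := by fun_prop
  have e1 : ∀ i, Continuous fun q : ℝ × (Fin d → ℝ) => spatialPD1 d χ i (x + q.1 • q.2) :=
    fun i => (c1 i).comp (by fun_prop)
  have e2 : ∀ i, Continuous fun q : ℝ × (Fin d → ℝ) => spatialPD2 d χ i i (x + q.1 • q.2) :=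
    fun i => (c2 i).comp (by fun_prop)
  refine (continuousOn_fst.mul ((hf.comp_continuousOn h1).mul e0.continuousOn)).sub
    (continuousOn_finsetSum _ fun i _ => ?_)
  have e3 : Continuous fun q : ℝ × (Fin d → ℝ) => q.2 i := by fun_prop
  exact (continuousOn_const.mul (e3.continuousOn.mul (h1.mul (e1 i).continuousOn))).sub
    (continuousOn_fst.mul (h1.mul (e2 i).continuousOn))

theorem prod_restrict_stdNormal (d : ℕ) (s : Set ℝ) :
    (volume.restrict s).prod (stdNormal d) =
      ((volume : Measure ℝ).prod (stdNormal d)).restrict (s ×ˢ univ) := by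
  rw [← Measure.prod_restrict, Measure.restrict_univ]

theorem integrable_abs_apply_stdNormal {d : ℕ} (i : Fin d) :
    Integrable (fun z : Fin d → ℝ => |z i|) (stdNormal d) := by
  have := integrable_comp_apply_stdNormal
    (integrable_rpow_gaussianReal le_rfl zero_le_one one_pos) i
  simpa using this

/-- Derivative of the cut off solution along the backward heat flow. -/
theorem hasDerivAt_integral_cutoff {d : ℕ} {T : ℝ} {f : ℝ → ℝ} {u : ℝ → (Fin d → ℝ) → ℝ}
    (hu : IsC12On d 0 T u)
    (hpde : ∀ t ∈ Icc (0 : ℝ) T, ∀ x, derivWithin (fun s => u s x) (Icc (0 : ℝ) T) t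
      = laplacian d (u t) x + f (u t x))
    {χ : (Fin d → ℝ) → ℝ} (hχ : ContDiff ℝ 2 χ) (hs : HasCompactSupport χ)
    {t : ℝ} (x : Fin d → ℝ) {ρ : ℝ} (hρ : 0 < ρ) (hsρ : t - ρ ^ 2 / 2 ∈ Ioo 0 T) :
    HasDerivAt (fun ρ => ∫ z, u (t - ρ ^ 2 / 2) (x + ρ • z) * χ (x + ρ • z) ∂(stdNormal d))
      (-∫ z, heatFlowIntegrand f u χ t x ρ z ∂(stdNormal d)) ρ := by
  have hχ1 : Differentiable ℝ χ := hχ.differentiable (by norm_num)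
  have cχ := hχ.continuous
  have cχ1 := fun i => (hχ.spatialPD1 i).continuous
  set D : ℝ → (Fin d → ℝ) → ℝ := fun s y => derivWithin (fun s => u s y) (Icc 0 T) s with hD
  -- the derivative of the integrand
  set F' : ℝ → (Fin d → ℝ) → ℝ := fun ρ z =>
    -ρ * (D (t - ρ ^ 2 / 2) (x + ρ • z) * χ (x + ρ • z)) +
      ∑ i, z i * (spatialPD1 d (u (t - ρ ^ 2 / 2)) i (x + ρ • z) * χ (x + ρ • z) +
        u (t - ρ ^ 2 / 2) (x + ρ • z) * spatialPD1 d χ i (x + ρ • z)) with hF'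
  obtain ⟨C0, hC0, hb0⟩ := exists_bound_mul_of_hasCompactSupport (p := D) hu.2.2.1 cχ hs
  choose C1 hC1 hb1 using fun i => exists_bound_mul_of_hasCompactSupport
    (p := fun s y => spatialPD1 d (u s) i y) (hu.2.2.2.2.1 i) cχ hs
  choose C2 hC2 hb2 using fun i => exists_bound_mul_of_hasCompactSupport
    (p := u) hu.1 (cχ1 i) (hs.spatialPD1 i)
  have hcont : Continuous fun ρ : ℝ => t - ρ ^ 2 / 2 := by fun_prop
  have hsnhds : {r : ℝ | t - r ^ 2 / 2 ∈ Ioo 0 T ∧ |r| < |ρ| + 1} ∈ nhds ρ :=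
    Filter.inter_mem ((isOpen_Ioo.preimage hcont).mem_nhds hsρ)
      ((isOpen_lt continuous_abs continuous_const).mem_nhds (by
        show |ρ| < |ρ| + 1; linarith))
  have hslice : ∀ r, t - r ^ 2 / 2 ∈ Ioo 0 T → Continuous fun z : Fin d → ℝ =>
      u (t - r ^ 2 / 2) (x + r • z) * χ (x + r • z) := by
    intro r hr
    have := hu.continuous_slice (Ioo_subset_Icc_self hr)
    fun_prop
  have hDc : ∀ s ∈ Icc 0 T, Continuous (D s) := by
    intro s hs'
    exact hu.2.2.1.comp_continuous (f := fun y => (s, y)) (by fun_prop)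
      fun y => ⟨hs', mem_univ _⟩
  have hvρ := hu.2.2.2.1 _ (Ioo_subset_Icc_self hsρ)
  have cD : Continuous (D (t - ρ ^ 2 / 2)) := hDc _ (Ioo_subset_Icc_self hsρ)
  have cv := hvρ.continuous
  have cv1 := fun i => (hvρ.spatialPD1 i).continuous
  have cv2 := fun i => hvρ.continuous_spatialPD2 i i
  have cy : Continuous fun z : Fin d → ℝ => x + ρ • z := by fun_prop
  have hmain := (hasDerivAt_integral_of_dominated_loc_of_deriv_le (μ := stdNormal d) (x₀ := ρ)
    (F := fun r z => u (t - r ^ 2 / 2) (x + r • z) * χ (x + r • z)) (F' := F')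
    (bound := fun z => (|ρ| + 1) * C0 + ∑ i, |z i| * (C1 i + C2 i)) hsnhds ?_ ?_ ?_ ?_ ?_ ?_).2
  · refine hmain.congr_deriv ?_
    -- integration by parts
    have i0 : Integrable (fun z => D (t - ρ ^ 2 / 2) (x + ρ • z) * χ (x + ρ • z)) (stdNormal d) :=
      integrable_affine_of_hasCompactSupport (h := fun y => D (t - ρ ^ 2 / 2) y * χ y)
        (cD.mul cχ) hs.mul_left x hρ.ne'
    have i1 : ∀ i, Integrable (fun z : Fin d → ℝ =>
        z i * (spatialPD1 d (u (t - ρ ^ 2 / 2)) i (x + ρ • z) * χ (x + ρ • z) +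
        u (t - ρ ^ 2 / 2) (x + ρ • z) * spatialPD1 d χ i (x + ρ • z))) (stdNormal d) := fun i =>
      integrable_mul_affine_of_hasCompactSupport (h := fun y =>
        spatialPD1 d (u (t - ρ ^ 2 / 2)) i y * χ y + u (t - ρ ^ 2 / 2) y * spatialPD1 d χ i y)
        (((cv1 i).mul cχ).add (cv.mul (cχ1 i)))
        (hs.mul_left.add (hs.spatialPD1 i).mul_left) x hρ.ne' i
    have j1 : ∀ i, Integrable (fun z => ρ * (spatialPD2 d (u (t - ρ ^ 2 / 2)) i i (x + ρ • z)
        * χ (x + ρ • z))) (stdNormal d) := fun i =>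
      (integrable_affine_of_hasCompactSupport
        (h := fun y => spatialPD2 d (u (t - ρ ^ 2 / 2)) i i y * χ y)
        ((cv2 i).mul cχ) hs.mul_left x hρ.ne').const_mul ρ
    have j2 : ∀ i, Integrable (fun z : Fin d → ℝ =>
        2 * (z i * (u (t - ρ ^ 2 / 2) (x + ρ • z) * spatialPD1 d χ i (x + ρ • z))) -
        ρ * (u (t - ρ ^ 2 / 2) (x + ρ • z) * spatialPD2 d χ i i (x + ρ • z))) (stdNormal d) :=
      fun i => ((integrable_mul_affine_of_hasCompactSupport
        (h := fun y => u (t - ρ ^ 2 / 2) y * spatialPD1 d χ i y) (cv.mul (cχ1 i))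
        (hs.spatialPD1 i).mul_left x hρ.ne' i).const_mul 2).sub
        ((integrable_affine_of_hasCompactSupport
        (h := fun y => u (t - ρ ^ 2 / 2) y * spatialPD2 d χ i i y)
        (cv.mul (hχ.continuous_spatialPD2 i i))
        (hs.spatialPD2 i i).mul_left x hρ.ne').const_mul ρ)
    have i0' := i0.const_mul (-ρ)
    have j3 : ∀ i, Integrable (fun z : Fin d → ℝ =>
        ρ * (spatialPD2 d (u (t - ρ ^ 2 / 2)) i i (x + ρ • z) * χ (x + ρ • z)) +
        (2 * (z i * (u (t - ρ ^ 2 / 2) (x + ρ • z) * spatialPD1 d χ i (x + ρ • z))) -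
        ρ * (u (t - ρ ^ 2 / 2) (x + ρ • z) * spatialPD2 d χ i i (x + ρ • z)))) (stdNormal d) :=
      fun i => (j1 i).add (j2 i)
    simp only [hF']
    rw [integral_add i0' (integrable_finsetSum _ fun i _ => i1 i),
      integral_finsetSum _ fun i _ => i1 i]
    simp only [integral_radial_deriv hvρ hχ hs x hρ.ne']
    rw [← integral_finsetSum _ fun i _ => j3 i,
      ← integral_add i0' (integrable_finsetSum _ fun i _ => j3 i), ← integral_neg]
    congr 1
    funext z
    simp only [heatFlowIntegrand, hD, hpde _ (Ioo_subset_Icc_self hsρ), laplacian,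
      Finset.sum_add_distrib, ← Finset.mul_sum, ← Finset.sum_mul]
    ring
  · filter_upwards [hsnhds] with r hr
    exact (hslice r hr.1).aestronglyMeasurable
  · exact integrable_affine_of_hasCompactSupport (h := fun y => u (t - ρ ^ 2 / 2) y * χ y)
      (cv.mul cχ) hs.mul_left x hρ.ne'
  · refine Continuous.aestronglyMeasurable ?_
    refine (continuous_const.mul ((cD.comp cy).mul (cχ.comp cy))).add
      (continuous_finsetSum _ fun i _ => (continuous_apply i).mul ?_)
    exact (((cv1 i).comp cy).mul (cχ.comp cy)).add ((cv.comp cy).mul ((cχ1 i).comp cy))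
  · refine Filter.Eventually.of_forall fun z r hr => ?_
    have hr1 := Ioo_subset_Icc_self hr.1
    rw [Real.norm_eq_abs]
    refine (abs_add_le _ _).trans (add_le_add ?_ ((Finset.abs_sum_le_sum_abs _ _).trans
      (Finset.sum_le_sum fun i _ => ?_)))
    · rw [abs_mul, abs_neg]
      exact mul_le_mul hr.2.le (hb0 _ hr1 _) (abs_nonneg _) (by positivity)
    · rw [abs_mul]
      exact mul_le_mul_of_nonneg_left ((abs_add_le _ _).trans
        (add_le_add (hb1 i _ hr1 _) (hb2 i _ hr1 _))) (abs_nonneg _)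
  · exact (integrable_const _).add (integrable_finsetSum _ fun i _ =>
      (integrable_abs_apply_stdNormal i).mul_const _)
  · refine Filter.Eventually.of_forall fun z r hr => ?_
    have h1 := hu.hasDerivAt_along x z hr.1
    have h2 : HasDerivAt (fun r : ℝ => χ (x + r • z))
        (∑ i, z i * spatialPD1 d χ i (x + r • z)) r := by
      have hl : HasDerivAt (fun r : ℝ => x + r • z) z r := by
        simpa using ((hasDerivAt_id r).smul_const z).const_add x
      refine ((hχ1 (x + r • z)).hasFDerivAt.comp_hasDerivAt r hl).congr_deriv ?_
      rw [fderiv_eq_sum_spatialPD1]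
      simp [mul_comm]
    refine (h1.mul h2).congr_deriv ?_
    simp only [hF', hD, mul_add, Finset.sum_add_distrib]
    rw [add_mul, Finset.sum_mul, Finset.mul_sum, add_assoc]
    congr 1
    · ring
    · congr 1
      · exact Finset.sum_congr rfl fun i _ => by ring
      · exact Finset.sum_congr rfl fun i _ => by ring

theorem duhamel_cutoff {d : ℕ} {T κ A C : ℝ} (hκ : 0 < κ) (hA : 0 ≤ A)
    {K : NNReal} {f : ℝ → ℝ} (hf : LipschitzWith K f) {u : ℝ → (Fin d → ℝ) → ℝ}
    (hu : IsC12On d 0 T u)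
    (hpde : ∀ t ∈ Icc (0 : ℝ) T, ∀ x, derivWithin (fun s => u s x) (Icc (0 : ℝ) T) t
      = laplacian d (u t) x + f (u t x))
    (hgr : ∀ t ∈ Icc 0 T, ∀ x, |u t x| ≤ A * polyGrowth κ x)
    {χ : (Fin d → ℝ) → ℝ} (hχ : ContDiff ℝ 2 χ) (hs : HasCompactSupport χ)
    (h0 : ∀ y, |χ y| ≤ C) (h1 : ∀ i y, |spatialPD1 d χ i y| ≤ C)
    (h2 : ∀ i y, |spatialPD2 d χ i i y| ≤ C)
    {t : ℝ} (ht : t ∈ Ioc 0 T) (x : Fin d → ℝ) :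
    u t x * χ x = ∫ z, u 0 (x + √(2 * t) • z) * χ (x + √(2 * t) • z) ∂(stdNormal d) +
      ∫ p, heatFlowIntegrand f u χ t x p.1 p.2
        ∂((volume.restrict (Ioc 0 √(2 * t))).prod (stdNormal d)) := by
  set R := √(2 * t) with hR
  have hR2 : R ^ 2 = 2 * t := Real.sq_sqrt (by linarith [ht.1])
  have hR0 : 0 < R := Real.sqrt_pos.2 (by linarith [ht.1])
  have htR : ∀ ρ ∈ Icc 0 R, t - ρ ^ 2 / 2 ∈ Icc 0 T := by
    intro ρ hρ
    have : ρ ^ 2 ≤ R ^ 2 := pow_le_pow_left₀ hρ.1 hρ.2 2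
    exact ⟨by linarith, by linarith [ht.2, sq_nonneg ρ]⟩
  have htR' : ∀ ρ ∈ Ioo 0 R, t - ρ ^ 2 / 2 ∈ Ioo 0 T := by
    intro ρ hρ
    have : ρ ^ 2 < R ^ 2 := pow_lt_pow_left₀ hρ.2 hρ.1.le two_ne_zero
    have := pow_pos hρ.1 2
    exact ⟨by linarith, by linarith [ht.2]⟩
  obtain ⟨B, hB, hbound⟩ := exists_bound_heatFlowIntegrand (C := C) hκ hA hf hgr x hR0.le
  obtain ⟨C0, hC0, hb0⟩ := exists_bound_mul_of_hasCompactSupport (p := u) hu.1 hχ.continuous hs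
  have hint : Integrable (fun p : ℝ × (Fin d → ℝ) => heatFlowIntegrand f u χ t x p.1 p.2)
      ((volume.restrict (Ioc 0 R)).prod (stdNormal d)) := by
    refine (hB.comp_snd (volume.restrict (Ioc 0 R))).mono' ?_ ?_
    · rw [prod_restrict_stdNormal]
      exact ((continuousOn_heatFlowIntegrand hf.continuous hu hχ htR x).mono
        (prod_mono_left Ioc_subset_Icc_self)).aestronglyMeasurable
        (measurableSet_Ioc.prod MeasurableSet.univ)
    · rw [prod_restrict_stdNormal]
      filter_upwards [ae_restrict_mem (measurableSet_Ioc.prod MeasurableSet.univ)] with p hp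
      exact hbound χ h0 h1 h2 t p.1 p.2 (Ioc_subset_Icc_self hp.1)
        (htR _ (Ioc_subset_Icc_self hp.1))
  have hcontφ : ContinuousOn (fun ρ => ∫ z, u (t - ρ ^ 2 / 2) (x + ρ • z) * χ (x + ρ • z)
      ∂(stdNormal d)) (Icc 0 R) := by
    refine continuousOn_of_dominated (bound := fun _ => C0) ?_ ?_ (integrable_const _) ?_
    · intro ρ hρ
      have c1 := hu.continuous_slice (htR ρ hρ)
      have c2 := hχ.continuous
      exact Continuous.aestronglyMeasurable (by fun_prop)
    · exact fun ρ hρ => Filter.Eventually.of_forall fun z => hb0 _ (htR ρ hρ) _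
    · refine Filter.Eventually.of_forall fun z => ?_
      have c2 := hχ.continuous
      have := (continuousOn_along hu.1 htR x).comp (f := fun ρ : ℝ => (ρ, z)) (by fun_prop)
        (s := Icc 0 R) fun ρ hρ => ⟨hρ, mem_univ _⟩
      exact this.mul (Continuous.continuousOn (by fun_prop))
  have hFTC := intervalIntegral.integral_eq_sub_of_hasDerivAt_of_le hR0.le hcontφ
    (fun ρ hρ => hasDerivAt_integral_cutoff hu hpde hχ hs x hρ.1 (htR' ρ hρ))
    ((intervalIntegrable_iff_integrableOn_Ioc_of_le hR0.le).2 hint.integral_prod_left.neg)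
  rw [integral_prod _ hint]
  rw [intervalIntegral.integral_of_le hR0.le, integral_neg, hR2] at hFTC
  simp only [mul_div_cancel_left₀ t (two_ne_zero' ℝ), sub_self, ne_eq, OfNat.ofNat_ne_zero,
    not_false_eq_true, zero_pow, zero_div, sub_zero, zero_smul, add_zero, integral_const,
    probReal_univ, one_smul] at hFTC
  linarith

/-- The law of a uniform time on `[0,1]` and an independent standard normal vector. -/
def picardSample (d : ℕ) : Measure (ℝ × (Fin d → ℝ)) :=
  (volume.restrict (Icc (0 : ℝ) 1)).prod (stdNormal d)

instance : IsProbabilityMeasure (volume.restrict (Icc (0 : ℝ) 1)) :=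
  ⟨by simp⟩

instance (d : ℕ) : IsProbabilityMeasure (picardSample d) := by
  unfold picardSample; infer_instance

/-- The space-time point reached from `(t, x)` along the sample `ω`. -/
def picardPoint {d : ℕ} (t : ℝ) (x : Fin d → ℝ) (ω : ℝ × (Fin d → ℝ)) : ℝ × (Fin d → ℝ) :=
  (t * ω.1, x + √(2 * (t * (1 - ω.1))) • ω.2)

theorem duhamel_radial {d : ℕ} {T κ A : ℝ} (hκ : 0 < κ) (hA : 0 ≤ A)
    {K : NNReal} {f : ℝ → ℝ} (hf : LipschitzWith K f) {u : ℝ → (Fin d → ℝ) → ℝ}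
    (hu : IsC12On d 0 T u)
    (hpde : ∀ t ∈ Icc (0 : ℝ) T, ∀ x, derivWithin (fun s => u s x) (Icc (0 : ℝ) T) t
      = laplacian d (u t) x + f (u t x))
    (hgr : ∀ t ∈ Icc 0 T, ∀ x, |u t x| ≤ A * polyGrowth κ x)
    {t : ℝ} (ht : t ∈ Ioc 0 T) (x : Fin d → ℝ) :
    Integrable (fun p : ℝ × (Fin d → ℝ) => p.1 * f (u (t - p.1 ^ 2 / 2) (x + p.1 • p.2)))
      ((volume.restrict (Ioc 0 √(2 * t))).prod (stdNormal d)) ∧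
    u t x = ∫ z, u 0 (x + √(2 * t) • z) ∂(stdNormal d) +
      ∫ p, p.1 * f (u (t - p.1 ^ 2 / 2) (x + p.1 • p.2))
        ∂((volume.restrict (Ioc 0 √(2 * t))).prod (stdNormal d)) := by
  obtain ⟨χ, C, -, hχ, hs, h0, h1, h2, hlim⟩ := exists_cutoff d
  have hcut := fun n => duhamel_cutoff hκ hA hf hu hpde hgr (hχ n) (hs n) (h0 n) (h1 n) (h2 n)
    ht x
  set R := √(2 * t) with hR
  have hR2 : R ^ 2 = 2 * t := Real.sq_sqrt (by linarith [ht.1])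
  have hR0 : 0 < R := Real.sqrt_pos.2 (by linarith [ht.1])
  have htR : ∀ ρ ∈ Icc 0 R, t - ρ ^ 2 / 2 ∈ Icc 0 T := by
    intro ρ hρ
    have : ρ ^ 2 ≤ R ^ 2 := pow_le_pow_left₀ hρ.1 hρ.2 2
    exact ⟨by linarith, by linarith [ht.2, sq_nonneg ρ]⟩
  obtain ⟨B, hB, hbound⟩ := exists_bound_heatFlowIntegrand (C := C) hκ hA hf hgr x hR0.le
  set m := (volume.restrict (Ioc 0 R)).prod (stdNormal d) with hm
  have hmem : ∀ᵐ p ∂m, p ∈ Ioc 0 R ×ˢ (univ : Set (Fin d → ℝ)) := by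
    rw [hm, prod_restrict_stdNormal]
    exact ae_restrict_mem (measurableSet_Ioc.prod MeasurableSet.univ)
  have hBm : Integrable (fun p : ℝ × (Fin d → ℝ) => B p.2) m :=
    hB.comp_snd (volume.restrict (Ioc 0 R))
  have hmeas : ∀ n, AEStronglyMeasurable
      (fun p : ℝ × (Fin d → ℝ) => heatFlowIntegrand f u (χ n) t x p.1 p.2) m := by
    intro n
    rw [hm, prod_restrict_stdNormal]
    exact ((continuousOn_heatFlowIntegrand hf.continuous hu (hχ n) htR x).mono
      (prod_mono_left Ioc_subset_Icc_self)).aestronglyMeasurable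
      (measurableSet_Ioc.prod MeasurableSet.univ)
  have hb : ∀ n, ∀ᵐ p ∂m, ‖heatFlowIntegrand f u (χ n) t x p.1 p.2‖ ≤ B p.2 := by
    intro n
    filter_upwards [hmem] with p hp
    exact hbound (χ n) (h0 n) (h1 n) (h2 n) t p.1 p.2 (Ioc_subset_Icc_self hp.1)
      (htR _ (Ioc_subset_Icc_self hp.1))
  have hev : ∀ p : ℝ × (Fin d → ℝ), ∀ᶠ n in Filter.atTop,
      heatFlowIntegrand f u (χ n) t x p.1 p.2
        = p.1 * f (u (t - p.1 ^ 2 / 2) (x + p.1 • p.2)) := by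
    intro p
    filter_upwards [hlim (x + p.1 • p.2)] with n hn
    simp [heatFlowIntegrand, hn.1, hn.2.1, hn.2.2]
  have hten : ∀ p : ℝ × (Fin d → ℝ), Filter.Tendsto
      (fun n => heatFlowIntegrand f u (χ n) t x p.1 p.2) Filter.atTop
      (nhds (p.1 * f (u (t - p.1 ^ 2 / 2) (x + p.1 • p.2)))) := fun p =>
    tendsto_const_nhds.congr' ((hev p).mono fun n hn => hn.symm)
  have hL2 := tendsto_integral_of_dominated_convergence (fun p => B p.2) hmeas hBm hb
    (Filter.Eventually.of_forall hten)
  have hlimm : AEStronglyMeasurable (fun p : ℝ × (Fin d → ℝ) =>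
      p.1 * f (u (t - p.1 ^ 2 / 2) (x + p.1 • p.2))) m :=
    aestronglyMeasurable_of_tendsto_ae Filter.atTop hmeas (Filter.Eventually.of_forall hten)
  have hI : Integrable (fun p : ℝ × (Fin d → ℝ) =>
      p.1 * f (u (t - p.1 ^ 2 / 2) (x + p.1 • p.2))) m := by
    refine hBm.mono' hlimm ?_
    have hball := ae_all_iff.2 hb
    filter_upwards [hball] with p hp
    obtain ⟨n, hn⟩ := (hev p).exists
    rw [← hn]
    exact hp n
  refine ⟨hI, ?_⟩
  have hT0 : (0 : ℝ) ∈ Icc 0 T := ⟨le_rfl, ht.1.le.trans ht.2⟩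
  have hL1 : Filter.Tendsto (fun n => ∫ z, u 0 (x + R • z) * χ n (x + R • z) ∂(stdNormal d))
      Filter.atTop (nhds (∫ z, u 0 (x + R • z) ∂(stdNormal d))) := by
    refine tendsto_integral_of_dominated_convergence
      (fun z => A * (1 + ∑ i, (|x i| + R * |z i|) ^ κ) * C) ?_
      (((integrable_growth_bound hκ x hR0.le).const_mul A).mul_const C) ?_ ?_
    · intro n
      have c1 := hu.continuous_slice hT0
      have c2 := (hχ n).continuous
      exact Continuous.aestronglyMeasurable (by fun_prop)
    · intro n
      refine Filter.Eventually.of_forall fun z => ?_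
      rw [Real.norm_eq_abs, abs_mul]
      have h3 : |u 0 (x + R • z)| ≤ A * (1 + ∑ i, (|x i| + R * |z i|) ^ κ) :=
        (hgr _ hT0 _).trans (mul_le_mul_of_nonneg_left
          (polyGrowth_add_smul_le hκ x z (abs_of_pos hR0).le) hA)
      exact mul_le_mul h3 (h0 n _) (abs_nonneg _) ((abs_nonneg _).trans h3)
    · refine Filter.Eventually.of_forall fun z => tendsto_const_nhds.congr' ?_
      filter_upwards [hlim (x + R • z)] with n hn
      rw [hn.1, mul_one]
  have hL0 : Filter.Tendsto (fun n => u t x * χ n x) Filter.atTop (nhds (u t x)) := by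
    refine tendsto_const_nhds.congr' ?_
    filter_upwards [hlim x] with n hn
    rw [hn.1, mul_one]
  refine tendsto_nhds_unique hL0 ?_
  simp only [hcut]
  exact hL1.add hL2

/-- Duhamel's formula (stochastic fixed point equation) for the semilinear heat equation. -/
theorem duhamel {d : ℕ} {T κ A : ℝ} (hκ : 0 < κ) (hA : 0 ≤ A)
    {K : NNReal} {f : ℝ → ℝ} (hf : LipschitzWith K f) {u : ℝ → (Fin d → ℝ) → ℝ}
    (hu : IsC12On d 0 T u)
    (hpde : ∀ t ∈ Icc (0 : ℝ) T, ∀ x, derivWithin (fun s => u s x) (Icc (0 : ℝ) T) t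
      = laplacian d (u t) x + f (u t x))
    (hgr : ∀ t ∈ Icc 0 T, ∀ x, |u t x| ≤ A * polyGrowth κ x)
    {t : ℝ} (ht : t ∈ Icc 0 T) (x : Fin d → ℝ) :
    Integrable (fun ω => t * f (u (picardPoint t x ω).1 (picardPoint t x ω).2))
      (picardSample d) ∧
    u t x = ∫ z, u 0 (x + √(2 * t) • z) ∂(stdNormal d) +
      ∫ ω, t * f (u (picardPoint t x ω).1 (picardPoint t x ω).2) ∂(picardSample d) := by
  obtain h0t | h0t := ht.1.eq_or_lt
  · subst h0t
    simp
  obtain ⟨hI, hfix⟩ := duhamel_radial hκ hA hf hu hpde hgr ⟨h0t, ht.2⟩ x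
  set R := √(2 * t) with hR
  have hR2 : R ^ 2 = 2 * t := Real.sq_sqrt (by linarith)
  have hR0 : 0 < R := Real.sqrt_pos.2 (by linarith)
  set g : ℝ → (Fin d → ℝ) → ℝ := fun s z => f (u s (x + √(2 * (t - s)) • z)) with hg
  set B : (Fin d → ℝ) → ℝ :=
    fun z => |f 0| + K * (A * (1 + ∑ i, (|x i| + R * |z i|) ^ κ)) with hB
  have hBi : Integrable B (stdNormal d) :=
    (integrable_const _).add (((integrable_growth_bound hκ x hR0.le).const_mul A).const_mul _)
  have hgb : ∀ s ∈ Icc 0 t, ∀ z, |g s z| ≤ B z := by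
    intro s hs z
    refine (hf.abs_le_add _).trans ?_
    have : |u s (x + √(2 * (t - s)) • z)| ≤ A * (1 + ∑ i, (|x i| + R * |z i|) ^ κ) :=
      (hgr s ⟨hs.1, hs.2.trans ht.2⟩ _).trans (mul_le_mul_of_nonneg_left
        (polyGrowth_add_smul_le hκ x z (by
          rw [abs_of_nonneg (Real.sqrt_nonneg _)]
          exact Real.sqrt_le_sqrt (by linarith [hs.1]))) hA)
    simp only [hB]
    gcongr
  have hgc : ContinuousOn (fun q : ℝ × (Fin d → ℝ) => g q.1 q.2) (Icc 0 t ×ˢ univ) := by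
    have := hu.1.comp (f := fun q : ℝ × (Fin d → ℝ) => (q.1, x + √(2 * (t - q.1)) • q.2))
      (s := Icc 0 t ×ˢ univ) (by fun_prop)
      fun q hq => ⟨⟨hq.1.1, hq.1.2.trans ht.2⟩, mem_univ _⟩
    exact hf.continuous.comp_continuousOn this
  set J : ℝ → ℝ := fun s => ∫ z, g s z ∂(stdNormal d) with hJ
  have hJc : ContinuousOn J (Icc 0 t) := by
    refine continuousOn_of_dominated (bound := B) ?_
      (fun s hs => Filter.Eventually.of_forall (hgb s hs)) hBi ?_
    · intro s hs
      exact (hgc.comp_continuous (f := fun z => (s, z)) (by fun_prop)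
        fun z => ⟨hs, mem_univ _⟩).aestronglyMeasurable
    · exact Filter.Eventually.of_forall fun z => hgc.comp (f := fun s : ℝ => (s, z))
        (by fun_prop) fun s hs => ⟨hs, mem_univ _⟩
  have hfun : (fun ω : ℝ × (Fin d → ℝ) =>
      t * f (u (picardPoint t x ω).1 (picardPoint t x ω).2)) = fun ω => t * g (t * ω.1) ω.2 := by
    funext ω
    simp only [picardPoint, hg]
    rw [show t - t * ω.1 = t * (1 - ω.1) by ring]
  rw [hfun]
  have hmem : ∀ r ∈ Icc (0 : ℝ) 1, t * r ∈ Icc 0 t := fun r hr =>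
    ⟨mul_nonneg h0t.le hr.1, mul_le_of_le_one_right h0t.le hr.2⟩
  have hI2 : Integrable (fun ω : ℝ × (Fin d → ℝ) => t * g (t * ω.1) ω.2) (picardSample d) := by
    refine Integrable.const_mul ?_ t
    refine (hBi.comp_snd (volume.restrict (Icc (0 : ℝ) 1))).mono' ?_ ?_
    · rw [prod_restrict_stdNormal]
      refine ContinuousOn.aestronglyMeasurable ?_ (measurableSet_Icc.prod MeasurableSet.univ)
      exact hgc.comp (f := fun ω : ℝ × (Fin d → ℝ) => (t * ω.1, ω.2)) (by fun_prop)
        fun ω hω => ⟨hmem _ hω.1, mem_univ _⟩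
    · rw [prod_restrict_stdNormal]
      filter_upwards [ae_restrict_mem (measurableSet_Icc.prod MeasurableSet.univ)] with ω hω
      exact hgb _ (hmem _ hω.1) _
  refine ⟨hI2, hfix.trans ?_⟩
  congr 1
  rw [integral_prod _ hI, picardSample, integral_prod _ hI2]
  simp only [integral_const_mul]
  rw [integral_Icc_eq_integral_Ioc, ← intervalIntegral.integral_of_le hR0.le,
    ← intervalIntegral.integral_of_le zero_le_one]
  have hsub := intervalIntegral.integral_comp_mul_deriv'' (a := 0) (b := R)
    (f := fun ρ => t - ρ ^ 2 / 2) (f' := fun ρ => -ρ) (g := J) (by fun_prop)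
    (fun ρ _ => (((hasDerivAt_pow 2 ρ).div_const 2).const_sub t).congr_deriv
      (by simp) |>.hasDerivWithinAt) (by fun_prop) (by
      refine hJc.mono ?_
      rintro _ ⟨ρ, hρ, rfl⟩
      rw [uIcc_of_le hR0.le] at hρ
      have : ρ ^ 2 ≤ R ^ 2 := pow_le_pow_left₀ hρ.1 hρ.2 2
      exact ⟨by simp only; linarith, by simp only; linarith [sq_nonneg ρ]⟩)
  simp only [Function.comp_def, hR2, mul_div_cancel_left₀ t (two_ne_zero' ℝ), sub_self, ne_eq,
    OfNat.ofNat_ne_zero, not_false_eq_true, zero_pow, zero_div, sub_zero] at hsub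
  have hlin : t * ∫ r in (0 : ℝ)..1, J (t * r) = ∫ s in (0 : ℝ)..t, J s := by
    rw [← smul_eq_mul,
      intervalIntegral.smul_integral_comp_mul_left]
    simp
  change _ = t * ∫ r in (0 : ℝ)..1, J (t * r)
  rw [hlin, intervalIntegral.integral_symm t 0, ← hsub, ← intervalIntegral.integral_neg]
  refine intervalIntegral.integral_congr fun ρ hρ => ?_
  rw [uIcc_of_le hR0.le] at hρ
  simp only [hJ, hg]
  have : √(2 * (t - (t - ρ ^ 2 / 2))) = ρ := by
    rw [show 2 * (t - (t - ρ ^ 2 / 2)) = ρ ^ 2 by ring, Real.sqrt_sq hρ.1]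
  rw [this]
  ring

section

open scoped ENNReal

/-- The uniform distribution on the unit cube and an independent standard normal vector. -/
def cubeNormal (d : ℕ) : Measure ((Fin d → ℝ) × (Fin d → ℝ)) :=
  (volume.restrict (unitCube d)).prod (stdNormal d)

/-- An exponentially weighted measure on `[0, T]` with an atom at `T`, normalised so that its
tails are `exp (-b s) / b`. -/
def timeWeight (T b : ℝ) : Measure ℝ :=
  (volume.restrict (Icc 0 T)).withDensity (fun s => ENNReal.ofReal (Real.exp (-b * s))) +
    ENNReal.ofReal (Real.exp (-b * T) / b) • Measure.dirac T

/-- The space-time reference measure: a weighted time, and a Brownian path started uniformly in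
the cube and evaluated at the remaining time. -/
def picardMeasure (d : ℕ) (T b : ℝ) : Measure (ℝ × (Fin d → ℝ)) :=
  ((timeWeight T b).prod (cubeNormal d)).map
    fun p => (p.1, p.2.1 + √(2 * (T - p.1)) • p.2.2)

instance (d : ℕ) : IsProbabilityMeasure (volume.restrict (unitCube d)) :=
  ⟨by rw [Measure.restrict_apply_univ, unitCube, volume_pi_pi]; simp⟩

instance (d : ℕ) : IsProbabilityMeasure (cubeNormal d) := by
  unfold cubeNormal; infer_instance

instance (T b : ℝ) : IsFiniteMeasure (timeWeight T b) := by
  have h : Integrable (fun s => Real.exp (-b * s)) (volume.restrict (Icc 0 T)) :=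
    ContinuousOn.integrableOn_compact isCompact_Icc (by fun_prop)
  have : IsFiniteMeasure ((volume.restrict (Icc 0 T)).withDensity
      (fun s => ENNReal.ofReal (Real.exp (-b * s)))) :=
    isFiniteMeasure_withDensity_ofReal h.2
  have : IsFiniteMeasure (ENNReal.ofReal (Real.exp (-b * T) / b) • Measure.dirac T) :=
    ⟨by simp⟩
  unfold timeWeight
  infer_instance

instance (d : ℕ) (T b : ℝ) : IsFiniteMeasure (picardMeasure d T b) := by
  unfold picardMeasure; infer_instance

theorem lintegral_timeWeight (T b : ℝ) {a : ℝ → ℝ≥0∞} (ha : Measurable a) :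
    ∫⁻ s, a s ∂(timeWeight T b) =
      (∫⁻ s in Icc 0 T, ENNReal.ofReal (Real.exp (-b * s)) * a s) +
        ENNReal.ofReal (Real.exp (-b * T) / b) * a T := by
  rw [timeWeight, lintegral_add_measure, lintegral_withDensity_eq_lintegral_mul _ (by fun_prop) ha,
    lintegral_smul_measure, lintegral_dirac' _ ha]
  rfl

theorem timeWeight_Ici {T b s : ℝ} (hb : 0 < b) (hs : s ∈ Icc 0 T) :
    timeWeight T b (Ici s) = ENNReal.ofReal (Real.exp (-b * s) / b) := by
  have h1 := lintegral_timeWeight T b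
    (a := (Ici s).indicator 1) (measurable_one.indicator measurableSet_Ici)
  rw [lintegral_indicator_one measurableSet_Ici] at h1
  rw [h1]
  have h2 : ∀ r, ENNReal.ofReal (Real.exp (-b * r)) * (Ici s).indicator 1 r =
      (Ici s).indicator (fun r => ENNReal.ofReal (Real.exp (-b * r))) r := by
    intro r
    by_cases hr : r ∈ Ici s <;> simp [hr]
  simp only [h2]
  rw [lintegral_indicator measurableSet_Ici, Measure.restrict_restrict measurableSet_Ici]
  have h3 : Ici s ∩ Icc 0 T = Icc s T := by
    ext r; simp only [mem_inter_iff, mem_Ici, mem_Icc]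
    exact ⟨fun h => ⟨h.1, h.2.2⟩, fun h => ⟨h.1, hs.1.trans h.1, h.2⟩⟩
  have h4 : (Ici s).indicator (1 : ℝ → ℝ≥0∞) T = 1 := by simp [hs.2]
  have hint : Integrable (fun r => Real.exp (-b * r)) (volume.restrict (Icc s T)) :=
    ContinuousOn.integrableOn_compact isCompact_Icc (by fun_prop)
  rw [h3, h4, mul_one, ← ofReal_integral_eq_lintegral_ofReal hint
    (Filter.Eventually.of_forall fun r => (Real.exp_pos _).le),
    ← ENNReal.ofReal_add (integral_nonneg fun r => (Real.exp_pos _).le)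
      (by positivity)]
  congr 1
  rw [integral_Icc_eq_integral_Ioc, ← intervalIntegral.integral_of_le hs.2]
  have hF : ∀ r ∈ uIcc s T,
      HasDerivAt (fun r => -(Real.exp (-b * r) / b)) (Real.exp (-b * r)) r := by
    intro r _
    have := (((hasDerivAt_id r).const_mul (-b)).exp.div_const b).neg
    refine this.congr_deriv ?_
    simp only [id]
    field_simp
  rw [intervalIntegral.integral_eq_sub_of_hasDerivAt hF
    (Continuous.intervalIntegrable (by fun_prop) _ _)]
  ring

theorem ae_mem_timeWeight {T b : ℝ} (hT : 0 ≤ T) : ∀ᵐ s ∂(timeWeight T b), s ∈ Icc 0 T := by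
  rw [timeWeight, ae_add_measure_iff]
  refine ⟨?_, ?_⟩
  · exact (withDensity_absolutelyContinuous _ _).ae_le (ae_restrict_mem measurableSet_Icc)
  · refine Measure.ae_smul_measure ?_ _
    exact (ae_dirac_iff (p := fun s => s ∈ Icc 0 T) measurableSet_Icc).2 ⟨hT, le_rfl⟩

theorem timeWeight_univ {T b : ℝ} (hT : 0 ≤ T) (hb : 0 < b) :
    timeWeight T b univ = ENNReal.ofReal (1 / b) := by
  have h := timeWeight_Ici hb (⟨le_rfl, hT⟩ : (0 : ℝ) ∈ Icc 0 T)
  rw [mul_zero, Real.exp_zero] at h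
  rw [← h]
  refine measure_congr (Filter.eventuallyEq_set.2 ?_)
  filter_upwards [ae_mem_timeWeight (b := b) hT] with s hs
  simp [hs.1]

theorem measurable_picardMeasure_map (d : ℕ) (T : ℝ) : Measurable
    fun p : ℝ × ((Fin d → ℝ) × (Fin d → ℝ)) => (p.1, p.2.1 + √(2 * (T - p.1)) • p.2.2) := by
  fun_prop

theorem lintegral_picardMeasure {d : ℕ} {T b : ℝ} {G : ℝ × (Fin d → ℝ) → ℝ≥0∞}
    (hG : Measurable G) :
    ∫⁻ y, G y ∂(picardMeasure d T b) =
      ∫⁻ s, ∫⁻ p, G (s, p.1 + √(2 * (T - s)) • p.2) ∂(cubeNormal d) ∂(timeWeight T b) := by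
  rw [picardMeasure, lintegral_map hG (measurable_picardMeasure_map d T), lintegral_prod]
  exact (hG.comp (measurable_picardMeasure_map d T)).aemeasurable

theorem ae_mem_picardMeasure {d : ℕ} {T b : ℝ} (hT : 0 ≤ T) :
    ∀ᵐ y ∂(picardMeasure d T b), y.1 ∈ Icc 0 T := by
  rw [picardMeasure, ae_map_iff (measurable_picardMeasure_map d T).aemeasurable
    (measurable_fst measurableSet_Icc)]
  exact Measure.quasiMeasurePreserving_fst.ae (ae_mem_timeWeight hT)

theorem lintegral_stdNormal_add {d : ℕ} {a b c : ℝ} (habc : c ^ 2 = a ^ 2 + b ^ 2)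
    {H : (Fin d → ℝ) → ℝ≥0∞} (hH : Measurable H) :
    ∫⁻ z, ∫⁻ z', H (a • z + b • z') ∂(stdNormal d) ∂(stdNormal d) =
      ∫⁻ z, H (c • z) ∂(stdNormal d) := by
  have h1 := lintegral_map (μ := (stdNormal d).prod (stdNormal d)) hH
    (show Measurable fun p : (Fin d → ℝ) × (Fin d → ℝ) => a • p.1 + b • p.2 by fun_prop)
  rw [map_stdNormal_prod d habc, lintegral_map hH (by fun_prop)] at h1
  rw [h1, lintegral_prod _ (by fun_prop)]

theorem lintegral_cubeNormal_add {d : ℕ} {a b c : ℝ} (habc : c ^ 2 = a ^ 2 + b ^ 2)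
    {H : (Fin d → ℝ) → ℝ≥0∞} (hH : Measurable H) :
    ∫⁻ p, ∫⁻ z', H (p.1 + a • p.2 + b • z') ∂(stdNormal d) ∂(cubeNormal d) =
      ∫⁻ p, H (p.1 + c • p.2) ∂(cubeNormal d) := by
  have hm : Measurable fun p : (Fin d → ℝ) × (Fin d → ℝ) =>
      ∫⁻ z', H (p.1 + a • p.2 + b • z') ∂(stdNormal d) :=
    Measurable.lintegral_prod_right'
      (f := fun q : ((Fin d → ℝ) × (Fin d → ℝ)) × (Fin d → ℝ) =>
        H (q.1.1 + a • q.1.2 + b • q.2)) (by fun_prop)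
  rw [cubeNormal, lintegral_prod _ hm.aemeasurable, lintegral_prod _ (by fun_prop)]
  refine lintegral_congr fun x => ?_
  simp only [add_assoc]
  exact lintegral_stdNormal_add habc (H := fun v => H (x + v)) (by fun_prop)

theorem ofReal_mul_lintegral_Icc_comp_mul_le {t : ℝ} (ht : 0 ≤ t) (a : ℝ → ℝ≥0∞) :
    ENNReal.ofReal t * ∫⁻ r in Icc (0 : ℝ) 1, a (t * r) ≤ ∫⁻ s in Icc 0 t, a s := by
  rcases ht.eq_or_lt with rfl | ht
  · simp
  have h := lintegral_image_eq_lintegral_abs_deriv_mul (s := Icc (0 : ℝ) 1) (f := fun r => t * r)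
    (f' := fun _ => t) measurableSet_Icc
    (fun r _ => by simpa using ((hasDerivAt_id r).const_mul t).hasDerivWithinAt)
    (fun r _ r' _ h => mul_left_cancel₀ ht.ne' h) a
  rw [image_mul_left_Icc' ht, mul_zero, mul_one] at h
  rw [h, abs_of_pos ht, lintegral_const_mul' _ _ ENNReal.ofReal_ne_top]

theorem measurable_picardPoint (d : ℕ) : Measurable
    fun q : (ℝ × (Fin d → ℝ)) × (ℝ × (Fin d → ℝ)) => picardPoint q.1.1 q.1.2 q.2 := by
  unfold picardPoint
  fun_prop

theorem lintegral_cubeNormal_picardPoint {d : ℕ} {T t : ℝ} (ht : t ∈ Icc 0 T)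
    {G : ℝ × (Fin d → ℝ) → ℝ≥0∞} (hG : Measurable G) :
    ∫⁻ p, ∫⁻ ω, G (picardPoint t (p.1 + √(2 * (T - t)) • p.2) ω) ∂(picardSample d)
        ∂(cubeNormal d) =
      ∫⁻ r in Icc (0 : ℝ) 1, ∫⁻ p, G (t * r, p.1 + √(2 * (T - t * r)) • p.2) ∂(cubeNormal d) := by
  have hm : Measurable fun q : ((Fin d → ℝ) × (Fin d → ℝ)) × (ℝ × (Fin d → ℝ)) =>
      G (picardPoint t (q.1.1 + √(2 * (T - t)) • q.1.2) q.2) := by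
    unfold picardPoint; fun_prop
  have h1 : ∀ p : (Fin d → ℝ) × (Fin d → ℝ),
      ∫⁻ ω, G (picardPoint t (p.1 + √(2 * (T - t)) • p.2) ω) ∂(picardSample d) =
      ∫⁻ r in Icc (0 : ℝ) 1, ∫⁻ z,
        G (picardPoint t (p.1 + √(2 * (T - t)) • p.2) (r, z)) ∂(stdNormal d) := by
    intro p
    have h := hm.comp (measurable_prodMk_left (x := p))
    rw [picardSample]
    exact lintegral_prod _ h.aemeasurable
  simp only [h1]
  rw [lintegral_lintegral_swap]
  · refine setLIntegral_congr_fun measurableSet_Icc fun r hr => ?_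
    have h2 : t * r ≤ T := (mul_le_of_le_one_right ht.1 hr.2).trans ht.2
    refine lintegral_cubeNormal_add (H := fun v => G (t * r, v)) (a := √(2 * (T - t)))
      (b := √(2 * (t * (1 - r)))) ?_ (by fun_prop)
    rw [Real.sq_sqrt (by linarith), Real.sq_sqrt (by linarith [ht.2]),
      Real.sq_sqrt (by nlinarith [ht.1, hr.2, mul_nonneg ht.1 (sub_nonneg.2 hr.2)])]
    ring
  · refine Measurable.aemeasurable ?_
    exact Measurable.lintegral_prod_right'
      (f := fun q : (((Fin d → ℝ) × (Fin d → ℝ)) × ℝ) × (Fin d → ℝ) =>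
        G (picardPoint t (q.1.1.1 + √(2 * (T - t)) • q.1.1.2) (q.1.2, q.2)))
      (by unfold picardPoint; fun_prop)

theorem lintegral_picardMeasure_picardPoint_le {d : ℕ} {T b : ℝ} (hT : 0 ≤ T) (hb : 0 < b)
    {G : ℝ × (Fin d → ℝ) → ℝ≥0∞} (hG : Measurable G) :
    ∫⁻ y, ∫⁻ ω, ENNReal.ofReal (y.1 ^ 2) * G (picardPoint y.1 y.2 ω) ∂(picardSample d)
        ∂(picardMeasure d T b) ≤
      ENNReal.ofReal (T / b) * ∫⁻ y, G y ∂(picardMeasure d T b) := by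
  have hGm : Measurable fun q : (ℝ × (Fin d → ℝ)) × (ℝ × (Fin d → ℝ)) =>
      ENNReal.ofReal (q.1.1 ^ 2) * G (picardPoint q.1.1 q.1.2 q.2) := by
    unfold picardPoint; fun_prop
  have hGω : Measurable fun y : ℝ × (Fin d → ℝ) =>
      ∫⁻ ω, ENNReal.ofReal (y.1 ^ 2) * G (picardPoint y.1 y.2 ω) ∂(picardSample d) :=
    hGm.lintegral_prod_right'
  set A : ℝ → ℝ≥0∞ := fun s => ∫⁻ p, G (s, p.1 + √(2 * (T - s)) • p.2) ∂(cubeNormal d) with hA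
  have hAm : Measurable A := Measurable.lintegral_prod_right'
    (f := fun q : ℝ × ((Fin d → ℝ) × (Fin d → ℝ)) => G (q.1, q.2.1 + √(2 * (T - q.1)) • q.2.2))
    (by fun_prop)
  have hind : Measurable fun q : ℝ × ℝ => if q.2 ≤ q.1 then A q.2 else 0 :=
    Measurable.ite (measurableSet_le measurable_snd measurable_fst)
      (hAm.comp measurable_snd) measurable_const
  rw [lintegral_picardMeasure hGω, lintegral_picardMeasure hG]
  calc
    _ ≤ ∫⁻ t, (ENNReal.ofReal T * ∫⁻ s in Icc 0 T, if s ≤ t then A s else 0) ∂(timeWeight T b) := by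
      refine lintegral_mono_ae ?_
      filter_upwards [ae_mem_timeWeight (b := b) hT] with t ht
      simp only [lintegral_const_mul' _ _ ENNReal.ofReal_ne_top]
      rw [lintegral_cubeNormal_picardPoint ht hG, pow_two, ENNReal.ofReal_mul ht.1, mul_assoc]
      gcongr
      · exact ht.2
      refine (ofReal_mul_lintegral_Icc_comp_mul_le ht.1 A).trans ?_
      calc ∫⁻ s in Icc 0 t, A s = ∫⁻ s in Icc 0 t, (if s ≤ t then A s else 0) :=
            setLIntegral_congr_fun measurableSet_Icc fun s hs => by simp [hs.2]
        _ ≤ _ := lintegral_mono_set (Icc_subset_Icc_right ht.2)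
    _ = ENNReal.ofReal T * ∫⁻ s in Icc 0 T, ENNReal.ofReal (Real.exp (-b * s) / b) * A s := by
      rw [lintegral_const_mul' _ _ ENNReal.ofReal_ne_top,
        lintegral_lintegral_swap hind.aemeasurable]
      congr 1
      refine setLIntegral_congr_fun measurableSet_Icc fun s hs => ?_
      rw [← timeWeight_Ici hb hs, mul_comm, ← setLIntegral_const,
        ← lintegral_indicator measurableSet_Ici]
      refine lintegral_congr fun t => ?_
      simp [indicator]
    _ = ENNReal.ofReal (T / b) * ∫⁻ s in Icc 0 T, ENNReal.ofReal (Real.exp (-b * s)) * A s := by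
      have : ∀ s, ENNReal.ofReal (Real.exp (-b * s) / b) * A s =
          ENNReal.ofReal (1 / b) * (ENNReal.ofReal (Real.exp (-b * s)) * A s) := by
        intro s
        rw [← mul_assoc, ← ENNReal.ofReal_mul (by positivity)]
        congr 2; ring
      simp only [this]
      rw [lintegral_const_mul' _ _ ENNReal.ofReal_ne_top, ← mul_assoc,
        ← ENNReal.ofReal_mul hT]
      congr 2; ring
    _ ≤ _ := by
      rw [lintegral_timeWeight T b hAm]
      gcongr
      exact le_self_add

theorem lintegral_picardMeasure_heat {d : ℕ} {T b : ℝ} (hT : 0 ≤ T) (hb : 0 < b)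
    {H : (Fin d → ℝ) → ℝ≥0∞} (hH : Measurable H) :
    ∫⁻ y, ∫⁻ z, H (y.2 + √(2 * y.1) • z) ∂(stdNormal d) ∂(picardMeasure d T b) =
      ENNReal.ofReal (1 / b) * ∫⁻ p, H (p.1 + √(2 * T) • p.2) ∂(cubeNormal d) := by
  have hm : Measurable fun y : ℝ × (Fin d → ℝ) =>
      ∫⁻ z, H (y.2 + √(2 * y.1) • z) ∂(stdNormal d) :=
    Measurable.lintegral_prod_right'
      (f := fun q : (ℝ × (Fin d → ℝ)) × (Fin d → ℝ) => H (q.1.2 + √(2 * q.1.1) • q.2))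
      (by fun_prop)
  rw [lintegral_picardMeasure hm]
  calc
    _ = ∫⁻ t, ∫⁻ p, H (p.1 + √(2 * T) • p.2) ∂(cubeNormal d) ∂(timeWeight T b) := by
      refine lintegral_congr_ae ?_
      filter_upwards [ae_mem_timeWeight (b := b) hT] with t ht
      refine lintegral_cubeNormal_add ?_ hH
      rw [Real.sq_sqrt (by linarith), Real.sq_sqrt (by linarith [ht.2]),
        Real.sq_sqrt (by linarith [ht.1])]
      ring
    _ = _ := by rw [lintegral_const, timeWeight_univ hT hb, mul_comm]

theorem lintegral_unitCube_le_picardMeasure {d : ℕ} {T b : ℝ}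
    {G : ℝ × (Fin d → ℝ) → ℝ≥0∞} (hG : Measurable G) :
    ENNReal.ofReal (Real.exp (-b * T) / b) * ∫⁻ x in unitCube d, G (T, x) ≤
      ∫⁻ y, G y ∂(picardMeasure d T b) := by
  have hAm : Measurable fun s =>
      ∫⁻ p, G (s, p.1 + √(2 * (T - s)) • p.2) ∂(cubeNormal d) := Measurable.lintegral_prod_right'
    (f := fun q : ℝ × ((Fin d → ℝ) × (Fin d → ℝ)) => G (q.1, q.2.1 + √(2 * (T - q.1)) • q.2.2))
    (by fun_prop)
  rw [lintegral_picardMeasure hG, lintegral_timeWeight T b hAm]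
  refine le_trans (le_of_eq ?_) le_add_self
  congr 1
  simp only [sub_self, mul_zero, Real.sqrt_zero, zero_smul, add_zero]
  rw [cubeNormal, lintegral_prod _ (by fun_prop)]
  simp

theorem exists_lintegral_picardMeasure_polyGrowth_le {κ T : ℝ} (hκ : 0 < κ) (hT : 0 ≤ T) :
    ∃ C : ℝ, 1 ≤ C ∧ ∀ d : ℕ, 0 < d →
      (∫⁻ p, ENNReal.ofReal (polyGrowth κ (p.1 + √(2 * T) • p.2) ^ 4) ∂(cubeNormal d) ≤
        ENNReal.ofReal (C * (d : ℝ) ^ 4)) ∧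
      ∀ b, 0 < b → ∫⁻ y, ENNReal.ofReal (polyGrowth κ y.2 ^ 4) ∂(picardMeasure d T b) ≤
        ENNReal.ofReal (1 / b) * ENNReal.ofReal (C * (d : ℝ) ^ 4) := by
  obtain ⟨C, hC1, hC⟩ := exists_lintegral_polyGrowth_le hκ (Real.sqrt_nonneg (2 * T))
  refine ⟨C, hC1, fun d hd => ?_⟩
  have hmeas : Measurable fun x : Fin d → ℝ => ENNReal.ofReal (polyGrowth κ x ^ 4) :=
    (((continuous_polyGrowth hκ).pow 4).measurable).ennreal_ofReal
  have key : ∀ t ∈ Icc 0 T, ∫⁻ p, ENNReal.ofReal (polyGrowth κ (p.1 + √(2 * t) • p.2) ^ 4)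
      ∂(cubeNormal d) ≤ ENNReal.ofReal (C * (d : ℝ) ^ 4) := by
    intro t ht
    have hm : Measurable fun p : (Fin d → ℝ) × (Fin d → ℝ) =>
        ENNReal.ofReal (polyGrowth κ (p.1 + √(2 * t) • p.2) ^ 4) :=
      hmeas.comp (f := fun p : (Fin d → ℝ) × (Fin d → ℝ) => p.1 + √(2 * t) • p.2) (by fun_prop)
    rw [cubeNormal, lintegral_prod _ hm.aemeasurable]
    refine hC d hd _ ?_
    rw [abs_of_nonneg (Real.sqrt_nonneg _)]
    exact Real.sqrt_le_sqrt (by linarith [ht.2])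
  refine ⟨key T ⟨hT, le_rfl⟩, fun b hb => ?_⟩
  have hm : Measurable fun y : ℝ × (Fin d → ℝ) => ENNReal.ofReal (polyGrowth κ y.2 ^ 4) :=
    hmeas.comp measurable_snd
  rw [lintegral_picardMeasure hm, ← timeWeight_univ hT hb, mul_comm,
    ← lintegral_const]
  refine lintegral_mono_ae ?_
  filter_upwards [ae_mem_timeWeight (b := b) hT] with t ht
  exact key (T - t) ⟨by linarith [ht.2], by linarith [ht.1]⟩

/-- `φ` is measurable and its `L²(μ)`-norm is at most `a`. -/
structure L2Bound {Y : Type*} [MeasurableSpace Y] (μ : Measure Y) (φ : Y → ℝ) (a : ℝ) : Prop where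
  measurable : Measurable φ
  nonneg : 0 ≤ a
  le : ∫⁻ y, ENNReal.ofReal (φ y ^ 2) ∂μ ≤ ENNReal.ofReal (a ^ 2)

section

variable {Y : Type*} [MeasurableSpace Y] {μ : Measure Y} {φ ψ : Y → ℝ} {a b : ℝ}

theorem eLpNorm_two_sq (φ : Y → ℝ) :
    eLpNorm φ 2 μ ^ 2 = ∫⁻ y, ENNReal.ofReal (φ y ^ 2) ∂μ := by
  have h := eLpNorm_nnreal_pow_eq_lintegral (μ := μ) (f := φ) (p := 2) two_ne_zero
  simp only [NNReal.coe_ofNat, ENNReal.coe_ofNat, ENNReal.rpow_ofNat] at h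
  rw [h]
  refine lintegral_congr fun y => ?_
  rw [← enorm_pow, Real.enorm_of_nonneg (sq_nonneg _)]

theorem l2Bound_iff (hφ : Measurable φ) (ha : 0 ≤ a) :
    L2Bound μ φ a ↔ eLpNorm φ 2 μ ≤ ENNReal.ofReal a := by
  rw [← ENNReal.pow_le_pow_left_iff two_ne_zero, eLpNorm_two_sq, ← ENNReal.ofReal_pow ha]
  exact ⟨fun h => h.le, fun h => ⟨hφ, ha, h⟩⟩

theorem L2Bound.eLpNorm_le (h : L2Bound μ φ a) : eLpNorm φ 2 μ ≤ ENNReal.ofReal a :=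
  (l2Bound_iff h.measurable h.nonneg).1 h

theorem L2Bound.add (hφ : L2Bound μ φ a) (hψ : L2Bound μ ψ b) :
    L2Bound μ (fun y => φ y + ψ y) (a + b) := by
  refine (l2Bound_iff (hφ.measurable.add hψ.measurable) (add_nonneg hφ.nonneg hψ.nonneg)).2 ?_
  rw [ENNReal.ofReal_add hφ.nonneg hψ.nonneg]
  exact (eLpNorm_add_le hφ.measurable.aestronglyMeasurable hψ.measurable.aestronglyMeasurable
    one_le_two).trans (add_le_add hφ.eLpNorm_le hψ.eLpNorm_le)

theorem L2Bound.mono_ae (hψ : L2Bound μ ψ b) (hφ : Measurable φ)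
    (h : ∀ᵐ y ∂μ, |φ y| ≤ |ψ y|) : L2Bound μ φ b := by
  refine ⟨hφ, hψ.nonneg, le_trans (lintegral_mono_ae ?_) hψ.le⟩
  filter_upwards [h] with y hy
  exact ENNReal.ofReal_le_ofReal (sq_le_sq.2 hy)

theorem L2Bound.mono (hφ : L2Bound μ φ a) (hab : a ≤ b) : L2Bound μ φ b :=
  ⟨hφ.measurable, hφ.nonneg.trans hab, hφ.le.trans
    (ENNReal.ofReal_le_ofReal (pow_le_pow_left₀ hφ.nonneg hab 2))⟩

theorem L2Bound.neg (hφ : L2Bound μ φ a) : L2Bound μ (fun y => -φ y) a :=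
  hφ.mono_ae hφ.measurable.neg (by simp)

theorem L2Bound.sub (hφ : L2Bound μ φ a) (hψ : L2Bound μ ψ b) :
    L2Bound μ (fun y => φ y - ψ y) (a + b) := by
  simpa only [sub_eq_add_neg] using hφ.add hψ.neg

theorem L2Bound.const_mul (hφ : L2Bound μ φ a) {c : ℝ} (hc : 0 ≤ c) :
    L2Bound μ (fun y => c * φ y) (c * a) := by
  refine ⟨hφ.measurable.const_mul c, mul_nonneg hc hφ.nonneg, ?_⟩
  simp only [mul_pow, ENNReal.ofReal_mul (sq_nonneg c)]
  rw [lintegral_const_mul' _ _ ENNReal.ofReal_ne_top]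
  gcongr
  exact hφ.le

theorem L2Bound.sum {ι : Type*} {s : Finset ι} {φ : ι → Y → ℝ} {a : ι → ℝ}
    (h : ∀ i ∈ s, L2Bound μ (φ i) (a i)) :
    L2Bound μ (fun y => ∑ i ∈ s, φ i y) (∑ i ∈ s, a i) := by
  classical
  induction s using Finset.induction_on with
  | empty => exact ⟨by simp, by simp, by simp⟩
  | insert i s hi ih =>
    simp only [Finset.sum_insert hi]
    exact (h i (Finset.mem_insert_self i s)).add
      (ih fun j hj => h j (Finset.mem_insert_of_mem hj))

end

section

variable {Ω : Type*} [MeasurableSpace Ω] {P : Measure Ω}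

theorem memLp_two_of_lintegral_sq_ne_top {X : Ω → ℝ} (hX : Measurable X)
    (h : ∫⁻ ω, ENNReal.ofReal (X ω ^ 2) ∂P ≠ ∞) : MemLp X 2 P := by
  refine ⟨hX.aestronglyMeasurable, ?_⟩
  rw [← eLpNorm_two_sq] at h
  exact lt_top_iff_ne_top.2 fun h' => h (by simp [h'])

variable [IsProbabilityMeasure P]

theorem ofReal_integral_sq_le {X : Ω → ℝ} (hX : Measurable X) :
    ENNReal.ofReal ((∫ ω, X ω ∂P) ^ 2) ≤ ∫⁻ ω, ENNReal.ofReal (X ω ^ 2) ∂P := by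
  by_cases h : ∫⁻ ω, ENNReal.ofReal (X ω ^ 2) ∂P = ∞
  · simp [h]
  have hL := memLp_two_of_lintegral_sq_ne_top hX h
  have hv := variance_eq_sub hL
  have hnn := variance_nonneg X P
  rw [← ofReal_integral_eq_lintegral_ofReal hL.integrable_sq
    (Filter.Eventually.of_forall fun _ => sq_nonneg _)]
  refine ENNReal.ofReal_le_ofReal ?_
  simp only [Pi.pow_apply] at hv
  linarith

theorem lintegral_average_sub_sq_le {X : Ω → ℝ} (hX : Measurable X) {m : ℕ} (hm : 0 < m) :
    ∫⁻ ω : Fin m → Ω, ENNReal.ofReal (((∑ i, (1 / (m : ℝ)) * X (ω i)) - ∫ ω, X ω ∂P) ^ 2)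
        ∂(Measure.pi fun _ => P) ≤
      ENNReal.ofReal (1 / m) * ∫⁻ ω, ENNReal.ofReal (X ω ^ 2) ∂P := by
  have hm' : (0 : ℝ) < m := by exact_mod_cast hm
  by_cases h : ∫⁻ ω, ENNReal.ofReal (X ω ^ 2) ∂P = ∞
  · rw [h, ENNReal.mul_top (by simpa using hm.ne')]
    exact le_top
  have hL := memLp_two_of_lintegral_sq_ne_top hX h
  have hLc : MemLp (fun ω => (1 / (m : ℝ)) * X ω) 2 P := hL.const_mul _
  have hint : Integrable X P := hL.integrable one_le_two
  have hcoord : ∀ i : Fin m, MemLp (fun ω : Fin m → Ω => (1 / (m : ℝ)) * X (ω i)) 2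
      (Measure.pi fun _ => P) :=
    fun i => hLc.comp_measurePreserving (measurePreserving_eval _ i)
  have hE : ∫ ω : Fin m → Ω, ∑ i, (1 / (m : ℝ)) * X (ω i) ∂(Measure.pi fun _ => P) =
      ∫ ω, X ω ∂P := by
    rw [integral_finsetSum _ fun i _ => (hcoord i).integrable one_le_two]
    simp_rw [integral_const_mul]
    have : ∀ i : Fin m, ∫ ω : Fin m → Ω, X (ω i) ∂(Measure.pi fun _ => P) = ∫ ω, X ω ∂P :=
      fun i => integral_comp_eval (μ := fun _ : Fin m => P) hX.aestronglyMeasurable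
    simp only [this, Finset.sum_const, Finset.card_univ, Fintype.card_fin, nsmul_eq_mul]
    field_simp
  have hvar := variance_sum_pi (μ := fun _ : Fin m => P)
    (X := fun _ ω => (1 / (m : ℝ)) * X ω) fun _ => hLc
  have hsum : MemLp (∑ i : Fin m, fun ω : Fin m → Ω => (1 / (m : ℝ)) * X (ω i)) 2
      (Measure.pi fun _ => P) := memLp_finsetSum' _ fun i _ => hcoord i
  have hev := evariance_eq_lintegral_ofReal
    (X := ∑ i : Fin m, fun ω : Fin m → Ω => (1 / (m : ℝ)) * X (ω i)) (μ := Measure.pi fun _ => P)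
  simp only [Finset.sum_apply, hE] at hev
  rw [← hev, ← ofReal_variance hsum, hvar,
    ← ofReal_integral_eq_lintegral_ofReal hL.integrable_sq
      (Filter.Eventually.of_forall fun _ => sq_nonneg _), ← ENNReal.ofReal_mul (by positivity)]
  refine ENNReal.ofReal_le_ofReal ?_
  simp only [variance_const_mul, Finset.sum_const, Finset.card_univ, Fintype.card_fin,
    nsmul_eq_mul]
  have hv := variance_le_expectation_sq (μ := P) hX.aestronglyMeasurable
  simp only [Pi.pow_apply] at hv
  calc (m : ℝ) * ((1 / m) ^ 2 * variance X P) = 1 / m * variance X P := by field_simp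
    _ ≤ _ := by gcongr

variable {Y : Type*} [MeasurableSpace Y] {μ : Measure Y} {h : Y → Ω → ℝ} {c : ℝ}

theorem L2Bound.integral (hh : Measurable fun q : Y × Ω => h q.1 q.2) (hc : 0 ≤ c)
    (hle : ∫⁻ y, ∫⁻ ω, ENNReal.ofReal (h y ω ^ 2) ∂P ∂μ ≤ ENNReal.ofReal (c ^ 2)) :
    L2Bound μ (fun y => ∫ ω, h y ω ∂P) c :=
  ⟨(hh.stronglyMeasurable.integral_prod_right').measurable, hc,
    (lintegral_mono fun _ => ofReal_integral_sq_le (hh.comp measurable_prodMk_left)).trans hle⟩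

theorem ae_memLp_two_of_lintegral_le (hh : Measurable fun q : Y × Ω => h q.1 q.2)
    (hle : ∫⁻ y, ∫⁻ ω, ENNReal.ofReal (h y ω ^ 2) ∂P ∂μ ≤ ENNReal.ofReal (c ^ 2)) :
    ∀ᵐ y ∂μ, MemLp (h y) 2 P := by
  have hm : Measurable fun y => ∫⁻ ω, ENNReal.ofReal (h y ω ^ 2) ∂P :=
    Measurable.lintegral_prod_right' (f := fun q : Y × Ω => ENNReal.ofReal (h q.1 q.2 ^ 2))
      (hh.pow_const 2).ennreal_ofReal
  filter_upwards [ae_lt_top hm (hle.trans_lt ENNReal.ofReal_lt_top).ne] with y hy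
  exact memLp_two_of_lintegral_sq_ne_top (hh.comp measurable_prodMk_left) hy.ne

theorem exists_average_l2Bound [SFinite μ] (hh : Measurable fun q : Y × Ω => h q.1 q.2) (hc : 0 ≤ c)
    (hle : ∫⁻ y, ∫⁻ ω, ENNReal.ofReal (h y ω ^ 2) ∂P ∂μ ≤ ENNReal.ofReal (c ^ 2))
    {m : ℕ} (hm : 0 < m) :
    ∃ ω : Fin m → Ω, L2Bound μ (fun y => (∑ i, (1 / (m : ℝ)) * h y (ω i)) - ∫ ω, h y ω ∂P)
      (c / √m) := by
  have hI : Measurable fun y => ∫ ω, h y ω ∂P :=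
    (hh.stronglyMeasurable.integral_prod_right').measurable
  have hJ : Measurable fun q : Y × (Fin m → Ω) =>
      (∑ i, (1 / (m : ℝ)) * h q.1 (q.2 i)) - ∫ ω, h q.1 ω ∂P := by
    refine (Finset.measurable_fun_sum _ fun i _ => ?_).sub (hI.comp measurable_fst)
    refine Measurable.const_mul ?_ _
    exact hh.comp (measurable_fst.prodMk ((measurable_pi_apply i).comp measurable_snd))
  have hJ2 : Measurable fun q : (Fin m → Ω) × Y => ENNReal.ofReal
      (((∑ i, (1 / (m : ℝ)) * h q.2 (q.1 i)) - ∫ ω, h q.2 ω ∂P) ^ 2) :=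
    ((hJ.comp measurable_swap).pow_const 2).ennreal_ofReal
  obtain ⟨ω, hω⟩ := exists_le_lintegral (μ := Measure.pi fun _ : Fin m => P)
    (f := fun ω => ∫⁻ y, ENNReal.ofReal
      (((∑ i, (1 / (m : ℝ)) * h y (ω i)) - ∫ ω, h y ω ∂P) ^ 2) ∂μ)
    (Measurable.lintegral_prod_right' hJ2).aemeasurable
  refine ⟨ω, hJ.comp measurable_prodMk_right, by positivity, hω.trans ?_⟩
  rw [lintegral_lintegral_swap hJ2.aemeasurable]
  calc
    _ ≤ ∫⁻ y, ENNReal.ofReal (1 / m) * ∫⁻ ω, ENNReal.ofReal (h y ω ^ 2) ∂P ∂μ :=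
      lintegral_mono fun y => lintegral_average_sub_sq_le (hh.comp measurable_prodMk_left) hm
    _ ≤ ENNReal.ofReal (1 / m) * ENNReal.ofReal (c ^ 2) := by
      rw [lintegral_const_mul' _ _ ENNReal.ofReal_ne_top]
      gcongr
    _ = _ := by
      rw [← ENNReal.ofReal_mul (by positivity), div_pow, Real.sq_sqrt (by positivity)]
      congr 1; ring

end

theorem measurable_mul_comp_picardPoint {d : ℕ} {G : ℝ × (Fin d → ℝ) → ℝ} (hG : Measurable G) :
    Measurable fun q : (ℝ × (Fin d → ℝ)) × (ℝ × (Fin d → ℝ)) =>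
      q.1.1 * G (picardPoint q.1.1 q.1.2 q.2) :=
  (measurable_fst.comp measurable_fst).mul (hG.comp (measurable_picardPoint d))

theorem L2Bound.lintegral_picardPoint_le {d : ℕ} {T b c : ℝ} (hT : 0 ≤ T) (hb : 0 < b)
    {G : ℝ × (Fin d → ℝ) → ℝ} (hG : L2Bound (picardMeasure d T b) G c) :
    ∫⁻ y, ∫⁻ ω, ENNReal.ofReal ((y.1 * G (picardPoint y.1 y.2 ω)) ^ 2) ∂(picardSample d)
        ∂(picardMeasure d T b) ≤ ENNReal.ofReal ((√(T / b) * c) ^ 2) := by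
  have h := lintegral_picardMeasure_picardPoint_le hT hb (G := fun y => ENNReal.ofReal (G y ^ 2))
    (hG.measurable.pow_const 2).ennreal_ofReal
  simp only [mul_pow, ENNReal.ofReal_mul (sq_nonneg _)]
  rw [Real.sq_sqrt (by positivity)]
  refine h.trans ?_
  gcongr
  exact hG.le

theorem measurable_comp_heat {d : ℕ} {H : (Fin d → ℝ) → ℝ} (hH : Measurable H) :
    Measurable fun q : (ℝ × (Fin d → ℝ)) × (Fin d → ℝ) => H (q.1.2 + √(2 * q.1.1) • q.2) :=
  hH.comp (by fun_prop)

theorem L2Bound.lintegral_heat_le {d : ℕ} {T b c : ℝ} (hT : 0 ≤ T) (hb : 1 ≤ b)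
    {H : (Fin d → ℝ) → ℝ} (hH : Measurable H)
    (hc : L2Bound (cubeNormal d) (fun p => H (p.1 + √(2 * T) • p.2)) c) :
    ∫⁻ y, ∫⁻ z, ENNReal.ofReal (H (y.2 + √(2 * y.1) • z) ^ 2) ∂(stdNormal d)
        ∂(picardMeasure d T b) ≤ ENNReal.ofReal (c ^ 2) := by
  rw [lintegral_picardMeasure_heat hT (by linarith) (H := fun x => ENNReal.ofReal (H x ^ 2))
    (hH.pow_const 2).ennreal_ofReal]
  calc _ ≤ ENNReal.ofReal (1 / b) * ENNReal.ofReal (c ^ 2) := by gcongr; exact hc.le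
    _ ≤ 1 * ENNReal.ofReal (c ^ 2) := by
      gcongr
      rw [ENNReal.ofReal_le_one, div_le_one (by linarith)]
      exact hb
    _ = _ := one_mul _

theorem multilevel_error_le {T K α β0 β1 β2 B θ s : ℝ} (hK : 0 ≤ K) (hα : 0 ≤ α) (hβ0 : 0 ≤ β0)
    (hβ1 : 0 ≤ β1) (hθ : 0 ≤ θ) (hs0 : 0 ≤ s) (hs1 : s ≤ 1) (hB : α + √T * β0 ≤ B)
    (hBθ : β2 + √T * β1 ≤ B * θ) (n : ℕ) {e c : ℕ → ℝ}
    (he : ∀ l, e l = B * (1 + 3 * (√T * K)) ^ l * (s ^ l + θ))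
    (hc0 : c 0 = β0) (hc : ∀ l, c (l + 1) = K * (e (l + 1) + e l)) :
    α * s ^ (n + 1) + β2 + ∑ l ∈ Finset.range (n + 1), √T * s * c l * s ^ (n + 1 - l) +
      √T * s * (K * e n + β1) ≤ e (n + 1) := by
  set C0 := √T * K with hC0
  have hC0n : 0 ≤ C0 := by positivity
  set C := 1 + 3 * C0 with hC
  have hC1 : 1 ≤ C := by linarith
  have hBn : 0 ≤ B := le_trans (by positivity) hB
  set X := s ^ (n + 1) + θ with hX
  have hXn : 0 ≤ X := by positivity
  have hpow : ∀ j, s ^ j ≤ 1 := fun j => pow_le_one₀ hs0 hs1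
  have hkey : ∀ l j i, l + j = n + 1 + i → s ^ j * (s ^ l + θ) ≤ X := by
    intro l j i h
    have h1 : s ^ j * s ^ l ≤ s ^ (n + 1) := by
      rw [← pow_add]
      exact pow_le_pow_of_le_one hs0 hs1 (by omega)
    have h2 : s ^ j * θ ≤ θ := mul_le_of_le_one_left hθ (hpow j)
    rw [mul_add]
    linarith
  have hterm : ∀ l ∈ Finset.range (n + 1), √T * s * c l * s ^ (n + 1 - l) ≤
      (if l = 0 then √T * β0 * s ^ (n + 1) else 0) + 2 * C0 * B * X * C ^ l := by
    intro l hl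
    have hl' : l ≤ n := Nat.lt_succ_iff.1 (Finset.mem_range.1 hl)
    rcases l with _ | l
    · simp only [hc0, if_true, Nat.sub_zero]
      have h1 : √T * s * β0 * s ^ (n + 1) ≤ √T * β0 * s ^ (n + 1) := by
        have : √T * β0 * s ^ (n + 1) * s ≤ √T * β0 * s ^ (n + 1) :=
          mul_le_of_le_one_right (by positivity) hs1
        nlinarith
      have h2 : 0 ≤ 2 * C0 * B * X * C ^ 0 := by positivity
      linarith
    · rw [hc, he, he, if_neg (Nat.succ_ne_zero l), zero_add]
      have h1 := hkey (l + 1) (n + 1 - (l + 1) + 1) 1 (by omega)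
      have h2 := hkey l (n + 1 - (l + 1) + 1) 0 (by omega)
      have h3 : C ^ l ≤ C ^ (l + 1) := pow_le_pow_right₀ hC1 (Nat.le_succ l)
      have h4 : C ^ l * (s ^ (n + 1 - (l + 1) + 1) * (s ^ l + θ)) ≤ C ^ (l + 1) * X := by
        gcongr
      have h5 : C ^ (l + 1) * (s ^ (n + 1 - (l + 1) + 1) * (s ^ (l + 1) + θ)) ≤
          C ^ (l + 1) * X := by gcongr
      calc √T * s * (K * (B * C ^ (l + 1) * (s ^ (l + 1) + θ) + B * C ^ l * (s ^ l + θ))) *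
            s ^ (n + 1 - (l + 1))
          = C0 * B * (C ^ (l + 1) * (s ^ (n + 1 - (l + 1) + 1) * (s ^ (l + 1) + θ)) +
              C ^ l * (s ^ (n + 1 - (l + 1) + 1) * (s ^ l + θ))) := by rw [hC0, pow_succ s]; ring
        _ ≤ C0 * B * (C ^ (l + 1) * X + C ^ (l + 1) * X) := by gcongr
        _ = _ := by ring
  have hsum := Finset.sum_le_sum hterm
  rw [Finset.sum_add_distrib, Finset.sum_ite_eq' (Finset.range (n + 1)) 0, if_pos (by simp),
    ← Finset.mul_sum] at hsum
  have hgeo := geom_sum_mul C (n + 1)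
  set G := ∑ i ∈ Finset.range (n + 1), C ^ i with hG
  have hlast : √T * s * (K * e n) ≤ C0 * B * X * G := by
    rw [he]
    have h1 := hkey n 1 0 (by omega)
    have h2 : C ^ n ≤ G :=
      Finset.single_le_sum (f := fun i => C ^ i) (fun i _ => by positivity)
        (Finset.self_mem_range_succ n)
    calc √T * s * (K * (B * C ^ n * (s ^ n + θ))) = C0 * B * (s ^ 1 * (s ^ n + θ)) * C ^ n := by
          rw [hC0]; ring
      _ ≤ C0 * B * X * G := by gcongr
  have hβ : √T * s * β1 ≤ √T * β1 := by
    have : √T * β1 * s ≤ √T * β1 := mul_le_of_le_one_right (by positivity) hs1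
    nlinarith
  have hBs : (α + √T * β0) * s ^ (n + 1) ≤ B * s ^ (n + 1) := by gcongr
  have hfin : B * C ^ (n + 1) * X = B * X + 3 * C0 * B * X * G := by
    have : C ^ (n + 1) = G * (C - 1) + 1 := by linarith
    rw [this, hC]; ring
  rw [he (n + 1), ← hX, hfin, hX]
  rw [hX] at hsum hlast
  nlinarith

/-- The increment `F ∘ N l - F ∘ N (l - 1)` (with the second term absent for `l = 0`). -/
def levelIncrement {Y : Type*} (F : ℝ → ℝ) (N : ℕ → Y → ℝ) : ℕ → Y → ℝ
  | 0, y => F (N 0 y)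
  | l + 1, y => F (N (l + 1) y) - F (N l y)

theorem sum_levelIncrement {Y : Type*} (F : ℝ → ℝ) (N : ℕ → Y → ℝ) (n : ℕ) (y : Y) :
    ∑ l ∈ Finset.range (n + 1), levelIncrement F N l y = F (N n y) := by
  induction n with
  | zero => simp [levelIncrement]
  | succ n ih => rw [Finset.sum_range_succ, ih, levelIncrement]; ring

theorem measurable_levelIncrement {Y : Type*} [MeasurableSpace Y] {F : ℝ → ℝ} (hF : Measurable F)
    {N : ℕ → Y → ℝ} (l : ℕ) (h : ∀ j ≤ l, Measurable (N j)) :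
    Measurable (levelIncrement F N l) := by
  cases l with
  | zero => exact hF.comp (h 0 le_rfl)
  | succ l => exact (hF.comp (h (l + 1) le_rfl)).sub (hF.comp (h l (Nat.le_succ l)))

theorem LipschitzWith.abs_sub_le {K : NNReal} {F : ℝ → ℝ} (hF : LipschitzWith K F) (x y : ℝ) :
    |F x - F y| ≤ K * |x - y| := by
  simpa [Real.dist_eq] using hF.dist_le_mul x y

theorem L2Bound.comp_sub_comp {Y : Type*} [MeasurableSpace Y] {μ : Measure Y} {K : NNReal}
    {F : ℝ → ℝ} (hF : LipschitzWith K F) {φ ψ : Y → ℝ} {a : ℝ} (hφ : Measurable φ)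
    (hψ : Measurable ψ) (h : L2Bound μ (fun y => φ y - ψ y) a) :
    L2Bound μ (fun y => F (φ y) - F (ψ y)) (K * a) := by
  refine (h.const_mul K.coe_nonneg).mono_ae
    ((hF.continuous.measurable.comp hφ).sub (hF.continuous.measurable.comp hψ)) ?_
  refine Filter.Eventually.of_forall fun y => ?_
  rw [abs_mul, abs_of_nonneg K.coe_nonneg]
  exact hF.abs_sub_le _ _

/-- One step of the multilevel Picard iteration: previous levels with small `L²`-errors are
averaged over suitable sample points. -/
theorem exists_multilevel_step {d M : ℕ} {T : ℝ} (hT : 0 ≤ T) (hM : 0 < M)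
    {f : ℝ → ℝ} {v : ℝ × (Fin d → ℝ) → ℝ} {K : NNReal} {g u0 : (Fin d → ℝ) → ℝ}
    (hv : Measurable v)
    (hvint : ∀ t ∈ Icc 0 T, ∀ x,
      Integrable (fun ω => t * f (v (picardPoint t x ω))) (picardSample d))
    (hvfix : ∀ t ∈ Icc 0 T, ∀ x, v (t, x) = ∫ z, u0 (x + √(2 * t) • z) ∂(stdNormal d) +
      ∫ ω, t * f (v (picardPoint t x ω)) ∂(picardSample d))
    (hgm : Measurable g) (hu0 : Measurable u0) {α β1 β2 : ℝ}
    (hg : L2Bound (cubeNormal d) (fun p => g (p.1 + √(2 * T) • p.2)) α)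
    (hgu : L2Bound (cubeNormal d) (fun p => g (p.1 + √(2 * T) • p.2) -
      u0 (p.1 + √(2 * T) • p.2)) β2)
    {F : ℝ → ℝ} (hF : LipschitzWith K F) (n : ℕ) {N : ℕ → ℝ × (Fin d → ℝ) → ℝ}
    (hNm : ∀ l ≤ n, Measurable (N l)) {e : ℝ} {c : ℕ → ℝ}
    (hD : ∀ l ≤ n, L2Bound (picardMeasure d T M) (levelIncrement F N l) (c l))
    (hFf : L2Bound (picardMeasure d T M) (fun y => F (v y) - f (v y)) β1)
    (he : L2Bound (picardMeasure d T M) (fun y => N n y - v y) e) :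
    ∃ (z : Fin (M ^ (n + 1)) → Fin d → ℝ)
      (ω : (l : ℕ) → Fin (M ^ (n + 1 - l)) → ℝ × (Fin d → ℝ)),
      L2Bound (picardMeasure d T M) (fun y =>
        (∑ i, (1 / ((M ^ (n + 1) : ℕ) : ℝ)) * g (y.2 + √(2 * y.1) • z i)) +
          (∑ l ∈ Finset.range (n + 1), ∑ i, (1 / ((M ^ (n + 1 - l) : ℕ) : ℝ)) *
            (y.1 * levelIncrement F N l (picardPoint y.1 y.2 (ω l i)))) - v y)
        (α * (1 / √M) ^ (n + 1) + β2 +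
          ∑ l ∈ Finset.range (n + 1), √T * (1 / √M) * c l * (1 / √M) ^ (n + 1 - l) +
          √T * (1 / √M) * (K * e + β1)) := by
  have hM0 : (0 : ℝ) < M := Nat.cast_pos.2 hM
  have hM1 : (1 : ℝ) ≤ M := by exact_mod_cast hM
  have hFm := hF.continuous.measurable
  have hsq : √(T / M) = √T * (1 / √M) := by rw [Real.sqrt_div hT]; ring
  have hpow : ∀ j, √((M ^ j : ℕ) : ℝ) = √M ^ j := fun j => by
    rw [Nat.cast_pow, Real.sqrt_eq_iff_mul_self_eq (by positivity) (by positivity), ← mul_pow,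
      Real.mul_self_sqrt hM0.le]
  have hdm := fun l (hl : l ≤ n) =>
    measurable_levelIncrement hFm l (N := N) fun j hj => hNm j (hj.trans hl)
  have hgle := hg.lintegral_heat_le hT hM1 hgm
  have hdle := hgu.lintegral_heat_le (H := fun x => g x - u0 x) hT hM1 (hgm.sub hu0)
  have hDle := fun l hl => (hD l hl).lintegral_picardPoint_le hT hM0
  obtain ⟨z, hz⟩ := exists_average_l2Bound
    (h := fun (y : ℝ × (Fin d → ℝ)) z => g (y.2 + √(2 * y.1) • z))
    (measurable_comp_heat hgm) hg.nonneg hgle (pow_pos hM (n + 1))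
  have hω := fun l (hl : l ≤ n) => exists_average_l2Bound
    (h := fun (y : ℝ × (Fin d → ℝ)) ω => y.1 * levelIncrement F N l (picardPoint y.1 y.2 ω))
    (measurable_mul_comp_picardPoint (hdm l hl))
    (mul_nonneg (Real.sqrt_nonneg _) (hD l hl).nonneg) (hDle l hl) (pow_pos hM (n + 1 - l))
  choose! ω hω using hω
  have hE1 := L2Bound.integral (h := fun (y : ℝ × (Fin d → ℝ)) z => g (y.2 + √(2 * y.1) • z) -
    u0 (y.2 + √(2 * y.1) • z)) (measurable_comp_heat (hgm.sub hu0)) hgu.nonneg hdle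
  have hFv : L2Bound (picardMeasure d T M) (fun y => F (N n y) - f (v y)) (K * e + β1) := by
    have := (L2Bound.comp_sub_comp hF (hNm n le_rfl) hv he).add hFf
    simpa using this
  have hFvle := hFv.lintegral_picardPoint_le hT hM0
  have hE3 := L2Bound.integral (h := fun (y : ℝ × (Fin d → ℝ)) ω => y.1 *
    (F (N n (picardPoint y.1 y.2 ω)) - f (v (picardPoint y.1 y.2 ω))))
    (measurable_mul_comp_picardPoint hFv.measurable)
    (mul_nonneg (Real.sqrt_nonneg _) hFv.nonneg) hFvle
  have hE2 := L2Bound.sum (s := Finset.range (n + 1)) fun l hl =>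
    hω l (Nat.lt_succ_iff.1 (Finset.mem_range.1 hl))
  have hall := ((hz.add hE1).add hE2).add hE3
  have hbound : α / √((M ^ (n + 1) : ℕ) : ℝ) + β2 +
      ∑ l ∈ Finset.range (n + 1), √(T / M) * c l / √((M ^ (n + 1 - l) : ℕ) : ℝ) +
      √(T / M) * (K * e + β1) = α * (1 / √M) ^ (n + 1) + β2 +
          ∑ l ∈ Finset.range (n + 1), √T * (1 / √M) * c l * (1 / √M) ^ (n + 1 - l) +
          √T * (1 / √M) * (K * e + β1) := by
    simp only [hpow, hsq]
    have : ∀ (a : ℝ) (j : ℕ), a / √M ^ j = a * (1 / √M) ^ j := fun a j => by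
      rw [one_div, inv_pow, div_eq_mul_inv]
    simp only [this]
  rw [hbound] at hall
  refine ⟨z, ω, hall.mono_ae ?_ ?_⟩
  · refine ((Finset.measurable_fun_sum _ fun i _ => (Measurable.const_mul ?_ _)).add
      (Finset.measurable_fun_sum _ fun l hl => Finset.measurable_fun_sum _ fun i _ =>
        (Measurable.const_mul ?_ _))).sub hv
    · exact hgm.comp (by fun_prop)
    · exact (measurable_mul_comp_picardPoint
        (hdm l (Nat.lt_succ_iff.1 (Finset.mem_range.1 hl)))).comp measurable_prodMk_right
  · have hI1 := ae_memLp_two_of_lintegral_le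
      (h := fun (y : ℝ × (Fin d → ℝ)) z => g (y.2 + √(2 * y.1) • z))
      (measurable_comp_heat hgm) hgle
    have hI2 := ae_memLp_two_of_lintegral_le
      (h := fun (y : ℝ × (Fin d → ℝ)) z => g (y.2 + √(2 * y.1) • z) -
      u0 (y.2 + √(2 * y.1) • z)) (measurable_comp_heat (hgm.sub hu0)) hdle
    have hI3 : ∀ᵐ y ∂(picardMeasure d T M), ∀ l ∈ Finset.range (n + 1),
        MemLp (fun ω => y.1 * levelIncrement F N l (picardPoint y.1 y.2 ω)) 2
          (picardSample d) := by
      rw [Filter.eventually_all_finset]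
      intro l hl
      have hl' := Nat.lt_succ_iff.1 (Finset.mem_range.1 hl)
      exact ae_memLp_two_of_lintegral_le
        (h := fun (y : ℝ × (Fin d → ℝ)) ω => y.1 * levelIncrement F N l (picardPoint y.1 y.2 ω))
        (measurable_mul_comp_picardPoint (hdm l hl')) (hDle l hl')
    filter_upwards [hI1, hI2, hI3, ae_mem_picardMeasure (d := d) (b := M) hT]
      with y h1 h2 h3 hy
    have i1 := h1.integrable one_le_two
    have i2 := h2.integrable one_le_two
    have i3 := fun l hl => (h3 l hl).integrable one_le_two
    have iu : Integrable (fun z => u0 (y.2 + √(2 * y.1) • z)) (stdNormal d) := by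
      have := i1.sub i2
      refine this.congr (Filter.Eventually.of_forall fun z => ?_)
      simp
    have hint1 := integral_sub i1 iu
    have hint2 := integral_finsetSum (Finset.range (n + 1)) i3
    have iF := integrable_finsetSum (Finset.range (n + 1)) i3
    have hiv := hvint y.1 hy y.2
    simp only [← Finset.mul_sum, sum_levelIncrement] at hint2 iF
    have hint3 := integral_sub iF hiv
    simp only [← mul_sub] at hint3
    have hfix := hvfix y.1 hy y.2
    refine le_of_eq (congrArg abs ?_)
    rw [hint1, hint3, hint2, Finset.sum_sub_distrib, show v y = v (y.1, y.2) from rfl, hfix]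
    ring

theorem multilevel_width (W M n : ℕ) :
    (∑ _i : Fin (M ^ (n + 1)), W) +
      ∑ l ∈ Finset.range (n + 1), ∑ _i : Fin (M ^ (n + 1 - l)), 2 * (W * (3 * M) ^ l) =
      W * (3 * M) ^ (n + 1) := by
  have h3 : ∀ m : ℕ, 1 + ∑ l ∈ Finset.range m, 2 * 3 ^ l = 3 ^ m := by
    intro m
    induction m with
    | zero => simp
    | succ m ih => rw [Finset.sum_range_succ, ← add_assoc, ih, pow_succ]; ring
  have h : ∀ l ∈ Finset.range (n + 1), ∑ _i : Fin (M ^ (n + 1 - l)), 2 * (W * (3 * M) ^ l) =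
      M ^ (n + 1) * W * (2 * 3 ^ l) := by
    intro l hl
    have hl' : n + 1 = (n + 1 - l) + l := by have := Finset.mem_range.1 hl; omega
    rw [Finset.sum_const, Finset.card_univ, Fintype.card_fin, smul_eq_mul]
    conv_rhs => rw [hl', pow_add]
    rw [mul_pow]; ring
  rw [Finset.sum_congr rfl h, ← Finset.mul_sum, Finset.sum_const, Finset.card_univ,
    Fintype.card_fin, smul_eq_mul, mul_pow, ← h3 (n + 1)]
  ring

theorem rectNet_levelIncrement {d k W M : ℕ} (hW : 2 ≤ W) (hM : 0 < M) {F : ℝ → ℝ} {m : ℕ}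
    (hm : m ≤ W) {a b c : ℕ → ℝ} {c₀ : ℝ}
    (hF : ∀ y, F y = ∑ i ∈ Finset.range m, c i * max (a i * y + b i) 0 + c₀)
    {N : ℕ → ℝ × (Fin d → ℝ) → ℝ} {n l : ℕ} (hl : l ≤ n)
    (hN : ∀ j ≤ n, ∀ t, RectNet d (k + j) (W * (3 * M) ^ j) (fun x => N j (t, x))) (t : ℝ) :
    RectNet d (k + (n + 1)) (2 * (W * (3 * M) ^ l)) (fun x => levelIncrement F N l (t, x)) := by
  have hge : ∀ j, W ≤ W * (3 * M) ^ j := fun j => Nat.le_mul_of_pos_right _ (by positivity)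
  have hFN : ∀ j ≤ n, RectNet d (k + (n + 1)) (W * (3 * M) ^ j) (fun x => F (N j (t, x))) := by
    intro j hj
    have h := ((hN j hj t).comp_shallow a b c c₀ (hm.trans (hge j))).mono_depth
      (k' := k + (n + 1)) (hW.trans (hge j)) (by omega)
    simpa only [hF] using h
  rcases l with _ | l
  · exact (hFN 0 hl).mono (by omega)
  · have h := (hFN (l + 1) hl).add ((hFN l (by omega)).const_mul (-1))
    have hle : W * (3 * M) ^ l ≤ W * (3 * M) ^ (l + 1) :=
      Nat.mul_le_mul_left _ (Nat.pow_le_pow_right (by omega) (Nat.le_succ l))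
    convert h.mono (w' := 2 * (W * (3 * M) ^ (l + 1))) (by omega) using 2 with x
    simp only [levelIncrement]
    ring

theorem exists_multilevel_picard {d k W M : ℕ} {T : ℝ} (hT : 0 ≤ T) (hM : 0 < M) (hW : 2 ≤ W)
    {f : ℝ → ℝ} {v : ℝ × (Fin d → ℝ) → ℝ} {K : NNReal} {g u0 : (Fin d → ℝ) → ℝ}
    (hv : Measurable v)
    (hvint : ∀ t ∈ Icc 0 T, ∀ x,
      Integrable (fun ω => t * f (v (picardPoint t x ω))) (picardSample d))
    (hvfix : ∀ t ∈ Icc 0 T, ∀ x, v (t, x) = ∫ z, u0 (x + √(2 * t) • z) ∂(stdNormal d) +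
      ∫ ω, t * f (v (picardPoint t x ω)) ∂(picardSample d))
    (hgm : Measurable g) (hu0 : Measurable u0) (hgr : RectNet d k W g) {α β0 β1 β2 B θ : ℝ}
    (hg : L2Bound (cubeNormal d) (fun p => g (p.1 + √(2 * T) • p.2)) α)
    (hgu : L2Bound (cubeNormal d) (fun p => g (p.1 + √(2 * T) • p.2) -
      u0 (p.1 + √(2 * T) • p.2)) β2)
    {F : ℝ → ℝ} {m : ℕ} (hm : m ≤ W) {a b c : ℕ → ℝ} {c₀ : ℝ}
    (hF : ∀ y, F y = ∑ i ∈ Finset.range m, c i * max (a i * y + b i) 0 + c₀)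
    (hFK : LipschitzWith K F)
    (hFf : L2Bound (picardMeasure d T M) (fun y => F (v y) - f (v y)) β1)
    (hF0 : L2Bound (picardMeasure d T M) (fun _ => F 0) β0)
    (hvB : L2Bound (picardMeasure d T M) v B) (hθ : 0 ≤ θ)
    (hB : α + √T * β0 ≤ B) (hBθ : β2 + √T * β1 ≤ B * θ) (n : ℕ) :
    ∃ N : ℝ × (Fin d → ℝ) → ℝ, Measurable N ∧ (n = 0 → N = 0) ∧
      (∀ t, RectNet d (k + n) (W * (3 * M) ^ n) (fun x => N (t, x))) ∧
      L2Bound (picardMeasure d T M) (fun y => N y - v y)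
        (B * (1 + 3 * (√T * K)) ^ n * ((1 / √M) ^ n + θ)) := by
  have hM1 : (1 : ℝ) ≤ M := by exact_mod_cast hM
  have hBn := hvB.nonneg
  induction n using Nat.strong_induction_on with
  | _ n ih =>
  rcases n with _ | n
  · refine ⟨0, measurable_const, fun _ => rfl, fun t => RectNet.const _ _ _ 0, ?_⟩
    have h : L2Bound (picardMeasure d T M) (fun y => (0 : ℝ × (Fin d → ℝ) → ℝ) y - v y) B := by
      simpa using hvB.neg
    exact h.mono (by simp only [pow_zero, mul_one]; nlinarith)
  choose! N hNm hN0 hNr hNe using ih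
  set e : ℕ → ℝ := fun l => B * (1 + 3 * (√T * K)) ^ l * ((1 / √M) ^ l + θ) with he
  let cs : ℕ → ℝ := fun l => Nat.casesOn l β0 fun l => K * (e (l + 1) + e l)
  have hD : ∀ l ≤ n, L2Bound (picardMeasure d T M) (levelIncrement F N l) (cs l) := by
    intro l hl
    rcases l with _ | l
    · have : levelIncrement F N 0 = fun _ => F 0 := by
        funext y
        rw [levelIncrement, hN0 0 (by omega) rfl]
        rfl
      rw [this]
      exact hF0
    · have h := (hNe (l + 1) (by omega)).sub (hNe l (by omega))
      refine L2Bound.comp_sub_comp hFK (hNm _ (by omega)) (hNm _ (by omega)) ?_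
      simpa only [sub_sub_sub_cancel_right] using h
  obtain ⟨z, ω, hzω⟩ := exists_multilevel_step hT hM hv hvint hvfix hgm hu0 hg hgu hFK n
    (N := N) (fun l hl => hNm l (by omega)) hD hFf (hNe n (by omega))
  have hDm := fun l (hl : l ≤ n) => (hD l hl).measurable
  refine ⟨fun y => (∑ i, (1 / ((M ^ (n + 1) : ℕ) : ℝ)) * g (y.2 + √(2 * y.1) • z i)) +
      (∑ l ∈ Finset.range (n + 1), ∑ i, (1 / ((M ^ (n + 1 - l) : ℕ) : ℝ)) *
        (y.1 * levelIncrement F N l (picardPoint y.1 y.2 (ω l i)))),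
    ?_, fun h => absurd h (Nat.succ_ne_zero n), fun t => ?_, hzω.mono ?_⟩
  · convert hzω.measurable.add hv using 1
    funext y
    simp only [Pi.add_apply, sub_add_cancel]
  · have h1 : ∀ i ∈ Finset.univ, RectNet d (k + (n + 1)) W
        (fun x => (1 / ((M ^ (n + 1) : ℕ) : ℝ)) * g (x + √(2 * t) • z i)) := fun i _ =>
      ((hgr.mono_depth hW (Nat.le_add_right k (n + 1))).comp_add _).const_mul _
    have h2 : ∀ l ∈ Finset.range (n + 1), RectNet d (k + (n + 1))
        (∑ _i : Fin (M ^ (n + 1 - l)), 2 * (W * (3 * M) ^ l))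
        (fun x => ∑ i, (1 / ((M ^ (n + 1 - l) : ℕ) : ℝ)) *
          (t * levelIncrement F N l (picardPoint t x (ω l i)))) := by
      intro l hl
      have hl' := Nat.lt_succ_iff.1 (Finset.mem_range.1 hl)
      refine RectNet.sum _ _ _ fun i _ => RectNet.const_mul ?_ _
      refine RectNet.const_mul ?_ _
      exact (rectNet_levelIncrement hW hM hm hF hl' (fun j hj => hNr j (by omega))
        (t * (ω l i).1)).comp_add _
    have h := (RectNet.sum _ _ _ h1).add (RectNet.sum _ _ _ h2)
    rwa [multilevel_width] at h
  · exact multilevel_error_le (s := 1 / √M) K.coe_nonneg hg.nonneg hF0.nonneg hFf.nonneg hθ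
      (by positivity) (by rw [div_le_one (by positivity), Real.one_le_sqrt]; exact hM1)
      hB hBθ n (e := e) (c := cs) (fun _ => rfl) rfl (fun _ => rfl)

theorem RectNet.continuous {d k w : ℕ} {h : (Fin d → ℝ) → ℝ} (hN : RectNet d k w h) :
    Continuous h := by
  obtain ⟨X, h0, hs, a, b, hh⟩ := hN
  have hX : ∀ j ≤ k, ∀ i < w, Continuous (X j i) := by
    intro j
    induction j with
    | zero =>
      intro _ i hi
      obtain ⟨a, b, h⟩ := h0 i hi
      rw [funext h]
      fun_prop
    | succ j ih =>
      intro hj i hi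
      obtain ⟨a, b, h⟩ := hs j hj i hi
      rw [funext h]
      refine Continuous.max (Continuous.add (continuous_finsetSum _ fun l hl => ?_)
        continuous_const) continuous_const
      exact continuous_const.mul (ih (by omega) l (Finset.mem_range.1 hl))
  rw [funext hh]
  exact (continuous_finsetSum _ fun l hl => continuous_const.mul
    (hX k le_rfl l (Finset.mem_range.1 hl))).add continuous_const

theorem L2Bound.of_abs_le_mul {Y : Type*} [MeasurableSpace Y] {μ : Measure Y} {φ ψ : Y → ℝ}
    {a R : ℝ} (hψ : L2Bound μ ψ R) (hφ : Measurable φ) (ha : 0 ≤ a)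
    (h : ∀ y, |φ y| ≤ a * ψ y) : L2Bound μ φ (a * R) :=
  (hψ.const_mul ha).mono_ae hφ (Filter.Eventually.of_forall fun y => (h y).trans (le_abs_self _))

theorem exists_l2Bound_polyGrowth {κ T : ℝ} (hκ : 0 < κ) (hT : 0 ≤ T) :
    ∃ R : ℝ, 1 ≤ R ∧ ∀ d : ℕ, 0 < d →
      L2Bound (cubeNormal d) (fun p => polyGrowth κ (p.1 + √(2 * T) • p.2)) (R * (d : ℝ) ^ 2) ∧
      ∀ b, 1 ≤ b → L2Bound (picardMeasure d T b) (fun y => polyGrowth κ y.2 ^ 2)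
        (R * (d : ℝ) ^ 2) := by
  obtain ⟨C, hC1, hC⟩ := exists_lintegral_picardMeasure_polyGrowth_le hκ hT
  refine ⟨√C, by rwa [Real.one_le_sqrt], fun d hd => ?_⟩
  obtain ⟨h1, h2⟩ := hC d hd
  have hsq : (√C * (d : ℝ) ^ 2) ^ 2 = C * (d : ℝ) ^ 4 := by
    rw [mul_pow, Real.sq_sqrt (by linarith)]; ring
  have hm : Measurable (polyGrowth κ : (Fin d → ℝ) → ℝ) := (continuous_polyGrowth hκ).measurable
  refine ⟨⟨hm.comp (by fun_prop), by positivity, ?_⟩, fun b hb =>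
    ⟨(hm.comp measurable_snd).pow_const 2, by positivity, ?_⟩⟩
  · rw [hsq]
    refine (lintegral_mono fun p => ENNReal.ofReal_le_ofReal ?_).trans h1
    exact pow_le_pow_right₀ (one_le_polyGrowth _ _) (by norm_num)
  · rw [hsq]
    simp only [← pow_mul]
    refine (h2 b (by linarith)).trans ?_
    refine mul_le_of_le_one_left zero_le ?_
    rw [ENNReal.ofReal_le_one, div_le_one (by linarith)]
    exact hb

/-- Rectifier networks approximating a solution of the semilinear heat equation at time `T`,
with explicit size and `L²`-error. -/
theorem exists_rectNet_error {T κ : ℝ} (hT : 0 ≤ T) (hκ : 0 < κ) {f : ℝ → ℝ} {K : NNReal}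
    (hf : LipschitzWith K f) :
    ∃ R : ℝ, 1 ≤ R ∧ ∀ (d : ℕ), 0 < d → ∀ (u : ℝ → (Fin d → ℝ) → ℝ), IsC12On d 0 T u →
      (∀ t ∈ Icc (0 : ℝ) T, ∀ x, derivWithin (fun s => u s x) (Icc (0 : ℝ) T) t
        = laplacian d (u t) x + f (u t x)) →
      ∀ A : ℝ, 0 ≤ A → (∀ t ∈ Icc 0 T, ∀ x, |u t x| ≤ A * polyGrowth κ x) →
      ∀ n : ℕ, 0 < n → ∀ (k W : ℕ) (g : (Fin d → ℝ) → ℝ), RectNet d k W g → 2 ≤ W →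
      (∀ x, |g x - u 0 x| ≤ (1 / √n) ^ n * A * polyGrowth κ x) →
      ∀ q : ℕ, 0 < q → 4 * q ^ 2 ≤ W → √T * (2 * K * (1 + A ^ 2)) ≤ q * (1 / √n) ^ n →
      ∃ h : (Fin d → ℝ) → ℝ, RectNet d (k + n) (W * (3 * n) ^ n) h ∧
        ∫⁻ x in unitCube d, ENNReal.ofReal ((h x - u T x) ^ 2) ≤
          ENNReal.ofReal (n * Real.exp (n * T) *
            (2 * (R * (d : ℝ) ^ 2 * (2 * A + √T * (|f 0| + 2 * K) + 1)) *
              (1 + 3 * (√T * K)) ^ n * (1 / √n) ^ n) ^ 2) := by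
  obtain ⟨R, hR1, hR⟩ := exists_l2Bound_polyGrowth hκ hT
  refine ⟨R, hR1, fun d hd u hu hpde A hA hgr n hn k W g hgr' hW hgu q hq hqW hqn => ?_⟩
  obtain ⟨hR0, hR2⟩ := hR d hd
  have hn1 : (1 : ℝ) ≤ n := by exact_mod_cast hn
  replace hR2 := hR2 n hn1
  set S := R * (d : ℝ) ^ 2 with hS
  have hSn : 0 ≤ S := by positivity
  set θ : ℝ := (1 / √n) ^ n with hθ
  have hθ0 : 0 ≤ θ := by positivity
  have hθ1 : θ ≤ 1 := pow_le_one₀ (by positivity)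
    (by rw [div_le_one (by positivity), Real.one_le_sqrt]; exact hn1)
  have hq0 : (1 : ℝ) ≤ q := by exact_mod_cast hq
  obtain ⟨a, b, c, c₀, F, hF, hFK, hFf⟩ := hf.exists_shallow_approx hq
  have hclamp : ∀ t, max 0 (min t T) ∈ Icc 0 T := fun t =>
    ⟨le_max_left _ _, max_le hT (min_le_right _ _)⟩
  have hclamp' : ∀ t ∈ Icc 0 T, max 0 (min t T) = t := fun t ht => by
    rw [min_eq_left ht.2, max_eq_right ht.1]
  set v : ℝ × (Fin d → ℝ) → ℝ := fun y => u (max 0 (min y.1 T)) y.2 with hv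
  have hvm : Measurable v := by
    refine Continuous.measurable ?_
    exact hu.1.comp_continuous (f := fun y : ℝ × (Fin d → ℝ) => (max 0 (min y.1 T), y.2))
      (by fun_prop) fun y => ⟨hclamp _, mem_univ _⟩
  have hvabs : ∀ y, |v y| ≤ A * polyGrowth κ y.2 := fun y => hgr _ (hclamp _) _
  have hvae : ∀ t ∈ Icc 0 T, ∀ x, (fun ω => t * f (u (picardPoint t x ω).1 (picardPoint t x ω).2))
      =ᵐ[picardSample d] fun ω => t * f (v (picardPoint t x ω)) := by
    intro t ht x
    have hmem : ∀ᵐ ω ∂(picardSample d), ω.1 ∈ Icc (0 : ℝ) 1 :=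
      Measure.quasiMeasurePreserving_fst.ae (ae_restrict_mem measurableSet_Icc)
    filter_upwards [hmem] with ω hω
    have : (picardPoint t x ω).1 ∈ Icc 0 T :=
      ⟨mul_nonneg ht.1 hω.1, (mul_le_of_le_one_right ht.1 hω.2).trans ht.2⟩
    simp only [hv, hclamp' _ this]
  have hduh := fun t (ht : t ∈ Icc 0 T) x => duhamel hκ hA hf hu hpde hgr ht x
  have hΨ1 : ∀ x : Fin d → ℝ, 1 ≤ polyGrowth κ x := one_le_polyGrowth κ
  have hΨ2 : ∀ x : Fin d → ℝ, polyGrowth κ x ≤ polyGrowth κ x ^ 2 := fun x => by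
    nlinarith [hΨ1 x]
  have h0 : (0 : ℝ) ∈ Icc 0 T := ⟨le_rfl, hT⟩
  have hgm := hgr'.continuous.measurable
  have hu0m := (hu.continuous_slice h0).measurable
  have hsh : Measurable fun p : (Fin d → ℝ) × (Fin d → ℝ) => p.1 + √(2 * T) • p.2 := by fun_prop
  have hgα : L2Bound (cubeNormal d) (fun p => g (p.1 + √(2 * T) • p.2)) (2 * A * S) := by
    refine hR0.of_abs_le_mul (hgm.comp hsh) (by positivity) fun p => ?_
    set x := p.1 + √(2 * T) • p.2
    have h1 := hgu x
    have h2 := hgr 0 h0 x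
    have h3 : θ * A * polyGrowth κ x ≤ A * polyGrowth κ x := by
      have : 0 ≤ A * polyGrowth κ x := mul_nonneg hA (zero_le_one.trans (hΨ1 x))
      nlinarith
    have h4 : |g x| ≤ |g x - u 0 x| + |u 0 x| := by
      simpa using abs_add_le (g x - u 0 x) (u 0 x)
    linarith
  have hgβ : L2Bound (cubeNormal d) (fun p => g (p.1 + √(2 * T) • p.2) -
      u 0 (p.1 + √(2 * T) • p.2)) (θ * A * S) :=
    hR0.of_abs_le_mul ((hgm.comp hsh).sub (hu0m.comp hsh)) (by positivity) fun p => hgu _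
  have hFm := hFK.continuous.measurable
  have hfm := hf.continuous.measurable
  have hFv : L2Bound (picardMeasure d T n) (fun y => F (v y) - f (v y))
      (2 * K * (1 + A ^ 2) / q * S) := by
    refine hR2.of_abs_le_mul ((hFm.comp hvm).sub (hfm.comp hvm)) (by positivity) fun y => ?_
    refine (hFf _).trans ?_
    have h1 : v y ^ 2 ≤ (A * polyGrowth κ y.2) ^ 2 := by
      rw [← sq_abs]
      exact pow_le_pow_left₀ (abs_nonneg _) (hvabs y) 2
    have h2 : 1 ≤ polyGrowth κ y.2 ^ 2 := (hΨ1 _).trans (hΨ2 _)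
    have h3 : 1 + v y ^ 2 ≤ (1 + A ^ 2) * polyGrowth κ y.2 ^ 2 := by nlinarith
    calc 2 * (K : ℝ) * ((1 + v y ^ 2) / q) ≤
          2 * K * ((1 + A ^ 2) * polyGrowth κ y.2 ^ 2 / q) := by gcongr
      _ = _ := by ring
  have hF0 : L2Bound (picardMeasure d T n) (fun _ => F 0) ((|f 0| + 2 * K) * S) := by
    refine hR2.of_abs_le_mul measurable_const (by positivity) fun y => ?_
    have h1 := hFf 0
    have h2 : 2 * (K : ℝ) * ((1 + 0 ^ 2) / q) ≤ 2 * K := by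
      refine mul_le_of_le_one_right (by positivity) ?_
      rw [div_le_one (by positivity)]
      simpa using hq0
    have h3 : |F 0| ≤ |F 0 - f 0| + |f 0| := by simpa using abs_add_le (F 0 - f 0) (f 0)
    calc |F 0| ≤ |f 0| + 2 * K := by linarith
      _ ≤ _ := le_mul_of_one_le_right (by positivity) ((hΨ1 _).trans (hΨ2 _))
  have hvL : L2Bound (picardMeasure d T n) v (A * S) :=
    hR2.of_abs_le_mul hvm hA fun y => (hvabs y).trans (by gcongr; exact hΨ2 _)
  set E := √T * (|f 0| + 2 * K) with hE
  have hEn : 0 ≤ E := by positivity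
  obtain ⟨N, hNm, -, hNr, hNe⟩ := exists_multilevel_picard (k := k) (W := W) (M := n)
    (u0 := u 0) (B := S * (2 * A + E + 1)) (θ := θ) hT hn hW hvm
    (fun t ht x => (hduh t ht x).1.congr (hvae t ht x))
    (fun t ht x => by
      rw [← integral_congr_ae (hvae t ht x), ← (hduh t ht x).2, hv]
      simp only [hclamp' t ht])
    hgm hu0m hgr' hgα hgβ hqW hF hFK hFv hF0
    (hvL.mono (by nlinarith [mul_nonneg hSn hA, mul_nonneg hSn hEn])) hθ0
    (by rw [hE]; nlinarith)
    (by
      have h1 : √T * (2 * K * (1 + A ^ 2) / q * S) ≤ θ * S := by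
        have : √T * (2 * K * (1 + A ^ 2)) / q ≤ θ := by
          rw [div_le_iff₀ (by positivity), mul_comm θ]; exact hqn
        calc √T * (2 * K * (1 + A ^ 2) / q * S) = √T * (2 * K * (1 + A ^ 2)) / q * S := by ring
          _ ≤ θ * S := by gcongr
      nlinarith [mul_nonneg (mul_nonneg hSn hA) hθ0, mul_nonneg (mul_nonneg hSn hEn) hθ0]) n
  refine ⟨fun x => N (T, x), hNr T, ?_⟩
  have hend := lintegral_unitCube_le_picardMeasure (d := d) (T := T) (b := n)
    (G := fun y => ENNReal.ofReal ((N y - v y) ^ 2)) (hNe.measurable.pow_const 2).ennreal_ofReal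
  replace hend := hend.trans hNe.le
  have hvT : ∀ x, v (T, x) = u T x := fun x => by
    simp only [hv, hclamp' T ⟨hT, le_rfl⟩]
  simp only [hvT] at hend
  rw [show (1 / √(n : ℝ)) ^ n + θ = 2 * θ by rw [← hθ]; ring] at hend
  have hn0 : (0 : ℝ) < n := by linarith
  have hexp : n * Real.exp (n * T) * (Real.exp (-n * T) / n) = 1 := by
    rw [neg_mul, Real.exp_neg]
    field_simp
  calc ∫⁻ x in unitCube d, ENNReal.ofReal ((N (T, x) - u T x) ^ 2)
      = ENNReal.ofReal (n * Real.exp (n * T)) * (ENNReal.ofReal (Real.exp (-n * T) / n) *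
          ∫⁻ x in unitCube d, ENNReal.ofReal ((N (T, x) - u T x) ^ 2)) := by
        rw [← mul_assoc, ← ENNReal.ofReal_mul (by positivity), hexp, ENNReal.ofReal_one, one_mul]
    _ ≤ _ := by
      refine (mul_le_mul_right hend _).trans (le_of_eq ?_)
      rw [← ENNReal.ofReal_mul (by positivity)]
      congr 1
      ring

theorem exists_div_sqrt_pow_le {P : ℝ} (hP : 0 < P) :
    ∃ c : ℝ, 1 ≤ c ∧ ∀ m : ℕ, 0 < m → (P / √m) ^ m ≤ c := by
  have h1 : 1 ≤ max 1 P := le_max_left _ _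
  refine ⟨max 1 P ^ ⌈P ^ 2⌉₊, one_le_pow₀ h1, fun m hm => ?_⟩
  have hm1 : (1 : ℝ) ≤ m := by exact_mod_cast hm
  have hs : 1 ≤ √(m : ℝ) := by rwa [Real.one_le_sqrt]
  rcases le_total m ⌈P ^ 2⌉₊ with h | h
  · calc (P / √m) ^ m ≤ max 1 P ^ m := by
          gcongr
          exact (div_le_self hP.le hs).trans (le_max_right _ _)
      _ ≤ _ := pow_le_pow_right₀ h1 h
  · have h2 : P ^ 2 ≤ m := Nat.ceil_le.1 h
    have h3 : P ≤ √m := Real.le_sqrt_of_sq_le h2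
    exact (pow_le_one₀ (by positivity) ((div_le_one (by linarith)).2 h3)).trans (one_le_pow₀ h1)

/-- A superexponentially growing sequence can be stopped above any level `Y` while its variants
with a worse exponential factor remain polynomial in `Y`. -/
theorem exists_le_sqrt_div_pow {K : ℝ} (hK : 1 ≤ K) :
    ∃ c : ℝ, 1 ≤ c ∧ ∀ Y : ℝ, 1 ≤ Y → ∃ n : ℕ, 0 < n ∧ Y ≤ (√n / K) ^ n ∧
      (3 * √n) ^ n ≤ c * Y ^ 2 := by
  have hK0 : 0 < K := by linarith
  obtain ⟨c₁, -, h₁⟩ := exists_div_sqrt_pow_le (P := 2 * K) (by positivity)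
  obtain ⟨c₂, hc₂, h₂⟩ := exists_div_sqrt_pow_le (P := 12 * K ^ 2) (by positivity)
  refine ⟨6 * c₂, by linarith, fun Y hY => ?_⟩
  have hex : ∃ n : ℕ, 0 < n ∧ Y ≤ (√n / K) ^ n := by
    obtain ⟨m, hm⟩ := pow_unbounded_of_one_lt (c₁ * Y) (one_lt_two (α := ℝ))
    refine ⟨m + 1, by omega, ?_⟩
    have hs : 0 < √((m + 1 : ℕ) : ℝ) := Real.sqrt_pos.2 (by positivity)
    have h := h₁ (m + 1) (by omega)
    have hc : 0 < c₁ := lt_of_lt_of_le (by positivity) h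
    have h2 : (2 : ℝ) ^ m ≤ 2 ^ (m + 1) := pow_le_pow_right₀ one_le_two (by omega)
    have h3 : (2 : ℝ) ^ (m + 1) =
        (2 * K / √((m + 1 : ℕ) : ℝ)) ^ (m + 1) * (√((m + 1 : ℕ) : ℝ) / K) ^ (m + 1) := by
      rw [← mul_pow]
      congr 1
      field_simp
    have h4 : (2 * K / √((m + 1 : ℕ) : ℝ)) ^ (m + 1) * (√((m + 1 : ℕ) : ℝ) / K) ^ (m + 1) ≤
        c₁ * (√((m + 1 : ℕ) : ℝ) / K) ^ (m + 1) := by gcongr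
    exact le_of_mul_le_mul_left (by linarith) hc
  classical
  refine ⟨Nat.find hex, (Nat.find_spec hex).1, (Nat.find_spec hex).2, ?_⟩
  have hpos := (Nat.find_spec hex).1
  obtain ⟨m, hm⟩ : ∃ m, Nat.find hex = m + 1 := ⟨_, (Nat.succ_pred_eq_of_pos hpos).symm⟩
  rcases Nat.eq_zero_or_pos m with rfl | hm0
  · rw [hm]
    norm_num
    nlinarith
  · have hlt : (√m / K) ^ m < Y := by
      have := Nat.find_min hex (m := m) (by omega)
      push Not at this
      exact this hm0
    rw [hm]
    have hm1 : (1 : ℝ) ≤ m := by exact_mod_cast hm0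
    have hs : 1 ≤ √(m : ℝ) := by rwa [Real.one_le_sqrt]
    have hs2 : √((m + 1 : ℕ) : ℝ) ≤ 2 * √m := by
      rw [show 2 * √(m : ℝ) = √(4 * m) by
        rw [Real.sqrt_mul (by norm_num), show (4 : ℝ) = 2 ^ 2 by norm_num,
          Real.sqrt_sq (by norm_num)]]
      apply Real.sqrt_le_sqrt
      push_cast
      linarith
    have hs3 : √(m : ℝ) ≤ 2 ^ m := by
      have h : (m : ℝ) ≤ 2 ^ m := by exact_mod_cast Nat.lt_two_pow_self.le
      refine le_trans ?_ h
      rw [Real.sqrt_le_left (by linarith)]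
      nlinarith
    calc (3 * √((m + 1 : ℕ) : ℝ)) ^ (m + 1) ≤ (3 * (2 * √m)) ^ (m + 1) := by gcongr
      _ = (6 * √m) ^ m * 6 * √m := by ring
      _ ≤ (6 * √m) ^ m * 6 * 2 ^ m := by gcongr
      _ = 6 * (12 * √m) ^ m := by
        rw [show (12 : ℝ) * √m = 6 * √m * 2 by ring, mul_pow (6 * √(m : ℝ)) 2 m]
        ring
      _ = 6 * (12 * K ^ 2 / √m) ^ m * ((√m / K) ^ m) ^ 2 := by
        rw [← pow_mul, mul_comm m 2, pow_mul, mul_assoc, ← mul_pow]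
        congr 2
        field_simp
      _ ≤ 6 * c₂ * Y ^ 2 := by
        have := h₂ m hm0
        gcongr

/-- `X` is bounded from above by a monomial in `y`. -/
def PolyBounded {ι : Type*} (y X : ι → ℝ) : Prop :=
  ∃ (c : ℝ) (p : ℕ), 0 ≤ c ∧ ∀ i, X i ≤ c * y i ^ p

namespace PolyBounded

variable {ι : Type*} {y X X' : ι → ℝ}

theorem mono (hX : PolyBounded y X) (h : ∀ i, X' i ≤ X i) : PolyBounded y X' := by
  obtain ⟨c, p, hc, hX⟩ := hX
  exact ⟨c, p, hc, fun i => (h i).trans (hX i)⟩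

theorem const (y : ι → ℝ) {a : ℝ} (ha : 0 ≤ a) : PolyBounded y fun _ => a :=
  ⟨a, 0, ha, fun i => by simp⟩

theorem self (y : ι → ℝ) : PolyBounded y y := ⟨1, 1, zero_le_one, fun i => by simp⟩

theorem add (hy : ∀ i, 1 ≤ y i) (hX : PolyBounded y X) (hX' : PolyBounded y X') :
    PolyBounded y fun i => X i + X' i := by
  obtain ⟨c, p, hc, hX⟩ := hX
  obtain ⟨c', p', hc', hX'⟩ := hX'
  refine ⟨c + c', p + p', by positivity, fun i => ?_⟩
  have h1 : y i ^ p ≤ y i ^ (p + p') := pow_le_pow_right₀ (hy i) (by omega)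
  have h2 : y i ^ p' ≤ y i ^ (p + p') := pow_le_pow_right₀ (hy i) (by omega)
  rw [add_mul]
  exact add_le_add ((hX i).trans (by gcongr)) ((hX' i).trans (by gcongr))

theorem mul (hy : ∀ i, 1 ≤ y i) (hX : PolyBounded y X) (hX' : PolyBounded y X')
    (h0 : ∀ i, 0 ≤ X' i) : PolyBounded y fun i => X i * X' i := by
  obtain ⟨c, p, hc, hX⟩ := hX
  obtain ⟨c', p', hc', hX'⟩ := hX'
  refine ⟨c * c', p + p', by positivity, fun i => ?_⟩
  have hyi : 0 ≤ y i := zero_le_one.trans (hy i)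
  calc X i * X' i ≤ c * y i ^ p * (c' * y i ^ p') :=
        mul_le_mul (hX i) (hX' i) (h0 i) (by positivity)
    _ = _ := by ring

theorem sq (hy : ∀ i, 1 ≤ y i) (hX : PolyBounded y X) (h0 : ∀ i, 0 ≤ X i) :
    PolyBounded y fun i => X i ^ 2 :=
  (hX.mul hy hX h0).mono fun _ => (pow_two _).le

theorem rpow (hy : ∀ i, 1 ≤ y i) (hX : PolyBounded y X) (h0 : ∀ i, 0 ≤ X i) {a : ℝ}
    (ha : 0 ≤ a) : PolyBounded y fun i => X i ^ a := by
  obtain ⟨c, p, hc, hX⟩ := hX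
  refine ⟨c ^ a, ⌈p * a⌉₊, by positivity, fun i => ?_⟩
  have hyi : 0 ≤ y i := zero_le_one.trans (hy i)
  calc X i ^ a ≤ (c * y i ^ p) ^ a := Real.rpow_le_rpow (h0 i) (hX i) ha
    _ = c ^ a * y i ^ (p * a) := by
      rw [Real.mul_rpow hc (by positivity), ← Real.rpow_natCast, ← Real.rpow_mul hyi]
    _ ≤ c ^ a * y i ^ (⌈p * a⌉₊ : ℝ) := by
      gcongr
      · exact hy i
      · exact Nat.le_ceil _
    _ = _ := by rw [Real.rpow_natCast]

end PolyBounded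

theorem pow_div_le_rpow_mul {c d ε : ℝ} (hc : 0 ≤ c) (hd : 1 ≤ d) (hε : ε ∈ Ioc (0 : ℝ) 1)
    (p : ℕ) {C : ℝ} (hcC : c ≤ C) (hpC : (p : ℝ) ≤ C) :
    c * (d / ε) ^ p ≤ C * d ^ C * ε ^ (-C) := by
  have hε0 := hε.1
  have h1 : 1 ≤ d / ε := (one_le_div hε0).2 (hε.2.trans hd)
  calc c * (d / ε) ^ p = c * (d / ε) ^ (p : ℝ) := by rw [Real.rpow_natCast]
    _ ≤ C * (d / ε) ^ C := by
      have hC : 0 ≤ C := hc.trans hcC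
      exact mul_le_mul hcC (Real.rpow_le_rpow_of_exponent_le h1 hpC) (by positivity) hC
    _ = _ := by rw [Real.div_rpow (by linarith) hε0.le, Real.rpow_neg hε0.le]; ring

theorem setIntegral_sq_rpow_le {d : ℕ} {v h : (Fin d → ℝ) → ℝ} (hv : Continuous v)
    (hh : Continuous h) {ε : ℝ} (hε : 0 ≤ ε)
    (hle : ∫⁻ x in unitCube d, ENNReal.ofReal ((h x - v x) ^ 2) ≤ ENNReal.ofReal (ε ^ 2)) :
    (∫ x in unitCube d, |v x - h x| ^ 2) ^ (1 / 2 : ℝ) ≤ ε := by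
  have hint : ∫ x in unitCube d, |v x - h x| ^ 2 ≤ ε ^ 2 := by
    rw [integral_eq_lintegral_of_nonneg_ae (Filter.Eventually.of_forall fun x => by positivity)
      (by fun_prop)]
    refine ENNReal.toReal_le_of_le_ofReal (by positivity) ?_
    simpa only [sq_abs, sub_sq_comm] using hle
  have h0 : 0 ≤ ∫ x in unitCube d, |v x - h x| ^ 2 := integral_nonneg fun x => by positivity
  calc _ ≤ (ε ^ 2) ^ (1 / 2 : ℝ) := Real.rpow_le_rpow h0 hint (by norm_num)
    _ = ε := by rw [← Real.sqrt_eq_rpow, Real.sqrt_sq hε]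

theorem error_le_sq {n : ℕ} (hn : 0 < n) {T B C ε : ℝ} (hT : 0 ≤ T) (hB : 0 ≤ B) (hC : 1 ≤ C)
    (hε : 0 < ε) (h : 2 * B / ε ≤ (√n / (2 * Real.exp T * C)) ^ n) :
    n * Real.exp (n * T) * (2 * B * C ^ n * (1 / √n) ^ n) ^ 2 ≤ ε ^ 2 := by
  have hn0 : (0 : ℝ) < n := by exact_mod_cast hn
  have hs : 0 < √(n : ℝ) := Real.sqrt_pos.2 hn0
  have hC0 : 0 < C := by linarith
  have h1 : (n : ℝ) ≤ (2 ^ n) ^ 2 := by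
    have h2 : (n : ℝ) ≤ 2 ^ n := by exact_mod_cast Nat.lt_two_pow_self.le
    have h3 : (1 : ℝ) ≤ 2 ^ n := one_le_pow₀ one_le_two
    nlinarith
  have h2 : Real.exp (n * T) ≤ (Real.exp T ^ n) ^ 2 := by
    rw [← Real.exp_nat_mul, ← Real.exp_nat_mul, Real.exp_le_exp]
    push_cast
    nlinarith [mul_nonneg hn0.le hT]
  have h3 : 2 * B * ((2 * Real.exp T * C) * (1 / √n)) ^ n ≤ ε := by
    have h4 : (√n / (2 * Real.exp T * C)) ^ n * ((2 * Real.exp T * C) * (1 / √n)) ^ n = 1 := by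
      rw [← mul_pow]
      convert one_pow n
      field_simp
    have h5 : 0 < ((2 * Real.exp T * C) * (1 / √(n : ℝ))) ^ n := by positivity
    rw [div_le_iff₀ hε] at h
    calc _ ≤ (√n / (2 * Real.exp T * C)) ^ n * ε * ((2 * Real.exp T * C) * (1 / √n)) ^ n := by
          gcongr
      _ = ((√n / (2 * Real.exp T * C)) ^ n * ((2 * Real.exp T * C) * (1 / √n)) ^ n) * ε := by ring
      _ = ε := by rw [h4, one_mul]
  calc n * Real.exp (n * T) * (2 * B * C ^ n * (1 / √n) ^ n) ^ 2
      ≤ (2 ^ n) ^ 2 * (Real.exp T ^ n) ^ 2 * (2 * B * C ^ n * (1 / √n) ^ n) ^ 2 := by gcongr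
    _ = (2 * B * ((2 * Real.exp T * C) * (1 / √n)) ^ n) ^ 2 := by
      simp only [mul_pow]; ring
    _ ≤ ε ^ 2 := by gcongr

end

/-- **Deep neural networks overcome the curse of dimensionality in the approximation of
semilinear heat PDEs** (Theorem 4.2; special case of the main result of Hutzenthaler,
Jentzen, Kruse & Nguyen 2020). -/
theorem dnn_approximation_semilinear_heat
    (T κ : ℝ) (hT : 0 < T) (hκ : 0 < κ)
    (g : ℕ → ℝ → NeuralNet)
    (u : (d : ℕ) → ℝ → (Fin d → ℝ) → ℝ)
    (f : ℝ → ℝ) (hf : ∃ K : NNReal, LipschitzWith K f)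
    (hu : ∀ d : ℕ, IsC12On d 0 T (u d))
    (hpde : ∀ d : ℕ, ∀ t ∈ Icc (0:ℝ) T, ∀ x : Fin d → ℝ,
      derivWithin (fun s => u d s x) (Icc (0:ℝ) T) t
        = laplacian d (u d t) x + f (u d t x))
    (hgdim : ∀ d : ℕ, 0 < d → ∀ ε ∈ Set.Ioc (0:ℝ) 1,
      (g d ε).l 0 = d ∧ (g d ε).l (g d ε).L = 1)
    (hgapprox : ∀ (d : ℕ) (hd : 0 < d) (ε : ℝ) (hε : ε ∈ Set.Ioc (0:ℝ) 1),
      ∀ t ∈ Icc (0:ℝ) T, ∀ x : Fin d → ℝ,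
        ε * |u d t x|
            + |u d 0 x - (g d ε).realizeScalar (hgdim d hd ε hε).1 (hgdim d hd ε hε).2 x|
          ≤ ε * κ * (d : ℝ) ^ κ * (1 + ∑ i, |x i| ^ κ))
    (hgparams : ∀ (d : ℕ), 0 < d → ∀ ε ∈ Set.Ioc (0:ℝ) 1,
      ((g d ε).params : ℝ) ≤ κ * (d : ℝ) ^ κ * ε ^ (-κ)) :
    ∃ (𝔲 : ℕ → ℝ → NeuralNet) (c : ℝ), ∀ (d : ℕ), 0 < d → ∀ ε ∈ Set.Ioc (0:ℝ) 1,
      ∃ (h0 : (𝔲 d ε).l 0 = d) (h1 : (𝔲 d ε).l (𝔲 d ε).L = 1),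
        ((𝔲 d ε).params : ℝ) ≤ c * (d : ℝ) ^ c * ε ^ (-c) ∧
        (∫ x in Set.univ.pi (fun _ : Fin d => Icc (0:ℝ) 1),
            |u d T x - (𝔲 d ε).realizeScalar h0 h1 x| ^ 2) ^ (1/2 : ℝ) ≤ ε := by
  obtain ⟨K, hf⟩ := hf
  obtain ⟨R, hR1, hR⟩ := exists_rectNet_error hT.le hκ hf
  set C : ℝ := 1 + 3 * (√T * K) with hC
  have hC1 : 1 ≤ C := le_add_of_nonneg_right (by positivity)
  have hexp1 : 1 ≤ Real.exp T := Real.one_le_exp hT.le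
  obtain ⟨c₁, hc₁, hsel⟩ := exists_le_sqrt_div_pow (K := 2 * Real.exp T * C) (by nlinarith)
  have h0T : (0 : ℝ) ∈ Icc 0 T := ⟨le_rfl, hT.le⟩
  let I := {i : ℕ × ℝ // 0 < i.1 ∧ i.2 ∈ Ioc (0 : ℝ) 1}
  let d : I → ℕ := fun i => i.1.1
  let ε : I → ℝ := fun i => i.1.2
  let y : I → ℝ := fun i => d i / ε i
  have hd0 : ∀ i, 0 < d i := fun i => i.2.1
  have hd1 : ∀ i, (1 : ℝ) ≤ d i := fun i => by exact_mod_cast hd0 i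
  have hε : ∀ i, ε i ∈ Ioc (0 : ℝ) 1 := fun i => i.2.2
  have hdy : ∀ i, (d i : ℝ) ≤ y i := fun i => le_div_self (by positivity) (hε i).1 (hε i).2
  have hy : ∀ i, 1 ≤ y i := fun i => (hd1 i).trans (hdy i)
  have hεy : ∀ i, (ε i)⁻¹ ≤ y i := fun i => by
    have := (hε i).1
    rw [← one_div]
    exact div_le_div_of_nonneg_right (hd1 i) this.le
  let A : I → ℝ := fun i => κ * (d i : ℝ) ^ κ
  have hA0 : ∀ i, 0 ≤ A i := fun i => by positivity
  let B : I → ℝ := fun i => R * (d i : ℝ) ^ 2 * (2 * A i + √T * (|f 0| + 2 * K) + 1)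
  have hB1 : ∀ i, 1 ≤ B i := fun i => by
    have h1 : (1 : ℝ) ≤ d i ^ 2 := one_le_pow₀ (hd1 i)
    have h2 : 0 ≤ √T * (|f 0| + 2 * K) := by positivity
    have h3 : 1 ≤ R * (d i : ℝ) ^ 2 := by nlinarith
    exact one_le_mul_of_one_le_of_one_le h3 (by linarith [hA0 i])
  have hY1 : ∀ i, 1 ≤ 2 * B i / ε i := fun i => by
    rw [one_le_div (hε i).1]
    linarith [hB1 i, (hε i).2]
  choose n hn hYn hZ using fun i => hsel _ (hY1 i)
  have hn1 : ∀ i, (1 : ℝ) ≤ n i := fun i => by exact_mod_cast hn i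
  have hs1 : ∀ i, 1 ≤ √(n i : ℝ) := fun i => by rw [Real.one_le_sqrt]; exact hn1 i
  let θ : I → ℝ := fun i => (1 / √(n i)) ^ n i
  have hθ : ∀ i, θ i ∈ Ioc (0 : ℝ) 1 := fun i =>
    have := hs1 i
    ⟨by positivity, pow_le_one₀ (by positivity) ((div_le_one (by positivity)).2 this)⟩
  let q : I → ℕ := fun i => ⌈√T * (2 * K * (1 + A i ^ 2)) * (θ i)⁻¹⌉₊ + 1
  have hq : ∀ i, √T * (2 * K * (1 + A i ^ 2)) ≤ q i * θ i := fun i => by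
    have h1 := Nat.le_ceil (√T * (2 * K * (1 + A i ^ 2)) * (θ i)⁻¹)
    rw [← div_eq_mul_inv, div_le_iff₀ (hθ i).1] at h1
    refine h1.trans (mul_le_mul_of_nonneg_right ?_ (hθ i).1.le)
    simp [q, div_eq_mul_inv]
  let P : I → ℕ := fun i => (g (d i) (θ i)).params
  let W : I → ℕ := fun i => P i + 4 * q i ^ 2 + 2
  have hnet : ∀ i : I, ∃ (Φ : NeuralNet) (h0 : Φ.l 0 = d i) (h1 : Φ.l Φ.L = 1),
      Φ.params ≤ (P i + n i + 2) * (W i * (3 * n i) ^ n i + d i + 1) ^ 2 ∧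
      (∫ x in unitCube (d i), |u (d i) T x - Φ.realizeScalar h0 h1 x| ^ 2) ^ (1 / 2 : ℝ)
        ≤ ε i := by
    intro i
    have hap := hgapprox (d i) (hd0 i) (θ i) (hθ i)
    obtain ⟨e0, e1⟩ := hgdim (d i) (hd0 i) (θ i) (hθ i)
    obtain ⟨h, hN, herr⟩ := hR (d i) (hd0 i) (u (d i)) (hu _) (hpde _) (A i) (hA0 i)
      (fun t ht x => by
        have h1 := hap t ht x
        have h2 : θ i * |u (d i) t x| ≤ θ i * (A i * polyGrowth κ x) := by
          refine (le_add_of_nonneg_right (abs_nonneg _)).trans (h1.trans (le_of_eq ?_))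
          simp only [A, polyGrowth]
          ring
        exact le_of_mul_le_mul_left h2 (hθ i).1)
      (n i) (hn i) (g (d i) (θ i)).depth (W i) _
      ((g (d i) (θ i)).rectNet e0 e1 (w := W i) (by simp only [W, P]; omega)
        (by simp only [W]; omega)) (by simp only [W]; omega)
      (fun x => by
        have h1 := hap 0 h0T x
        rw [abs_sub_comm]
        refine (le_add_of_nonneg_left (mul_nonneg (hθ i).1.le (abs_nonneg _))).trans
          (h1.trans (le_of_eq ?_))
        simp only [A, polyGrowth, θ]
        ring)
      (q i) (by simp only [q]; omega) (by simp only [W]; omega) (hq i)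
    have hw : 0 < W i * (3 * n i) ^ n i :=
      Nat.mul_pos (by simp only [W]; omega) (Nat.pow_pos (by have := hn i; omega))
    obtain ⟨Φ, h0, h1, hΦ, hΦh⟩ := hN.exists_neuralNet (hd0 i) hw
    refine ⟨Φ, h0, h1, hΦ.trans ?_, ?_⟩
    · have := (g (d i) (θ i)).depth_le_params
      gcongr
    · simp only [hΦh]
      refine setIntegral_sq_rpow_le ((hu _).continuous_slice ⟨hT.le, le_rfl⟩) hN.continuous
        (hε i).1.le (herr.trans (ENNReal.ofReal_le_ofReal ?_))
      exact error_le_sq (hn i) hT.le (zero_le_one.trans (hB1 i)) hC1 (hε i).1 (hYn i)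
  have hpb : PolyBounded y fun i =>
      ((P i : ℝ) + n i + 2) * (W i * (3 * n i) ^ n i + d i + 1) ^ 2 := by
    have pd : PolyBounded y fun i => (d i : ℝ) := (PolyBounded.self y).mono hdy
    have pA : PolyBounded y A := (PolyBounded.const y hκ.le).mul hy
      (pd.rpow hy (fun i => by positivity) hκ.le) fun i => by positivity
    have pB : PolyBounded y B := by
      refine ((PolyBounded.const y (by positivity)).mul hy (pd.sq hy fun i => by positivity)
        fun i => by positivity).mul hy ((((PolyBounded.const y zero_le_two).mul hy pA hA0).add hy
        (PolyBounded.const y (by positivity))).add hy (PolyBounded.const y zero_le_one)) fun i => ?_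
      have := hA0 i
      positivity
    have pY : PolyBounded y fun i => 2 * B i / ε i :=
      ((PolyBounded.const y zero_le_two).mul hy pB fun i => zero_le_one.trans (hB1 i)).mul hy
        ((PolyBounded.self y).mono hεy) fun i => inv_nonneg.2 (hε i).1.le
    have pZ : PolyBounded y fun i => (3 * √(n i)) ^ n i :=
      ((PolyBounded.const y (by positivity)).mul hy
        (pY.sq hy fun i => zero_le_one.trans (hY1 i)) fun i => by positivity).mono hZ
    have pθ : PolyBounded y fun i => (θ i)⁻¹ := pZ.mono fun i => by
      simp only [θ, one_div, inv_pow, inv_inv]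
      have := hs1 i
      gcongr
      linarith
    have pn : PolyBounded y fun i => (n i : ℝ) := pZ.mono fun i => by
      have h1 : (n i : ℝ) ≤ 2 ^ n i := by exact_mod_cast Nat.lt_two_pow_self.le
      have := hs1 i
      exact h1.trans (pow_le_pow_left₀ zero_le_two (by linarith) _)
    have pnn : PolyBounded y fun i => (3 * (n i : ℝ)) ^ n i :=
      (pZ.sq hy fun i => by positivity).mono fun i => by
        rw [← pow_mul, mul_comm (n i) 2, pow_mul, mul_pow 3 (√(n i : ℝ)),
          Real.sq_sqrt (by positivity)]
        gcongr
        norm_num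
    have pP : PolyBounded y fun i => (P i : ℝ) :=
      (pA.mul hy (pθ.rpow hy (fun i => inv_nonneg.2 (hθ i).1.le) hκ.le) fun i =>
        Real.rpow_nonneg (inv_nonneg.2 (hθ i).1.le) _).mono fun i => by
          rw [Real.inv_rpow (hθ i).1.le, ← Real.rpow_neg (hθ i).1.le]
          exact hgparams (d i) (hd0 i) (θ i) (hθ i)
    have pq : PolyBounded y fun i => (q i : ℝ) := by
      refine ((((PolyBounded.const y (Real.sqrt_nonneg T)).mul hy
        ((PolyBounded.const y (a := 2 * K) (by positivity)).mul hy
        ((PolyBounded.const y zero_le_one).add hy (pA.sq hy hA0)) fun i => by positivity)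
        fun i => by positivity).mul hy pθ fun i => inv_nonneg.2 (hθ i).1.le).add hy
        (PolyBounded.const y zero_le_two)).mono fun i => ?_
      have h1 : 0 ≤ √T * (2 * K * (1 + A i ^ 2)) * (θ i)⁻¹ :=
        mul_nonneg (by positivity) (inv_nonneg.2 (hθ i).1.le)
      have h2 := Nat.ceil_lt_add_one h1
      simp only [q, Nat.cast_add, Nat.cast_one]
      linarith
    have pW : PolyBounded y fun i => (W i : ℝ) := by
      refine ((pP.add hy ((PolyBounded.const y (a := 4) (by norm_num)).mul hy
        (pq.sq hy fun i => by positivity) fun i => by positivity)).add hy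
        (PolyBounded.const y zero_le_two)).mono fun i => ?_
      simp [W]
    exact ((pP.add hy pn).add hy (PolyBounded.const y zero_le_two)).mul hy
      ((((pW.mul hy pnn fun i => by positivity).add hy pd).add hy
        (PolyBounded.const y zero_le_one)).sq hy fun i => by positivity) fun i => by positivity
  obtain ⟨c, p, hc, hcp⟩ := hpb
  have key : ∀ (d : ℕ) (ε : ℝ), ∃ Φ : NeuralNet, 0 < d → ε ∈ Ioc (0 : ℝ) 1 →
      ∃ (h0 : Φ.l 0 = d) (h1 : Φ.l Φ.L = 1),
        (Φ.params : ℝ) ≤ max c p * (d : ℝ) ^ max c p * ε ^ (-max c p) ∧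
        (∫ x in unitCube d, |u d T x - Φ.realizeScalar h0 h1 x| ^ 2) ^ (1 / 2 : ℝ) ≤ ε := by
    intro d' ε'
    by_cases h : 0 < d' ∧ ε' ∈ Ioc (0 : ℝ) 1
    · let i : I := ⟨(d', ε'), h⟩
      obtain ⟨Φ, h0, h1, hΦ, herr⟩ := hnet i
      refine ⟨Φ, fun _ _ => ⟨h0, h1, ?_, herr⟩⟩
      refine le_trans ?_ ((hcp i).trans
        (pow_div_le_rpow_mul hc (hd1 i) (hε i) p (le_max_left c p) (le_max_right c p)))
      beta_reduce
      exact_mod_cast hΦ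
    · exact ⟨g d' ε', fun h1 h2 => (h ⟨h1, h2⟩).elim⟩
  choose 𝔲 h𝔲 using key
  exact ⟨𝔲, max c p, fun d hd ε hε => h𝔲 d ε hd hε⟩

end
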